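/- Fix R > 0. Uniformly for x ≥ 3, 1 ≤ k ≤ R log₂ x, and every set P of primes contained in [2, x] with ∑_{p ∈ P} 1/p = o(1) as x → ∞, the number of integers 1 < n ≤ x such that ω(n−1) = k and n has a prime factor in P is o(π_k(x)). -/

import Mathlib

open Finset Real

/-- `π_k(x) := #{n ≤ x : ω(n) = k}`. -/
noncomputable def pik (k : ℕ) (x : ℝ) : ℕ :=
  ((Finset.Icc 1 ⌊x⌋₊).filter (fun n => n.primeFactors.card = k)).card

/-- The elementary symmetric sum of degree `j` in the values `g p`, `p ∈ Q`. -/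
noncomputable def esum (Q : Finset ℕ) (g : ℕ → ℝ) (j : ℕ) : ℝ :=
  ∑ D ∈ Q.powersetCard j, ∏ p ∈ D, g p

lemma esum_zero (Q : Finset ℕ) (g : ℕ → ℝ) : esum Q g 0 = 1 := by
  simp [esum]

lemma esum_empty_succ (g : ℕ → ℝ) (j : ℕ) : esum ∅ g (j + 1) = 0 := by
  rw [esum, Finset.powersetCard_eq_empty.2 (by simp), Finset.sum_empty]

lemma esum_insert {Q : Finset ℕ} {a : ℕ} (ha : a ∉ Q) (g : ℕ → ℝ) (j : ℕ) :
    esum (insert a Q) g (j + 1) = esum Q g (j + 1) + g a * esum Q g j := by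
  unfold esum
  rw [Finset.powersetCard_succ_insert ha, Finset.sum_union, Finset.sum_image, Finset.mul_sum]
  · congr 1
    refine Finset.sum_congr rfl fun D hD => ?_
    rw [Finset.prod_insert]
    exact fun h => ha ((Finset.mem_powersetCard.1 hD).1 h)
  · intro D hD D' hD' h
    have h1 : a ∉ D := fun h => ha ((Finset.mem_powersetCard.1 hD).1 h)
    have h2 : a ∉ D' := fun h => ha ((Finset.mem_powersetCard.1 hD').1 h)
    rw [← Finset.erase_insert h1, ← Finset.erase_insert h2, h]
  · rw [Finset.disjoint_left]
    intro D hD hD'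
    obtain ⟨D', -, rfl⟩ := Finset.mem_image.1 hD'
    exact ha ((Finset.mem_powersetCard.1 hD).1 (Finset.mem_insert_self _ _))

lemma esum_one (Q : Finset ℕ) (g : ℕ → ℝ) : esum Q g 1 = ∑ p ∈ Q, g p := by
  simp [esum, Finset.powersetCard_one]

lemma esum_nonneg {Q : Finset ℕ} {g : ℕ → ℝ} (hg : ∀ p ∈ Q, 0 ≤ g p) (j : ℕ) :
    0 ≤ esum Q g j :=
  Finset.sum_nonneg fun _ hD => Finset.prod_nonneg fun p hp =>
    hg p ((Finset.mem_powersetCard.1 hD).1 hp)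

lemma esum_mono {Q : Finset ℕ} {g g' : ℕ → ℝ} (hg : ∀ p ∈ Q, 0 ≤ g p)
    (h : ∀ p ∈ Q, g p ≤ g' p) (j : ℕ) : esum Q g j ≤ esum Q g' j :=
  Finset.sum_le_sum fun _ hD => Finset.prod_le_prod
    (fun p hp => hg p ((Finset.mem_powersetCard.1 hD).1 hp))
    (fun p hp => h p ((Finset.mem_powersetCard.1 hD).1 hp))

lemma esum_succ_mul_le (Q : Finset ℕ) {g : ℕ → ℝ} (hg : ∀ p, 0 ≤ g p) (j : ℕ) :
    (j + 1) * esum Q g (j + 1) ≤ (∑ p ∈ Q, g p) * esum Q g j := by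
  induction Q using Finset.induction_on generalizing j with
  | empty => simp [esum_empty_succ]
  | insert a Q ha ih =>
    rw [Finset.sum_insert ha, esum_insert ha]
    cases j with
    | zero =>
      have := ih 0
      simp only [esum_zero] at *
      push_cast at *
      linarith
    | succ j =>
      rw [esum_insert ha]
      have h1 := ih (j + 1)
      have h2 := mul_le_mul_of_nonneg_left (ih j) (hg a)
      have h3 := mul_nonneg (mul_nonneg (hg a) (hg a)) (esum_nonneg (Q := Q) (fun p _ => hg p) j)
      push_cast at *
      linarith

lemma esum_le_pow_div_factorial (Q : Finset ℕ) {g : ℕ → ℝ} (hg : ∀ p, 0 ≤ g p) (j : ℕ) :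
    esum Q g j ≤ (∑ p ∈ Q, g p) ^ j / (j.factorial : ℝ) := by
  induction j with
  | zero => simp [esum_zero]
  | succ j ih =>
    have h0 : 0 ≤ ∑ p ∈ Q, g p := Finset.sum_nonneg fun p _ => hg p
    have h1 := esum_succ_mul_le Q hg j
    have h2 := mul_le_mul_of_nonneg_left ih h0
    rw [Nat.factorial_succ, le_div_iff₀ (by positivity)]
    rw [mul_div_assoc', le_div_iff₀ (by positivity)] at h2
    have h3 : (0:ℝ) < (j.factorial : ℝ) := by positivity
    have h4 := mul_le_mul_of_nonneg_right h1 h3.le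
    push_cast
    rw [pow_succ']
    linarith

/-- A lower bound for consecutive elementary symmetric sums. -/
lemma sum_mul_esum_le (Q : Finset ℕ) {g : ℕ → ℝ} (hg : ∀ p, 0 ≤ g p) (j : ℕ) :
    (∑ p ∈ Q, g p) * esum Q g (j + 1)
      ≤ (j + 2) * esum Q g (j + 2) + (∑ p ∈ Q, g p ^ 2) * esum Q g j := by
  induction Q using Finset.induction_on generalizing j with
  | empty => simp [esum_empty_succ]
  | insert a Q ha ih =>
    rw [Finset.sum_insert ha, Finset.sum_insert ha, esum_insert ha, esum_insert ha]
    cases j with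
    | zero =>
      have := ih 0
      simp only [esum_zero, zero_add, esum_one] at *
      push_cast at *
      nlinarith
    | succ j =>
      rw [esum_insert ha]
      have h1 := ih (j + 1)
      have h2 := mul_le_mul_of_nonneg_left (ih j) (hg a)
      have h3 := mul_nonneg (pow_nonneg (hg a) 3) (esum_nonneg (Q := Q) (fun p _ => hg p) j)
      simp only [show j + 1 + 2 = j + 3 from rfl,
        show j + 1 + 1 = j + 2 from rfl] at *
      push_cast at *
      nlinarith

lemma esum_le_mul_esum_succ (Q : Finset ℕ) {g : ℕ → ℝ} (hg : ∀ p, 0 ≤ g p) {r : ℝ} (hr : 0 < r)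
    (hS : 2 * r * ∑ p ∈ Q, g p ^ 2 ≤ ∑ p ∈ Q, g p) {J : ℕ} (hJ : 2 * (J : ℝ) ≤ r * ∑ p ∈ Q, g p)
    (j : ℕ) (hj : j < J) : esum Q g j ≤ r * esum Q g (j + 1) := by
  induction j with
  | zero =>
    have : (1 : ℝ) ≤ J := by exact_mod_cast hj
    rw [esum_zero, zero_add, esum_one]
    linarith
  | succ j ih =>
    have h0 := ih (by omega)
    have h1 := sum_mul_esum_le Q hg j
    have hB : 0 ≤ ∑ p ∈ Q, g p ^ 2 := Finset.sum_nonneg fun p _ => by positivity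
    have hS0 : 0 < ∑ p ∈ Q, g p := by
      have h2 : (0 : ℝ) < J := by exact_mod_cast (by omega : 0 < J)
      by_contra hcon
      nlinarith
    have h2 := mul_le_mul_of_nonneg_left h0 hB
    have hE1 := esum_nonneg (Q := Q) (fun p _ => hg p) (j + 1)
    have hE2 := esum_nonneg (Q := Q) (fun p _ => hg p) (j + 2)
    have h3 : (j : ℝ) + 2 ≤ J := by exact_mod_cast hj
    have h4 : (∑ p ∈ Q, g p) * esum Q g (j + 1) ≤
        (∑ p ∈ Q, g p) * (r * esum Q g (j + 2)) := by
      nlinarith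
    exact le_of_mul_le_mul_left h4 hS0

/-- The generating polynomial of the sums `esum Q g j`. -/
noncomputable def esumPoly (Q : Finset ℕ) (g : ℕ → ℝ) : Polynomial ℝ :=
  ∏ p ∈ Q, (1 + Polynomial.C (g p) * Polynomial.X)

lemma coeff_esumPoly (Q : Finset ℕ) (g : ℕ → ℝ) (j : ℕ) :
    (esumPoly Q g).coeff j = esum Q g j := by
  induction Q using Finset.induction_on generalizing j with
  | empty => cases j <;> simp [esumPoly, esum_empty_succ, esum_zero, Polynomial.coeff_one]
  | insert a Q ha ih =>
    have : esumPoly (insert a Q) g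
        = esumPoly Q g + Polynomial.C (g a) * (esumPoly Q g * Polynomial.X) := by
      rw [esumPoly, Finset.prod_insert ha, ← esumPoly]; ring
    rw [this]
    cases j with
    | zero => simp [ih, esum_zero]
    | succ j => simp [ih, esum_insert ha]

lemma coeff_esumPoly_add_le (Q : Finset ℕ) {g h : ℕ → ℝ} (hg : ∀ p, 0 ≤ g p)
    (hh : ∀ p, 0 ≤ h p) (j : ℕ) :
    (esumPoly Q (g + h)).coeff j ≤ (esumPoly Q g * esumPoly Q h).coeff j := by
  induction Q using Finset.induction_on generalizing j with
  | empty => simp [esumPoly]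
  | insert a Q ha ih =>
    have h1 : esumPoly (insert a Q) (g + h) = esumPoly Q (g + h)
        + Polynomial.C (g a + h a) * (esumPoly Q (g + h) * Polynomial.X) := by
      rw [esumPoly, Finset.prod_insert ha, ← esumPoly, Pi.add_apply]; ring
    have h2 : esumPoly (insert a Q) g * esumPoly (insert a Q) h = esumPoly Q g * esumPoly Q h
        + Polynomial.C (g a + h a) * (esumPoly Q g * esumPoly Q h * Polynomial.X)
        + Polynomial.C (g a * h a) * (esumPoly Q g * esumPoly Q h * Polynomial.X ^ 2) := by
      rw [esumPoly, esumPoly, Finset.prod_insert ha, Finset.prod_insert ha, ← esumPoly, ← esumPoly,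
        Polynomial.C_add, Polynomial.C_mul]
      ring
    have hnn : ∀ i, 0 ≤ (esumPoly Q g * esumPoly Q h).coeff i := fun i => by
      rw [Polynomial.coeff_mul]
      refine Finset.sum_nonneg fun q _ => ?_
      rw [coeff_esumPoly, coeff_esumPoly]
      exact mul_nonneg (esum_nonneg (fun p _ => hg p) _) (esum_nonneg (fun p _ => hh p) _)
    have h0 := add_nonneg (hg a) (hh a)
    rw [h1, h2]
    rcases j with _ | _ | j
    · simpa using ih 0
    · have := mul_le_mul_of_nonneg_left (ih 0) h0
      have h3 := ih 1
      rw [Polynomial.coeff_add, Polynomial.coeff_add, Polynomial.coeff_add, Polynomial.coeff_C_mul,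
        Polynomial.coeff_C_mul, Polynomial.coeff_C_mul, zero_add, Polynomial.coeff_mul_X_pow',
        ← zero_add 1, Polynomial.coeff_mul_X, Polynomial.coeff_mul_X]
      simp only [zero_add]
      rw [if_neg (by norm_num)]
      linarith
    · have := mul_le_mul_of_nonneg_left (ih (j + 1)) h0
      have h3 := ih (j + 2)
      have h4 := mul_nonneg (mul_nonneg (hg a) (hh a)) (hnn j)
      rw [Polynomial.coeff_add, Polynomial.coeff_add, Polynomial.coeff_add, Polynomial.coeff_C_mul,
        Polynomial.coeff_C_mul, Polynomial.coeff_C_mul, Polynomial.coeff_mul_X_pow,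
        Polynomial.coeff_mul_X, Polynomial.coeff_mul_X]
      simp only [add_assoc, one_add_one_eq_two] at *
      linarith

lemma esum_le_pow_mul_esum {Q : Finset ℕ} {g : ℕ → ℝ} {r : ℝ} (hr : 0 ≤ r) {J : ℕ}
    (hrat : ∀ j < J, esum Q g j ≤ r * esum Q g (j + 1)) (i j : ℕ) (hij : j + i ≤ J) :
    esum Q g j ≤ r ^ i * esum Q g (j + i) := by
  induction i with
  | zero => simp
  | succ i ih =>
    have h1 := ih (by omega)
    have h2 := mul_le_mul_of_nonneg_left (hrat (j + i) (by omega)) (pow_nonneg hr i)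
    rw [pow_succ, mul_assoc]
    exact h1.trans h2

lemma esum_add_le_exp_mul {Q : Finset ℕ} {g h : ℕ → ℝ} (hg : ∀ p, 0 ≤ g p)
    (hh : ∀ p, 0 ≤ h p) {r : ℝ} (hr : 0 ≤ r) {J : ℕ}
    (hrat : ∀ j < J, esum Q g j ≤ r * esum Q g (j + 1)) (j : ℕ) (hj : j ≤ J) :
    esum Q (g + h) j ≤ exp (r * ∑ p ∈ Q, h p) * esum Q g j := by
  have hE := esum_nonneg (Q := Q) (fun p _ => hg p) j
  have hH : 0 ≤ ∑ p ∈ Q, h p := Finset.sum_nonneg fun p _ => hh p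
  rw [← coeff_esumPoly]
  refine (coeff_esumPoly_add_le Q hg hh j).trans ?_
  rw [mul_comm (esumPoly Q g), Polynomial.coeff_mul, Finset.Nat.sum_antidiagonal_eq_sum_range_succ_mk]
  calc _ ≤ ∑ i ∈ range (j + 1), (r * ∑ p ∈ Q, h p) ^ i / (i.factorial : ℝ) * esum Q g j := by
        refine Finset.sum_le_sum fun i hi => ?_
        have hi' : i ≤ j := by simpa [Nat.lt_succ_iff] using hi
        rw [coeff_esumPoly, coeff_esumPoly]
        have h1 := esum_le_pow_mul_esum hr hrat i (j - i) (by omega)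
        rw [Nat.sub_add_cancel hi'] at h1
        calc _ ≤ (∑ p ∈ Q, h p) ^ i / (i.factorial : ℝ) * (r ^ i * esum Q g j) :=
              mul_le_mul (esum_le_pow_div_factorial Q hh i) h1
                (esum_nonneg (fun p _ => hg p) _) (by positivity)
          _ = _ := by rw [mul_pow]; ring
    _ = (∑ i ∈ range (j + 1), (r * ∑ p ∈ Q, h p) ^ i / (i.factorial : ℝ)) * esum Q g j := by
        rw [Finset.sum_mul]
    _ ≤ _ := mul_le_mul_of_nonneg_right
        (Real.sum_le_exp_of_nonneg (mul_nonneg hr hH) _) hE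

lemma sum_le_sum_of_injOn {α β : Type*} [DecidableEq β] {s : Finset α} {t : Finset β}
    {f : α → ℝ} {g : β → ℝ} (e : α → β) (hmaps : ∀ a ∈ s, e a ∈ t)
    (hinj : Set.InjOn e s) (hle : ∀ a ∈ s, f a ≤ g (e a)) (hg : ∀ b ∈ t, 0 ≤ g b) :
    ∑ a ∈ s, f a ≤ ∑ b ∈ t, g b := by
  calc ∑ a ∈ s, f a ≤ ∑ a ∈ s, g (e a) := Finset.sum_le_sum hle
    _ = ∑ b ∈ s.image e, g b := (Finset.sum_image hinj).symm
    _ ≤ _ := Finset.sum_le_sum_of_subset_of_nonneg (Finset.image_subset_iff.2 hmaps)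
        fun b hb _ => hg b hb

lemma sum_log_primeFactors_le (m : ℕ) (hm : m ≠ 0) : ∑ p ∈ m.primeFactors, log p ≤ log m := by
  rw [← Real.log_prod (fun p hp => by
    exact_mod_cast (Nat.prime_of_mem_primeFactors hp).ne_zero)]
  have h := Nat.le_of_dvd (Nat.pos_of_ne_zero hm) (Nat.prod_primeFactors_dvd m)
  have h0 : 0 < ∏ p ∈ m.primeFactors, p :=
    Finset.prod_pos fun p hp => (Nat.prime_of_mem_primeFactors hp).pos
  rw [← Nat.cast_prod]
  exact Real.log_le_log (by exact_mod_cast h0) (by exact_mod_cast h)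

/-- An upper bound in the direction of Mertens' first theorem. -/
lemma sum_log_div_primesLE_le (n : ℕ) : ∑ p ∈ n.primesLE, log p / p ≤ 2 * log n := by
  rcases Nat.eq_zero_or_pos n with rfl | hn
  · simp
  have hn' : (0 : ℝ) < n := by exact_mod_cast hn
  have h1 : ∑ m ∈ Ioc 0 n, ∑ p ∈ m.primeFactors, log p ≤ n * log n := by
    calc _ ≤ ∑ m ∈ Ioc 0 n, log n := by
          refine Finset.sum_le_sum fun m hm => ?_
          rw [Finset.mem_Ioc] at hm
          refine (sum_log_primeFactors_le m (by omega)).trans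
            (Real.log_le_log (by exact_mod_cast hm.1) (by exact_mod_cast hm.2))
      _ = _ := by simp
  have h2 : ∑ m ∈ Ioc 0 n, ∑ p ∈ m.primeFactors, log p
      = ∑ p ∈ n.primesLE, ((n / p : ℕ) : ℝ) * log p := by
    rw [Finset.sum_comm' (t' := n.primesLE) (s' := fun p => (Ioc 0 n).filter (p ∣ ·))]
    · refine Finset.sum_congr rfl fun p hp => ?_
      rw [Finset.sum_const, Nat.Ioc_filter_dvd_card_eq_div, nsmul_eq_mul]
    · intro m p
      simp only [Finset.mem_Ioc, Nat.mem_primeFactors, Finset.mem_filter, Nat.mem_primesLE]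
      constructor
      · rintro ⟨⟨h1, h2⟩, h3, h4, h5⟩
        exact ⟨⟨⟨h1, h2⟩, h4⟩, (Nat.le_of_dvd h1 h4).trans h2, h3⟩
      · rintro ⟨⟨⟨h1, h2⟩, h4⟩, h5, h3⟩
        exact ⟨⟨h1, h2⟩, h3, h4, by omega⟩
  have h3 : ∑ p ∈ n.primesLE, (n / 2 : ℝ) * (log p / p)
      ≤ ∑ p ∈ n.primesLE, ((n / p : ℕ) : ℝ) * log p := by
    refine Finset.sum_le_sum fun p hp => ?_
    rw [Nat.mem_primesLE] at hp
    have hp0 := hp.2.pos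
    have hlog : 0 ≤ log (p : ℝ) := Real.log_natCast_nonneg p
    have : (n : ℝ) / 2 ≤ ((n / p : ℕ) : ℝ) * p := by
      have a1 : n < p * (n / p + 1) := Nat.lt_mul_div_succ n hp0
      have a2 : 1 ≤ n / p := Nat.div_pos hp.1 hp0
      have a3 : n ≤ 2 * ((n / p) * p) := by nlinarith
      have a4 : (n : ℝ) ≤ 2 * (((n / p : ℕ) : ℝ) * p) := by exact_mod_cast a3
      linarith
    have hp0' : (0 : ℝ) < p := by exact_mod_cast hp0
    calc (n / 2 : ℝ) * (log p / p) = (n / 2) / p * log p := by ring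
      _ ≤ ((n / p : ℕ) : ℝ) * log p := by
        refine mul_le_mul_of_nonneg_right ?_ hlog
        rwa [div_le_iff₀ hp0']
  rw [← Finset.mul_sum] at h3
  have h4 : (n / 2 : ℝ) * ∑ p ∈ n.primesLE, log p / p ≤ (n / 2 : ℝ) * (2 * log n) := by
    linarith
  exact le_of_mul_le_mul_left h4 (by positivity)

lemma log_le_prod_inv (n : ℕ) (hn : 1 ≤ n) :
    log n ≤ ∏ p ∈ n.primesLE, (1 - (p : ℝ)⁻¹)⁻¹ := by
  let f : ℕ →* ℝ := ⟨⟨fun n => (n : ℝ)⁻¹, by simp⟩, fun a b => by simp [mul_comm]⟩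
  have hf : ∀ {p : ℕ}, p.Prime → ‖f p‖ < 1 := fun {p} hp => by
    change ‖(p : ℝ)⁻¹‖ < 1
    rw [Real.norm_of_nonneg (by positivity)]
    exact inv_lt_one_of_one_lt₀ (by exact_mod_cast hp.one_lt)
  have h := (EulerProduct.summable_and_hasSum_smoothNumbers_prod_primesBelow_geometric hf (n + 1)).2
  have h1 := sum_le_hasSum ((Icc 1 n).subtype (· ∈ (n + 1).smoothNumbers))
    (fun i _ => by change 0 ≤ ((i : ℕ) : ℝ)⁻¹; positivity) h
  rw [Finset.sum_subtype_of_mem (p := (· ∈ (n + 1).smoothNumbers)) (fun i => f i) (fun i hi => by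
    rw [Finset.mem_Icc] at hi
    exact Nat.mem_smoothNumbers_of_lt (by omega) (by omega))] at h1
  refine le_trans ?_ h1
  have h2 := log_add_one_le_harmonic n
  rw [harmonic_eq_sum_Icc] at h2
  push_cast at h2
  refine le_trans (Real.log_le_log (by exact_mod_cast hn) (by linarith)) h2

lemma one_sub_inv_prime_pos {p : ℕ} (hp : p.Prime) : (0 : ℝ) < 1 - (p : ℝ)⁻¹ := by
  have : (p : ℝ)⁻¹ < 1 := inv_lt_one_of_one_lt₀ (by exact_mod_cast hp.one_lt)
  linarith

lemma prod_one_sub_inv_primesLE_le (n : ℕ) (hn : 2 ≤ n) :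
    ∏ p ∈ n.primesLE, (1 - (p : ℝ)⁻¹) ≤ 1 / log n := by
  have h := log_le_prod_inv n (by omega)
  have h0 : 0 < log (n : ℝ) := Real.log_pos (by exact_mod_cast hn)
  rw [Finset.prod_inv_distrib] at h
  have h1 : 0 < ∏ p ∈ n.primesLE, (1 - (p : ℝ)⁻¹) :=
    Finset.prod_pos fun p hp => one_sub_inv_prime_pos (Nat.prime_of_mem_primesLE hp)
  rw [le_div_iff₀ h0]
  calc _ ≤ (∏ p ∈ n.primesLE, (1 - (p : ℝ)⁻¹)) * (∏ p ∈ n.primesLE, (1 - (p : ℝ)⁻¹))⁻¹ :=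
        mul_le_mul_of_nonneg_left h h1.le
    _ = 1 := mul_inv_cancel₀ h1.ne'

lemma inv_one_sub_inv_prime_le_exp {p : ℕ} (hp : p.Prime) :
    (1 - (p : ℝ)⁻¹)⁻¹ ≤ exp (2 * (p : ℝ)⁻¹) := by
  have h2 : (2 : ℝ) ≤ p := by exact_mod_cast hp.two_le
  have h0 := one_sub_inv_prime_pos hp
  have h3 : (p : ℝ)⁻¹ ≤ 1 / 2 := by
    rw [inv_eq_one_div]; exact one_div_le_one_div_of_le (by norm_num) h2
  have h4 := Real.add_one_le_exp (2 * (p : ℝ)⁻¹)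
  refine le_trans ?_ h4
  rw [inv_le_iff_one_le_mul₀ h0]
  have : 0 < (p : ℝ)⁻¹ := by positivity
  nlinarith

lemma log_log_le_sum_inv (n : ℕ) (hn : 2 ≤ n) :
    log (log n) ≤ 2 * ∑ p ∈ n.primesLE, (p : ℝ)⁻¹ := by
  have h := log_le_prod_inv n (by omega)
  have h0 : 0 < log (n : ℝ) := Real.log_pos (by exact_mod_cast hn)
  rw [Real.log_le_iff_le_exp h0, Finset.mul_sum, Real.exp_sum]
  refine h.trans (Finset.prod_le_prod (fun p hp => ?_) fun p hp => ?_)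
  · exact inv_nonneg.2 (one_sub_inv_prime_pos (Nat.prime_of_mem_primesLE hp)).le
  · exact inv_one_sub_inv_prime_le_exp (Nat.prime_of_mem_primesLE hp)

lemma sum_Icc_inv_sq_le (n : ℕ) : ∑ m ∈ Icc 2 n, ((m : ℝ) ^ 2)⁻¹ ≤ 1 := by
  have key : ∀ n : ℕ, 1 ≤ n → ∑ m ∈ Icc 2 n, ((m : ℝ) ^ 2)⁻¹ ≤ 1 - (n : ℝ)⁻¹ := by
    intro n hn
    induction n, hn using Nat.le_induction with
    | base => simp
    | succ n hn ih =>
      rw [Finset.sum_Icc_succ_top (by omega)]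
      have hn' : (0 : ℝ) < n := by exact_mod_cast hn
      have : (((n + 1 : ℕ) : ℝ) ^ 2)⁻¹ ≤ (n : ℝ)⁻¹ - ((n + 1 : ℕ) : ℝ)⁻¹ := by
        push_cast
        rw [inv_sub_inv (by positivity) (by positivity), inv_eq_one_div,
          div_le_div_iff₀ (by positivity) (by positivity)]
        nlinarith
      linarith
  rcases Nat.eq_zero_or_pos n with rfl | hn
  · simp
  · have := key n hn
    have h2 : (0 : ℝ) ≤ (n : ℝ)⁻¹ := by positivity
    linarith

lemma sum_primesLE_inv_sq_le (n : ℕ) : ∑ p ∈ n.primesLE, ((p : ℝ) ^ 2)⁻¹ ≤ 1 := by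
  refine (Finset.sum_le_sum_of_subset_of_nonneg (fun p hp => ?_) fun _ _ _ => by positivity).trans
    (sum_Icc_inv_sq_le n)
  rw [Nat.mem_primesLE] at hp
  exact Finset.mem_Icc.2 ⟨hp.2.two_le, hp.1⟩

lemma log_sq_le (y : ℝ) (hy : 1 ≤ y) : log y ^ 2 ≤ 16 * √y := by
  have h := Real.log_le_rpow_div (x := y) (by linarith) (show (0 : ℝ) < 1 / 4 by norm_num)
  have h0 : 0 ≤ log y := Real.log_nonneg hy
  have h1 : (y ^ (1 / 4 : ℝ)) ^ 2 = √y := by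
    rw [← Real.rpow_natCast, ← Real.rpow_mul (by linarith), Real.sqrt_eq_rpow]; norm_num
  calc log y ^ 2 ≤ (y ^ (1 / 4 : ℝ) / (1 / 4)) ^ 2 := pow_le_pow_left₀ h0 h 2
    _ = 16 * √y := by rw [div_pow, h1]; ring

lemma sum_log_prime_pow_le_of_prime {p : ℕ} (hp : p.Prime) (Y V : ℕ) :
    ∑ v ∈ (Icc 1 V).filter (fun v => p ^ v ≤ Y), (v : ℝ) * log p
      ≤ (Nat.log p Y : ℝ) ^ 2 * log p := by
  have hlog : 0 ≤ log (p : ℝ) := Real.log_natCast_nonneg p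
  calc _ ≤ ∑ v ∈ Icc 1 (Nat.log p Y), (Nat.log p Y : ℝ) * log p := by
        refine (Finset.sum_le_sum_of_subset_of_nonneg (t := Icc 1 (Nat.log p Y))
          (fun v hv => ?_) fun _ _ _ => by positivity).trans
          (Finset.sum_le_sum fun v hv => ?_)
        · rw [Finset.mem_filter, Finset.mem_Icc] at hv
          exact Finset.mem_Icc.2 ⟨hv.1.1, Nat.le_log_of_pow_le hp.one_lt hv.2⟩
        · have : (v : ℝ) ≤ Nat.log p Y := by exact_mod_cast (Finset.mem_Icc.1 hv).2
          exact mul_le_mul_of_nonneg_right this hlog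
    _ = _ := by simp; ring

lemma sum_log_prime_pow_le (Y V : ℕ) :
    ∑ p ∈ Y.primesLE, ∑ v ∈ (Icc 1 V).filter (fun v => p ^ v ≤ Y), (v : ℝ) * log p
      ≤ 34 * Y := by
  rcases Nat.eq_zero_or_pos Y with rfl | hY
  · simp
  have hY1 : (1 : ℝ) ≤ Y := by exact_mod_cast hY
  have hlogY : 0 ≤ log (Y : ℝ) := Real.log_nonneg hY1
  have hl2 := Real.log_two_gt_d9
  have step : ∀ p ∈ Y.primesLE,
      ∑ v ∈ (Icc 1 V).filter (fun v => p ^ v ≤ Y), (v : ℝ) * log p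
        ≤ log p + if p ^ 2 ≤ Y then 2 * log Y ^ 2 else 0 := by
    intro p hp
    rw [Nat.mem_primesLE] at hp
    have hlog : 0 ≤ log (p : ℝ) := Real.log_natCast_nonneg p
    have hlogp : log 2 ≤ log (p : ℝ) :=
      Real.log_le_log (by norm_num) (by exact_mod_cast hp.2.two_le)
    refine (sum_log_prime_pow_le_of_prime hp.2 Y V).trans ?_
    split_ifs with h
    · have h1 : (Nat.log p Y : ℝ) * log p ≤ log Y := by
        rw [← Real.log_pow]
        refine Real.log_le_log (by have := hp.2.pos; positivity) ?_
        exact_mod_cast Nat.pow_log_le_self p (by omega)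
      have h3 : ((Nat.log p Y : ℝ) * log p) ^ 2 ≤ log Y ^ 2 :=
        pow_le_pow_left₀ (by positivity) h1 2
      have h4 : (Nat.log p Y : ℝ) ^ 2 * log p ≤ 2 * ((Nat.log p Y : ℝ) * log p) ^ 2 := by
        have h5 : (0 : ℝ) ≤ (Nat.log p Y : ℝ) ^ 2 * log p := by positivity
        have h6 : 0 ≤ ((Nat.log p Y : ℝ) ^ 2 * log p) * (2 * log p - 1) :=
          mul_nonneg h5 (by linarith)
        nlinarith
      linarith
    · have h1 : Nat.log p Y ≤ 1 := by
        by_contra hcon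
        exact h (Nat.pow_le_of_le_log (by omega) (by omega))
      have h2 : (Nat.log p Y : ℝ) ≤ 1 := by exact_mod_cast h1
      have h3 : (Nat.log p Y : ℝ) ^ 2 ≤ 1 := pow_le_one₀ (by positivity) h2
      nlinarith
  refine (Finset.sum_le_sum step).trans ?_
  rw [Finset.sum_add_distrib, ← Finset.sum_filter, Finset.sum_const, nsmul_eq_mul]
  have hθ : ∑ p ∈ Y.primesLE, log (p : ℝ) ≤ log 4 * Y := by
    rw [← Chebyshev.theta_eq_sum_primesLE_log]
    exact Chebyshev.theta_le_log4_mul_x (by positivity)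
  have hcard : ((Y.primesLE.filter (fun p => p ^ 2 ≤ Y)).card : ℝ) ≤ √Y := by
    have : (Y.primesLE.filter (fun p => p ^ 2 ≤ Y)) ⊆ Icc 1 (Nat.sqrt Y) := fun p hp => by
      rw [Finset.mem_filter, Nat.mem_primesLE] at hp
      exact Finset.mem_Icc.2 ⟨hp.1.2.pos, Nat.le_sqrt'.2 hp.2⟩
    have h1 := Finset.card_le_card this
    rw [Nat.card_Icc] at h1
    calc _ ≤ ((Nat.sqrt Y : ℕ) : ℝ) := by exact_mod_cast h1
      _ ≤ √Y := Real.nat_sqrt_le_real_sqrt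
  have hsq := log_sq_le Y hY1
  have h1 : ((Y.primesLE.filter (fun p => p ^ 2 ≤ Y)).card : ℝ) * (2 * log Y ^ 2)
      ≤ √Y * (2 * (16 * √Y)) := by gcongr
  have h2 : √(Y : ℝ) * √Y = Y := Real.mul_self_sqrt (by positivity)
  have h3 : log 4 = 2 * log 2 := by
    rw [show (4 : ℝ) = 2 ^ 2 by norm_num, Real.log_pow]; norm_num
  have h4 := Real.log_two_lt_d9
  nlinarith

lemma primeCounting_lower {y : ℝ} (hy : 100 ≤ y) :
    y / (2 * log y) ≤ (Nat.primesLE ⌊y⌋₊).card := by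
  have h := Chebyshev.pi_ge' (x := y) (by linarith)
  have h0 : 0 < log y := Real.log_pos (by linarith)
  have h1 : log (y + 2) ≤ (y + 2) / 16 + 4 * log 2 - 1 := by
    have := Real.log_le_sub_one_of_pos (show 0 < (y + 2) / 16 by positivity)
    rw [Real.log_div (by linarith) (by norm_num), show (16 : ℝ) = 2 ^ 4 by norm_num,
      Real.log_pow] at this
    push_cast at this
    linarith
  have h2 := Real.log_two_gt_d9
  have h3 := Real.log_two_lt_d9
  rw [← Nat.primesLE_card_eq_primeCounting] at h
  refine le_trans ?_ h
  rw [← div_div]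
  refine div_le_div_of_nonneg_right ?_ h0.le
  nlinarith

/-- The average of `∑_{d ∣ t} d^{-1/2}` against `1/t` is bounded by a constant times `log`. -/
lemma exists_sum_divisors_rpow_le :
    ∃ C : ℝ, 0 < C ∧ ∀ T : ℕ, 1 ≤ T →
      ∑ t ∈ Icc 1 T, (t : ℝ)⁻¹ * ∑ d ∈ t.divisors, (d : ℝ) ^ (-(1 / 2) : ℝ) ≤ C * (1 + log T) := by
  have hs : Summable fun d : ℕ => (d : ℝ) ^ (-(3 / 2) : ℝ) :=
    Real.summable_nat_rpow.2 (by norm_num)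
  have htsum : 0 ≤ ∑' d : ℕ, (d : ℝ) ^ (-(3 / 2) : ℝ) := tsum_nonneg fun d => by positivity
  refine ⟨1 + ∑' d : ℕ, (d : ℝ) ^ (-(3 / 2) : ℝ), by linarith, fun T hT => ?_⟩
  have hlog : 0 ≤ log (T : ℝ) := Real.log_natCast_nonneg T
  have hharm : ∑ e ∈ Icc 1 T, (e : ℝ)⁻¹ ≤ 1 + log T := by
    have := harmonic_le_one_add_log T
    rw [harmonic_eq_sum_Icc] at this
    push_cast at this
    exact this
  have h1 : ∑ t ∈ Icc 1 T, (t : ℝ)⁻¹ * ∑ d ∈ t.divisors, (d : ℝ) ^ (-(1 / 2) : ℝ)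
      ≤ ∑ q ∈ Icc 1 T ×ˢ Icc 1 T, (q.1 : ℝ) ^ (-(3 / 2) : ℝ) * (q.2 : ℝ)⁻¹ := by
    simp_rw [Finset.mul_sum]
    rw [Finset.sum_sigma']
    refine sum_le_sum_of_injOn (fun q => (q.2, q.1 / q.2)) ?_ ?_ ?_ fun _ _ => by positivity
    · rintro ⟨t, d⟩ h
      simp only [Finset.mem_sigma, Finset.mem_Icc, Nat.mem_divisors, Finset.mem_product] at h ⊢
      obtain ⟨⟨h1, h2⟩, h3, h4⟩ := h
      have hd : 0 < d := Nat.pos_of_dvd_of_pos h3 h1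
      exact ⟨⟨hd, (Nat.le_of_dvd h1 h3).trans h2⟩, Nat.div_pos (Nat.le_of_dvd h1 h3) hd,
        (Nat.div_le_self t d).trans h2⟩
    · rintro ⟨t, d⟩ h ⟨t', d'⟩ h' heq
      simp only [Finset.coe_sigma, Set.mem_sigma_iff, Finset.mem_coe, Nat.mem_divisors] at h h'
      simp only [Prod.mk.injEq] at heq
      obtain ⟨rfl, heq⟩ := heq
      have : t = t' := by
        rw [← Nat.div_mul_cancel h.2.1, ← Nat.div_mul_cancel h'.2.1, heq]
      rw [this]
    · rintro ⟨t, d⟩ h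
      simp only [Finset.mem_sigma, Finset.mem_Icc, Nat.mem_divisors] at h
      obtain ⟨⟨h1, h2⟩, h3, h4⟩ := h
      have hd : 0 < d := Nat.pos_of_dvd_of_pos h3 h1
      have hd' : (0 : ℝ) < d := by exact_mod_cast hd
      have ht' : (0 : ℝ) < t := by exact_mod_cast h1
      simp only
      rw [Nat.cast_div h3 hd'.ne', inv_div, show (-(3 / 2) : ℝ) = -(1 / 2) + -1 by norm_num,
        Real.rpow_add hd', Real.rpow_neg_one]
      refine le_of_eq ?_
      field_simp
  rw [Finset.sum_product] at h1
  simp_rw [← Finset.mul_sum] at h1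
  rw [← Finset.sum_mul] at h1
  refine h1.trans (mul_le_mul ?_ hharm (Finset.sum_nonneg fun _ _ => by positivity) ?_)
  · have := hs.sum_le_tsum (Icc 1 T) (fun d _ => by positivity)
    linarith
  · linarith

lemma bonferroni {Q : Finset ℕ} {g : ℕ → ℝ} (h0 : ∀ p ∈ Q, 0 ≤ g p) (h1 : ∀ p ∈ Q, g p ≤ 1)
    (n : ℕ) :
    0 ≤ (-1) ^ n * (∑ i ∈ range (n + 1), esum Q (fun p => -g p) i - ∏ p ∈ Q, (1 - g p)) ∧
    (-1) ^ n * (∑ i ∈ range (n + 1), esum Q (fun p => -g p) i - ∏ p ∈ Q, (1 - g p))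
      ≤ esum Q g (n + 1) := by
  induction Q using Finset.induction_on generalizing n with
  | empty =>
    have : ∑ i ∈ range (n + 1), esum ∅ (fun p => -g p) i = 1 := by
      rw [Finset.sum_range_succ', esum_zero, Finset.sum_eq_zero, zero_add]
      exact fun i _ => esum_empty_succ _ _
    simp [this, esum_empty_succ]
  | insert a Q ha ih =>
    have h0' := fun p hp => h0 p (Finset.mem_insert_of_mem hp)
    have h1' := fun p hp => h1 p (Finset.mem_insert_of_mem hp)
    have ih := ih h0' h1'
    have ha0 := h0 a (Finset.mem_insert_self _ _)
    have ha1 := h1 a (Finset.mem_insert_self _ _)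
    rw [Finset.prod_insert ha]
    cases n with
    | zero =>
      have hV0 : 0 ≤ ∏ p ∈ Q, (1 - g p) :=
        Finset.prod_nonneg fun p hp => by linarith [h1' p hp]
      have hV1 : ∏ p ∈ Q, (1 - g p) ≤ 1 :=
        Finset.prod_le_one (fun p hp => by linarith [h1' p hp])
          fun p hp => by linarith [h0' p hp]
      have := ih 0
      rw [esum_insert ha]
      simp only [zero_add, range_one, sum_singleton, esum_zero, pow_zero, one_mul] at *
      constructor <;> nlinarith
    | succ n =>
      have e1 : ∑ i ∈ range (n + 1 + 1), esum (insert a Q) (fun p => -g p) i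
          = ∑ i ∈ range (n + 1 + 1), esum Q (fun p => -g p) i
            - g a * ∑ i ∈ range (n + 1), esum Q (fun p => -g p) i := by
        rw [Finset.sum_range_succ', Finset.sum_range_succ' _ (n + 1), Finset.mul_sum, esum_zero,
          esum_zero]
        simp_rw [esum_insert ha, Finset.sum_add_distrib, neg_mul, Finset.sum_neg_distrib]
        ring
      rw [e1, esum_insert ha]
      obtain ⟨i1, i2⟩ := ih n
      obtain ⟨i3, i4⟩ := ih (n + 1)
      have i5 := mul_nonneg ha0 i1
      have i6 := mul_le_mul_of_nonneg_left i2 ha0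
      rw [pow_succ] at *
      constructor <;> linarith

lemma exists_family_prod_sum_esum (B : ℕ → Finset ℕ) (hB : ∀ i j, i ≠ j → Disjoint (B i) (B j))
    (t : ℕ → ℕ) (n : ℕ) :
    ∃ F : Finset (Finset ℕ), (∀ D ∈ F, D ⊆ (range n).biUnion B) ∧
      ∀ ψ : ℕ → ℝ, ∑ D ∈ F, ∏ l ∈ D, ψ l
        = ∏ j ∈ range n, ∑ i ∈ range (t j + 1), esum (B j) ψ i := by
  induction n with
  | zero => exact ⟨{∅}, by simp, by simp⟩
  | succ n ih =>
    obtain ⟨F, hF, hsum⟩ := ih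
    let G : Finset (Finset ℕ) := (range (t n + 1)).biUnion fun i => (B n).powersetCard i
    have hGB : ∀ D ∈ G, D ⊆ B n := fun D hD => by
      obtain ⟨i, -, hi⟩ := Finset.mem_biUnion.1 hD
      exact (Finset.mem_powersetCard.1 hi).1
    have hdis : Disjoint ((range n).biUnion B) (B n) := by
      rw [Finset.disjoint_biUnion_left]
      exact fun i hi => hB i n (Finset.mem_range.1 hi).ne
    refine ⟨(F ×ˢ G).image fun x => x.1 ∪ x.2, ?_, fun ψ => ?_⟩
    · intro D hD
      obtain ⟨⟨D1, D2⟩, h, rfl⟩ := Finset.mem_image.1 hD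
      obtain ⟨h1, h2⟩ := Finset.mem_product.1 h
      rw [Finset.range_add_one, Finset.biUnion_insert, Finset.union_comm]
      exact Finset.union_subset_union (hGB _ h2) (hF _ h1)
    · have hsumG : ∑ D ∈ G, ∏ l ∈ D, ψ l = ∑ i ∈ range (t n + 1), esum (B n) ψ i := by
        rw [Finset.sum_biUnion]
        · rfl
        · intro i _ j _ hij
          exact Finset.pairwise_disjoint_powersetCard (B n) hij
      rw [Finset.sum_image, Finset.sum_product, Finset.prod_range_succ, ← hsum, ← hsumG,
        Finset.sum_mul_sum]
      · refine Finset.sum_congr rfl fun D1 h1 => Finset.sum_congr rfl fun D2 h2 => ?_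
        exact Finset.prod_union (hdis.mono (hF _ h1) (hGB _ h2))
      · rintro ⟨D1, D2⟩ h ⟨D3, D4⟩ h' heq
        obtain ⟨h1, h2⟩ := Finset.mem_product.1 h
        obtain ⟨h3, h4⟩ := Finset.mem_product.1 h'
        have key : ∀ X Y : Finset ℕ, X ⊆ (range n).biUnion B → Y ⊆ B n →
            (X ∪ Y) ∩ (range n).biUnion B = X ∧ (X ∪ Y) ∩ B n = Y := by
          intro X Y hX hY
          have d1 : Disjoint Y ((range n).biUnion B) := (hdis.mono_right hY).symm
          have d2 : Disjoint X (B n) := hdis.mono_left hX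
          rw [Finset.union_inter_distrib_right, Finset.union_inter_distrib_right,
            Finset.inter_eq_left.2 hX, Finset.inter_eq_left.2 hY,
            Finset.disjoint_iff_inter_eq_empty.1 d1, Finset.disjoint_iff_inter_eq_empty.1 d2]
          simp
        have k1 := key D1 D2 (hF _ h1) (hGB _ h2)
        have k2 := key D3 D4 (hF _ h3) (hGB _ h4)
        simp only at heq
        rw [heq] at k1
        exact Prod.ext (k1.1.symm.trans k2.1) (k1.2.symm.trans k2.2)

lemma card_filter_range_mul {M l : ℕ} (hM : 0 < M) (hl : 0 < l) (h : M.Coprime l)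
    (p q : ℕ → Prop) [DecidablePred p] [DecidablePred q] :
    ((range (M * l)).filter fun s => p (s % M) ∧ q (s % l)).card
      = ((range M).filter p).card * ((range l).filter q).card := by
  rw [← Finset.card_product]
  refine Finset.card_nbij' (fun s => (s % M, s % l)) (fun y => (Nat.chineseRemainder h y.1 y.2 : ℕ))
    ?_ ?_ ?_ ?_
  · intro s hs
    simp only [Finset.coe_filter, Finset.mem_range, Set.mem_ofPred_eq, Finset.coe_product,
      Set.mem_prod] at *
    exact ⟨⟨Nat.mod_lt _ hM, hs.2.1⟩, Nat.mod_lt _ hl, hs.2.2⟩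
  · rintro ⟨a, b⟩ hs
    simp only [Finset.coe_filter, Finset.mem_range, Set.mem_ofPred_eq, Finset.coe_product,
      Set.mem_prod] at *
    have h1 : (Nat.chineseRemainder h a b : ℕ) % M = a % M := (Nat.chineseRemainder h a b).2.1
    have h2 : (Nat.chineseRemainder h a b : ℕ) % l = b % l := (Nat.chineseRemainder h a b).2.2
    rw [Nat.mod_eq_of_lt hs.1.1] at h1
    rw [Nat.mod_eq_of_lt hs.2.1] at h2
    rw [h1, h2]
    exact ⟨Nat.chineseRemainder_lt_mul h _ _ hM.ne' hl.ne', hs.1.2, hs.2.2⟩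
  · intro s hs
    simp only [Finset.coe_filter, Finset.mem_range, Set.mem_ofPred_eq] at hs
    have h1 := Nat.chineseRemainder_modEq_unique h (a := s % M) (b := s % l) (z := s)
      (Nat.mod_modEq _ _).symm (Nat.mod_modEq _ _).symm
    have h2 := Nat.chineseRemainder_lt_mul h (s % M) (s % l) hM.ne' hl.ne'
    exact (Nat.ModEq.eq_of_lt_of_lt h1 hs.1 h2).symm
  · rintro ⟨a, b⟩ hs
    simp only [Finset.coe_filter, Finset.mem_range, Set.mem_ofPred_eq, Finset.coe_product,
      Set.mem_prod] at *
    have h1 : (Nat.chineseRemainder h a b : ℕ) % M = a % M := (Nat.chineseRemainder h a b).2.1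
    have h2 : (Nat.chineseRemainder h a b : ℕ) % l = b % l := (Nat.chineseRemainder h a b).2.2
    rw [h1, h2, Nat.mod_eq_of_lt hs.1.1, Nat.mod_eq_of_lt hs.2.1]

lemma card_filter_range_prod {D : Finset ℕ} (hD : ∀ l ∈ D, l.Prime) {Ω : ℕ → Finset ℕ}
    (hΩ : ∀ l ∈ D, Ω l ⊆ range l) :
    ((range (∏ l ∈ D, l)).filter fun s => ∀ l ∈ D, s % l ∈ Ω l).card = ∏ l ∈ D, (Ω l).card := by
  induction D using Finset.induction_on with
  | empty => simp
  | insert a D ha ih =>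
    have hD' := fun l hl => hD l (Finset.mem_insert_of_mem hl)
    have hpa := hD a (Finset.mem_insert_self _ _)
    have hcop : (∏ l ∈ D, l).Coprime a := Nat.Coprime.prod_left fun l hl =>
      (Nat.coprime_primes (hD' l hl) hpa).2 fun h => ha (h ▸ hl)
    rw [Finset.prod_insert ha, Finset.prod_insert ha, mul_comm a, mul_comm (Ω a).card,
      ← ih hD' fun l hl => hΩ l (Finset.mem_insert_of_mem hl)]
    have e : (Ω a).card = ((range a).filter fun s => s ∈ Ω a).card := by
      congr 1
      ext s
      simp only [Finset.mem_filter]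
      exact ⟨fun h => ⟨hΩ a (Finset.mem_insert_self _ _) h, h⟩, fun h => h.2⟩
    rw [e, ← card_filter_range_mul (Finset.prod_pos fun l hl => (hD' l hl).pos) hpa.pos hcop]
    congr 1
    refine Finset.filter_congr fun s _ => ?_
    rw [Finset.forall_mem_insert, and_comm]
    refine and_congr_left' (forall₂_congr fun l hl => ?_)
    rw [Nat.mod_mod_of_dvd _ (Finset.dvd_prod_of_mem _ hl)]

lemma abs_count_sub_le {p : ℕ → Prop} [DecidablePred p] {M : ℕ} (hM : 0 < M)
    (hp : ∀ s, p (s + M) ↔ p s) (N : ℕ) :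
    |(((range N).filter p).card : ℝ) - N * (((range M).filter p).card / M : ℝ)|
      ≤ ((range M).filter p).card := by
  have key : ∀ q r : ℕ, Nat.count p (q * M + r) = q * Nat.count p M + Nat.count p r := by
    intro q r
    induction q with
    | zero => simp
    | succ q ih =>
      have : (q + 1) * M + r = M + (q * M + r) := by ring
      rw [this, Nat.count_add, add_mul, one_mul]
      have e : (fun k => p (M + k)) = p := by
        funext s; rw [add_comm]; exact propext (hp s)
      simp only [e]
      rw [ih]; ring
  rw [← Nat.count_eq_card_filter_range, ← Nat.count_eq_card_filter_range]
  have hN : N / M * M + N % M = N := Nat.div_add_mod' N M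
  have hr : N % M < M := Nat.mod_lt _ hM
  have h1 := key (N / M) (N % M)
  rw [hN] at h1
  have h2 : Nat.count p (N % M) ≤ Nat.count p M := Nat.count_monotone p hr.le
  have hM' : (0 : ℝ) < M := by exact_mod_cast hM
  have hN' : (N : ℝ) = (N / M : ℕ) * M + (N % M : ℕ) := by exact_mod_cast hN.symm
  have e : (N : ℝ) * (Nat.count p M / M : ℝ)
      = (N / M : ℕ) * Nat.count p M + (N % M : ℕ) / M * Nat.count p M := by
    rw [hN']; field_simp
  have h3 : ((N % M : ℕ) : ℝ) / M ≤ 1 := by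
    rw [div_le_one hM']; exact_mod_cast hr.le
  have h4 : (0 : ℝ) ≤ ((N % M : ℕ) : ℝ) / M := by positivity
  have h5 : (0 : ℝ) ≤ Nat.count p M := by positivity
  have h6 : (0 : ℝ) ≤ Nat.count p (N % M) := by positivity
  have h7 : (Nat.count p (N % M) : ℝ) ≤ Nat.count p M := by exact_mod_cast h2
  rw [e, h1, abs_le]
  push_cast
  constructor <;> nlinarith

lemma abs_card_hits_sub_le {D : Finset ℕ} (hD : ∀ l ∈ D, l.Prime) {Ω : ℕ → Finset ℕ}
    (hΩ : ∀ l ∈ D, Ω l ⊆ range l) (N : ℕ) :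
    |(((range N).filter fun s => ∀ l ∈ D, s % l ∈ Ω l).card : ℝ)
        - N * ∏ l ∈ D, ((Ω l).card / l : ℝ)| ≤ ∏ l ∈ D, ((Ω l).card : ℝ) := by
  have h := abs_count_sub_le (p := fun s => ∀ l ∈ D, s % l ∈ Ω l) (M := ∏ l ∈ D, l)
    (Finset.prod_pos fun l hl => (hD l hl).pos) (fun s => forall₂_congr fun l hl => by
      obtain ⟨c, hc⟩ := Finset.dvd_prod_of_mem (fun l => l) hl
      rw [hc, Nat.add_mul_mod_self_left]) N
  rw [card_filter_range_prod hD hΩ] at h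
  push_cast at h
  rwa [Finset.prod_div_distrib]

lemma sum_range_esum_le {Q : Finset ℕ} {g : ℕ → ℝ} (hg : ∀ p, 0 ≤ g p) (n : ℕ) :
    ∑ i ∈ range (n + 1), esum Q g i ≤ (1 + ∑ p ∈ Q, g p) ^ n := by
  have hS : 0 ≤ ∑ p ∈ Q, g p := Finset.sum_nonneg fun p _ => hg p
  rw [add_comm (1 : ℝ), add_pow]
  refine Finset.sum_le_sum fun i hi => (esum_le_pow_div_factorial Q hg i).trans ?_
  rw [one_pow, mul_one, div_eq_mul_inv]
  refine mul_le_mul_of_nonneg_left ?_ (pow_nonneg hS _)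
  have h1 : (1 : ℝ) ≤ i.factorial := by exact_mod_cast i.factorial_pos
  have h2 : (1 : ℝ) ≤ n.choose i := by
    exact_mod_cast Nat.choose_pos (Nat.lt_succ_iff.1 (Finset.mem_range.1 hi))
  exact (inv_le_one_of_one_le₀ h1).trans h2

/-- The combinatorial core of the Brun--Hooley sieve. -/
lemma brun_hooley_inequality (B : ℕ → Finset ℕ) (hB : ∀ i j, i ≠ j → Disjoint (B i) (B j))
    (n : ℕ) (hprime : ∀ j, ∀ l ∈ B j, l.Prime) {Ω : ℕ → Finset ℕ}
    (hΩ : ∀ j, ∀ l ∈ B j, Ω l ⊆ range l) (t : ℕ → ℕ) (N : ℕ) :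
    (((range N).filter fun s => ∀ l ∈ (range n).biUnion B, s % l ∉ Ω l).card : ℝ)
      ≤ N * ∏ j ∈ range n,
          ∑ i ∈ range (2 * t j + 1), esum (B j) (fun l => -((Ω l).card / l : ℝ)) i
        + ∏ j ∈ range n, (1 + ∑ l ∈ B j, ((Ω l).card : ℝ)) ^ (2 * t j) := by
  obtain ⟨F, hF, hsum⟩ := exists_family_prod_sum_esum B hB (fun j => 2 * t j) n
  let hit : ℕ → ℕ → ℝ := fun s l => if s % l ∈ Ω l then 1 else 0
  have step1 : (((range N).filter fun s => ∀ l ∈ (range n).biUnion B, s % l ∉ Ω l).card : ℝ)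
      ≤ ∑ s ∈ range N, ∑ D ∈ F, ∏ l ∈ D, -hit s l := by
    rw [Finset.card_filter]
    push_cast
    refine Finset.sum_le_sum fun s _ => ?_
    rw [hsum]
    have hb := fun j => bonferroni (Q := B j) (g := hit s)
      (fun l _ => by simp only [hit]; split_ifs <;> norm_num)
      (fun l _ => by simp only [hit]; split_ifs <;> norm_num) (2 * t j)
    have hV : ∀ j, 0 ≤ ∏ l ∈ B j, (1 - hit s l) := fun j => Finset.prod_nonneg fun l _ => by
      simp only [hit]; split_ifs <;> norm_num
    have hle : ∀ j, ∏ l ∈ B j, (1 - hit s l)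
        ≤ ∑ i ∈ range (2 * t j + 1), esum (B j) (fun l => -hit s l) i := fun j => by
      have := (hb j).1
      rw [pow_mul, neg_one_sq, one_pow, one_mul] at this
      linarith
    split_ifs with h
    · have : ∏ j ∈ range n, ∏ l ∈ B j, (1 - hit s l) = 1 :=
        Finset.prod_eq_one fun j hj => Finset.prod_eq_one fun l hl => by
          simp only [hit]
          rw [if_neg (h l (Finset.mem_biUnion.2 ⟨j, hj, hl⟩)), sub_zero]
      rw [← this]
      exact Finset.prod_le_prod (fun j _ => hV j) fun j _ => hle j
    · exact Finset.prod_nonneg fun j _ => (hV j).trans (hle j)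
  refine step1.trans ?_
  rw [Finset.sum_comm, ← hsum]
  have hBF : ∀ D ∈ F, ∀ l ∈ D, l.Prime ∧ Ω l ⊆ range l := fun D hD l hl => by
    obtain ⟨j, -, hj⟩ := Finset.mem_biUnion.1 (hF D hD hl)
    exact ⟨hprime j l hj, hΩ j l hj⟩
  have step2 : ∀ D ∈ F, ∑ s ∈ range N, ∏ l ∈ D, -hit s l
      ≤ N * ∏ l ∈ D, -((Ω l).card / l : ℝ) + ∏ l ∈ D, ((Ω l).card : ℝ) := by
    intro D hD
    have h := abs_card_hits_sub_le (fun l hl => (hBF D hD l hl).1)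
      (fun l hl => (hBF D hD l hl).2) N
    have e : ∑ s ∈ range N, ∏ l ∈ D, -hit s l
        = (-1) ^ D.card * (((range N).filter fun s => ∀ l ∈ D, s % l ∈ Ω l).card : ℝ) := by
      rw [Finset.card_filter]
      push_cast
      rw [Finset.mul_sum]
      refine Finset.sum_congr rfl fun s _ => ?_
      rw [Finset.prod_neg]
      congr 1
      split_ifs with h
      · exact Finset.prod_eq_one fun l hl => if_pos (h l hl)
      · push Not at h
        obtain ⟨l, hl, h⟩ := h
        exact Finset.prod_eq_zero hl (if_neg h)
    rw [e, Finset.prod_neg]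
    rw [abs_le] at h
    rcases neg_one_pow_eq_or ℝ D.card with h' | h' <;> rw [h'] <;> linarith
  refine (Finset.sum_le_sum step2).trans ?_
  rw [Finset.sum_add_distrib, ← Finset.mul_sum]
  refine add_le_add le_rfl ?_
  rw [hsum]
  exact Finset.prod_le_prod
    (fun j _ => Finset.sum_nonneg fun i _ => esum_nonneg (fun l _ => Nat.cast_nonneg _) i)
    fun j _ => sum_range_esum_le (fun l => Nat.cast_nonneg _) _

lemma sum_inv_dyadic_block_le (Q : Finset ℕ) (hQ : ∀ l ∈ Q, l.Prime) (j : ℕ) :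
    ∑ l ∈ Q.filter (fun l => 2 ^ 2 ^ j < l ∧ l ≤ 2 ^ 2 ^ (j + 1)), (l : ℝ)⁻¹ ≤ 4 := by
  have hL : 0 < (2 : ℝ) ^ j * log 2 := mul_pos (by positivity) (Real.log_pos (by norm_num))
  have h := sum_log_div_primesLE_le (2 ^ 2 ^ (j + 1))
  have e : 2 * log ((2 ^ 2 ^ (j + 1) : ℕ) : ℝ) = 4 * (2 ^ j * log 2) := by
    push_cast
    rw [Real.log_pow]; push_cast; ring
  rw [e] at h
  refine le_of_mul_le_mul_left ?_ hL
  rw [mul_comm _ (4 : ℝ)]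
  refine le_trans ?_ h
  rw [Finset.mul_sum]
  have hsub : Q.filter (fun l => 2 ^ 2 ^ j < l ∧ l ≤ 2 ^ 2 ^ (j + 1))
      ⊆ Nat.primesLE (2 ^ 2 ^ (j + 1)) := fun l hl => by
    rw [Finset.mem_filter] at hl
    exact Nat.mem_primesLE.2 ⟨hl.2.2, hQ l hl.1⟩
  refine le_trans (Finset.sum_le_sum fun l hl => ?_)
    (Finset.sum_le_sum_of_subset_of_nonneg hsub fun l _ _ =>
      div_nonneg (Real.log_natCast_nonneg l) (Nat.cast_nonneg l))
  rw [Finset.mem_filter] at hl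
  rw [div_eq_mul_inv]
  refine mul_le_mul_of_nonneg_right ?_ (by positivity)
  have : (2 : ℝ) ^ j * log 2 = log ((2 ^ 2 ^ j : ℕ) : ℝ) := by
    push_cast; rw [Real.log_pow]; push_cast; ring
  rw [this]
  exact Real.log_le_log (by positivity) (by exact_mod_cast hl.2.1.le)

lemma prod_Icc_one_sub_two_div (w : ℕ) (hw : 2 ≤ w) :
    ((w : ℝ) ^ 2)⁻¹ ≤ ∏ n ∈ Icc 3 w, (1 - 2 / (n : ℝ)) := by
  have key : ∏ n ∈ Icc 3 w, (1 - 2 / (n : ℝ)) = 2 / (w * (w - 1)) := by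
    induction w, hw using Nat.le_induction with
    | base => norm_num
    | succ w hw ih =>
      have h2 : (2 : ℝ) ≤ w := by exact_mod_cast hw
      have h3 : (w : ℝ) - 1 ≠ 0 := by linarith
      have h4 : (w : ℝ) ≠ 0 := by linarith
      have h5 : (w : ℝ) + 1 ≠ 0 := by linarith
      rw [Finset.prod_Icc_succ_top (by omega), ih]
      push_cast
      rw [add_sub_cancel_right]
      field_simp
      ring
  rw [key]
  have h2 : (2 : ℝ) ≤ w := by exact_mod_cast hw
  rw [← one_div]
  rw [div_le_div_iff₀ (by positivity) (by nlinarith)]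
  nlinarith

lemma inv_sq_le_prod_one_sub {Q : Finset ℕ} {w : ℕ} (hQ : ∀ l ∈ Q, 3 ≤ l ∧ l ≤ w) (hw : 2 ≤ w)
    {κ : ℕ → ℕ} (hκ : ∀ l ∈ Q, κ l ≤ 2) :
    ((w : ℝ) ^ 2)⁻¹ ≤ ∏ l ∈ Q, (1 - (κ l : ℝ) / l) := by
  have hle : ∀ l : ℕ, 3 ≤ l → (0 : ℝ) ≤ 1 - 2 / l ∧ (1 : ℝ) - 2 / l ≤ 1 := fun l hl => by
    have : (3 : ℝ) ≤ l := by exact_mod_cast hl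
    have h2 : 2 / (l : ℝ) ≤ 1 := by rw [div_le_one (by linarith)]; linarith
    have h3 : 0 ≤ 2 / (l : ℝ) := by positivity
    constructor <;> linarith
  refine (prod_Icc_one_sub_two_div w hw).trans ?_
  have hsub : Q ⊆ Icc 3 w := fun l hl => Finset.mem_Icc.2 (hQ l hl)
  rw [← Finset.prod_sdiff hsub]
  have h1 : ∏ n ∈ Icc 3 w \ Q, (1 - 2 / (n : ℝ)) ≤ 1 :=
    Finset.prod_le_one (fun l hl => (hle l (Finset.mem_Icc.1 (Finset.mem_sdiff.1 hl).1).1).1)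
      fun l hl => (hle l (Finset.mem_Icc.1 (Finset.mem_sdiff.1 hl).1).1).2
  have h2 : ∏ n ∈ Q, (1 - 2 / (n : ℝ)) ≤ ∏ l ∈ Q, (1 - (κ l : ℝ) / l) :=
    Finset.prod_le_prod (fun l hl => (hle l (hQ l hl).1).1) fun l hl => by
      have : (κ l : ℝ) ≤ 2 := by exact_mod_cast hκ l hl
      gcongr
  have h3 : 0 ≤ ∏ n ∈ Q, (1 - 2 / (n : ℝ)) :=
    Finset.prod_nonneg fun l hl => (hle l (hQ l hl).1).1
  nlinarith

lemma prod_pow_blocks_le (J : ℕ) (S : ℕ → ℝ) (hS0 : ∀ j, 0 ≤ S j)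
    (hS : ∀ j, S j ≤ 2 * (2 ^ 2 ^ (j + 1) : ℕ) - 1) :
    ∏ j ∈ range J, (1 + S j) ^ (2 * (J - 1 - j)) ≤ ((2 ^ 2 ^ J : ℕ) : ℝ) ^ 8 := by
  have h1 : ∀ j, 1 + S j ≤ (2 : ℝ) ^ (4 * 2 ^ j) := fun j => by
    have h := hS j
    have hX : (2 : ℝ) ≤ (2 ^ 2 ^ (j + 1) : ℕ) := by
      have : 2 ^ 1 ≤ 2 ^ 2 ^ (j + 1) := Nat.pow_le_pow_right (by norm_num) Nat.one_le_two_pow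
      exact_mod_cast this
    have e : (2 : ℝ) ^ (4 * 2 ^ j) = ((2 ^ 2 ^ (j + 1) : ℕ) : ℝ) ^ 2 := by
      push_cast
      rw [← pow_mul]; congr 1; ring
    rw [e]; nlinarith
  calc ∏ j ∈ range J, (1 + S j) ^ (2 * (J - 1 - j))
      ≤ ∏ j ∈ range J, ((2 : ℝ) ^ (4 * 2 ^ j)) ^ (2 * (J - 1 - j)) :=
        Finset.prod_le_prod (fun j _ => pow_nonneg (by linarith [hS0 j]) _)
          fun j _ => pow_le_pow_left₀ (by linarith [hS0 j]) (h1 j) _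
    _ = (2 : ℝ) ^ (8 * ∑ j ∈ range J, 2 ^ j * (J - 1 - j)) := by
        simp_rw [← pow_mul]
        rw [Finset.prod_pow_eq_pow_sum, Finset.mul_sum]
        congr 1
        exact Finset.sum_congr rfl fun j _ => by ring
    _ ≤ (2 : ℝ) ^ (8 * 2 ^ J) := by
        refine pow_le_pow_right₀ (by norm_num) (Nat.mul_le_mul_left _ ?_)
        have : ∀ J : ℕ, ∑ j ∈ range J, 2 ^ j * (J - 1 - j) + J + 1 = 2 ^ J := by
          intro J
          induction J with
          | zero => simp
          | succ J ih =>
            have e : ∀ j ∈ range J, 2 ^ j * (J + 1 - 1 - j) = 2 ^ j * (J - 1 - j) + 2 ^ j := by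
              intro j hj
              rw [Finset.mem_range] at hj
              obtain ⟨d, rfl⟩ := Nat.exists_eq_add_of_lt hj
              have e1 : j + d + 1 + 1 - 1 - j = d + 1 := by omega
              have e2 : j + d + 1 - 1 - j = d := by omega
              rw [e1, e2]; ring
            have e2 : ∑ j ∈ range J, 2 ^ j + 1 = 2 ^ J := by
              have := Nat.geomSum_eq (le_refl 2) J
              have h2 : 1 ≤ 2 ^ J := Nat.one_le_two_pow
              simp at this; omega
            rw [Finset.sum_range_succ, Finset.sum_congr rfl e, Finset.sum_add_distrib, pow_succ]
            simp
            omega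
        have := this J
        omega
    _ = ((2 ^ 2 ^ J : ℕ) : ℝ) ^ 8 := by
        push_cast
        rw [← pow_mul]; congr 1; ring

lemma block_main_le {Q : Finset ℕ} {g : ℕ → ℝ} (h0 : ∀ l, 0 ≤ g l) (h1 : ∀ l ∈ Q, g l ≤ 2 / 3)
    (hS : ∑ l ∈ Q, g l ≤ 8) (t : ℕ) :
    ∑ i ∈ range (2 * t + 1), esum Q (fun l => -g l) i
      ≤ (∏ l ∈ Q, (1 - g l)) * exp (exp 24 * (8 ^ (2 * t + 1) / ((2 * t + 1).factorial : ℝ))) := by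
  have hb := (bonferroni (fun l _ => h0 l) (fun l hl => (h1 l hl).trans (by norm_num)) (2 * t)).2
  rw [pow_mul, neg_one_sq, one_pow, one_mul] at hb
  have hV : 1 ≤ (∏ l ∈ Q, (1 - g l)) * exp 24 := by
    have : exp (-24) ≤ ∏ l ∈ Q, (1 - g l) := by
      calc exp (-24) ≤ exp (∑ l ∈ Q, -(3 * g l)) := by
            rw [Finset.sum_neg_distrib, ← Finset.mul_sum]
            exact Real.exp_le_exp.2 (by linarith)
        _ = ∏ l ∈ Q, exp (-(3 * g l)) := Real.exp_sum _ _
        _ ≤ _ := Finset.prod_le_prod (fun _ _ => (Real.exp_pos _).le) fun l hl => by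
            rw [Real.exp_neg, inv_le_comm₀ (Real.exp_pos _) (by linarith [h1 l hl])]
            refine le_trans ?_ (Real.add_one_le_exp _)
            rw [inv_le_iff_one_le_mul₀ (by linarith [h1 l hl])]
            nlinarith [h1 l hl, h0 l]
    calc (1 : ℝ) = exp (-24) * exp 24 := by rw [← Real.exp_add]; simp
      _ ≤ _ := mul_le_mul_of_nonneg_right this (Real.exp_pos _).le
  have hV0 : 0 ≤ ∏ l ∈ Q, (1 - g l) := Finset.prod_nonneg fun l hl => by linarith [h1 l hl]
  have he : esum Q g (2 * t + 1) ≤ 8 ^ (2 * t + 1) / ((2 * t + 1).factorial : ℝ) := by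
    refine (esum_le_pow_div_factorial Q h0 _).trans ?_
    have := Finset.sum_nonneg (s := Q) fun l _ => h0 l
    gcongr
  set u : ℝ := 8 ^ (2 * t + 1) / ((2 * t + 1).factorial : ℝ) with hu
  have hu0 : 0 ≤ u := by positivity
  calc ∑ i ∈ range (2 * t + 1), esum Q (fun l => -g l) i
      ≤ ∏ l ∈ Q, (1 - g l) + u := by linarith
    _ ≤ (∏ l ∈ Q, (1 - g l)) * (exp 24 * u + 1) := by nlinarith
    _ ≤ _ := mul_le_mul_of_nonneg_left (Real.add_one_le_exp _) hV0

/-- An upper bound sieve of dimension at most two. -/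
theorem exists_sieve_upper_bound :
    ∃ C : ℝ, 0 < C ∧ ∀ (J : ℕ) (Q : Finset ℕ) (Ω : ℕ → Finset ℕ) (N : ℕ),
      (∀ l ∈ Q, l.Prime ∧ 3 ≤ l ∧ l ≤ 2 ^ 2 ^ J) → (∀ l ∈ Q, Ω l ⊆ range l) →
      (∀ l ∈ Q, (Ω l).card ≤ 2) → (2 ^ 2 ^ J) ^ 10 ≤ N →
      (((range N).filter fun s => ∀ l ∈ Q, s % l ∉ Ω l).card : ℝ)
        ≤ C * N * ∏ l ∈ Q, (1 - ((Ω l).card : ℝ) / l) := by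
  refine ⟨exp (exp 24 * exp 8) + 1, by positivity, fun J Q Ω N hQ hΩ hcard hN => ?_⟩
  let B : ℕ → Finset ℕ := fun j => Q.filter (fun l => 2 ^ 2 ^ j < l ∧ l ≤ 2 ^ 2 ^ (j + 1))
  have hmono : ∀ i j : ℕ, i ≤ j → 2 ^ 2 ^ i ≤ 2 ^ 2 ^ j := fun i j h =>
    Nat.pow_le_pow_right (by norm_num) (Nat.pow_le_pow_right (by norm_num) h)
  have hBsub : ∀ j, B j ⊆ Q := fun j => Finset.filter_subset _ _
  have hB : ∀ i j, i ≠ j → Disjoint (B i) (B j) := by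
    intro i j hij
    rw [Finset.disjoint_left]
    intro l hi hj
    rw [Finset.mem_filter] at hi hj
    rcases lt_or_gt_of_ne hij with h | h
    · have := hmono (i + 1) j h; omega
    · have := hmono (j + 1) i h; omega
  have hcover : (range J).biUnion B = Q := by
    refine Finset.Subset.antisymm (Finset.biUnion_subset.2 fun j _ => hBsub j) fun l hl => ?_
    obtain ⟨-, h3, h4⟩ := hQ l hl
    have hex : ∃ j, l ≤ 2 ^ 2 ^ j := ⟨J, h4⟩
    classical
    obtain ⟨j, hj⟩ : ∃ j, Nat.find hex = j + 1 := Nat.exists_eq_succ_of_ne_zero fun h => by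
      have := Nat.find_spec hex
      rw [h] at this; norm_num at this; omega
    have hJ : Nat.find hex ≤ J := Nat.find_min' hex h4
    refine Finset.mem_biUnion.2 ⟨j, Finset.mem_range.2 (by omega), Finset.mem_filter.2 ⟨hl, ?_, ?_⟩⟩
    · exact not_le.1 (Nat.find_min hex (by omega))
    · rw [← hj]; exact Nat.find_spec hex
  have key := brun_hooley_inequality B hB J (fun j l hl => (hQ l (hBsub j hl)).1)
    (fun j l hl => hΩ l (hBsub j hl)) (fun j => J - 1 - j) N
  rw [hcover] at key
  have hg : ∀ j, ∀ l ∈ B j, ((Ω l).card : ℝ) / l ≤ 2 / 3 := fun j l hl => by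
    have h1 : ((Ω l).card : ℝ) ≤ 2 := by exact_mod_cast hcard l (hBsub j hl)
    have h2 : (3 : ℝ) ≤ l := by exact_mod_cast (hQ l (hBsub j hl)).2.1
    gcongr
  have hgS : ∀ j, ∑ l ∈ B j, ((Ω l).card : ℝ) / l ≤ 8 := fun j => by
    have h := sum_inv_dyadic_block_le Q (fun l hl => (hQ l hl).1) j
    calc ∑ l ∈ B j, ((Ω l).card : ℝ) / l ≤ ∑ l ∈ B j, 2 * (l : ℝ)⁻¹ :=
          Finset.sum_le_sum fun l hl => by
            have h1 : ((Ω l).card : ℝ) ≤ 2 := by exact_mod_cast hcard l (hBsub j hl)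
            rw [div_eq_mul_inv]; gcongr
      _ ≤ 8 := by rw [← Finset.mul_sum]; linarith
  have hV : ∏ j ∈ range J, ∏ l ∈ B j, (1 - ((Ω l).card : ℝ) / l)
      = ∏ l ∈ Q, (1 - ((Ω l).card : ℝ) / l) := by
    rw [← Finset.prod_biUnion fun i _ j _ hij => hB i j hij, hcover]
  have hmain : ∏ j ∈ range J, ∑ i ∈ range (2 * (J - 1 - j) + 1),
      esum (B j) (fun l => -((Ω l).card / l : ℝ)) i
      ≤ (∏ l ∈ Q, (1 - ((Ω l).card : ℝ) / l)) * exp (exp 24 * exp 8) := by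
    rw [← hV]
    calc _ ≤ ∏ j ∈ range J, ((∏ l ∈ B j, (1 - ((Ω l).card : ℝ) / l)) *
          exp (exp 24 * (8 ^ (2 * (J - 1 - j) + 1) / ((2 * (J - 1 - j) + 1).factorial : ℝ)))) := by
          refine Finset.prod_le_prod (fun j _ => ?_) fun j _ =>
            block_main_le (fun l => by positivity) (hg j) (hgS j) _
          have hb := (bonferroni (Q := B j) (g := fun l => ((Ω l).card : ℝ) / l)
            (fun l _ => by positivity) (fun l hl => (hg j l hl).trans (by norm_num))
            (2 * (J - 1 - j))).1
          rw [pow_mul, neg_one_sq, one_pow, one_mul] at hb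
          have : 0 ≤ ∏ l ∈ B j, (1 - ((Ω l).card : ℝ) / l) :=
            Finset.prod_nonneg fun l hl => by linarith [hg j l hl]
          linarith
      _ ≤ _ := by
          rw [Finset.prod_mul_distrib, ← Real.exp_sum, ← Finset.mul_sum]
          refine mul_le_mul_of_nonneg_left ?_ ?_
          · refine Real.exp_le_exp.2 (mul_le_mul_of_nonneg_left ?_ (Real.exp_pos _).le)
            rw [Finset.sum_range_reflect
              (fun t => (8 : ℝ) ^ (2 * t + 1) / ((2 * t + 1).factorial : ℝ)) J]
            refine le_trans ?_ (Real.sum_le_exp_of_nonneg (by norm_num) (2 * J))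
            refine sum_le_sum_of_injOn (fun t => 2 * t + 1) ?_ ?_ ?_ ?_
            · intro t ht; simp only [Finset.mem_range] at *; omega
            · intro a _ b _ h; simp only at h; omega
            · intro t _; exact le_rfl
            · intro i _; positivity
          · exact Finset.prod_nonneg fun j _ => Finset.prod_nonneg fun l hl => by
              linarith [hg j l hl]
  have herr := prod_pow_blocks_le J (fun j => ∑ l ∈ B j, ((Ω l).card : ℝ))
    (fun j => Finset.sum_nonneg fun _ _ => Nat.cast_nonneg _) (fun j => by
      have h1 : (B j).card ≤ 2 ^ 2 ^ (j + 1) - 1 := by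
        refine (Finset.card_le_card (t := Icc 2 (2 ^ 2 ^ (j + 1))) fun l hl => ?_).trans
          (by rw [Nat.card_Icc]; omega)
        exact Finset.mem_Icc.2 ⟨(hQ l (hBsub j hl)).1.two_le, (Finset.mem_filter.1 hl).2.2⟩
      have h2 : ((B j).card : ℝ) + 1 ≤ (2 ^ 2 ^ (j + 1) : ℕ) := by
        have : 1 ≤ 2 ^ 2 ^ (j + 1) := Nat.one_le_two_pow
        exact_mod_cast (by omega : (B j).card + 1 ≤ 2 ^ 2 ^ (j + 1))
      calc ∑ l ∈ B j, ((Ω l).card : ℝ) ≤ ∑ l ∈ B j, 2 :=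
            Finset.sum_le_sum fun l hl => by exact_mod_cast hcard l (hBsub j hl)
        _ = 2 * (B j).card := by rw [Finset.sum_const, nsmul_eq_mul, mul_comm]
        _ ≤ _ := by linarith)
  have hw2 : 2 ≤ 2 ^ 2 ^ J := by
    calc 2 = 2 ^ 1 := rfl
      _ ≤ _ := Nat.pow_le_pow_right (by norm_num) Nat.one_le_two_pow
  have hVlow := inv_sq_le_prod_one_sub (fun l hl => (hQ l hl).2) hw2 hcard
  have hw : (0 : ℝ) < (2 ^ 2 ^ J : ℕ) := by positivity
  have hN' : ((2 ^ 2 ^ J : ℕ) : ℝ) ^ 10 ≤ N := by exact_mod_cast hN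
  generalize ((2 ^ 2 ^ J : ℕ) : ℝ) = w at *
  have h8 : w ^ 8 ≤ N * ∏ l ∈ Q, (1 - ((Ω l).card : ℝ) / l) := by
    calc w ^ 8 = w ^ 10 * (w ^ 2)⁻¹ := by field_simp
      _ ≤ _ := mul_le_mul hN' hVlow (by positivity) (Nat.cast_nonneg _)
  have hmain' := mul_le_mul_of_nonneg_left hmain (Nat.cast_nonneg (α := ℝ) N)
  linarith

lemma sum_prod_factorization_le {A Q : Finset ℕ} {j : ℕ}
    (hA : ∀ a ∈ A, a ≠ 0 ∧ a.primeFactors ⊆ Q ∧ a.primeFactors.card = j)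
    {φ : ℕ → ℕ → ℝ} (hφ : ∀ l v, 0 ≤ φ l v) {G : ℕ → ℝ}
    (hG : ∀ l ∈ Q, ∀ V : ℕ, ∑ v ∈ Icc 1 V, φ l v ≤ G l) :
    ∑ a ∈ A, ∏ l ∈ a.primeFactors, φ l (a.factorization l) ≤ esum Q G j := by
  have hmaps : ∀ a ∈ A, a.primeFactors ∈ Q.powersetCard j := fun a ha =>
    Finset.mem_powersetCard.2 (hA a ha).2
  rw [← Finset.sum_fiberwise_of_maps_to hmaps, esum]
  refine Finset.sum_le_sum fun D hD => ?_
  let V := A.sup id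
  calc ∑ a ∈ A with a.primeFactors = D, ∏ l ∈ a.primeFactors, φ l (a.factorization l)
      ≤ ∑ p ∈ D.pi fun _ => Icc 1 V, ∏ l ∈ D.attach, φ l.1 (p l.1 l.2) := by
        refine sum_le_sum_of_injOn (fun a l _ => a.factorization l) ?_ ?_ ?_ ?_
        · intro a ha
          obtain ⟨haA, rfl⟩ := Finset.mem_filter.1 ha
          refine Finset.mem_pi.2 fun l hl => Finset.mem_Icc.2 ⟨?_, ?_⟩
          · exact (Nat.prime_of_mem_primeFactors hl).factorization_pos_of_dvd (hA a haA).1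
              (Nat.dvd_of_mem_primeFactors hl)
          · exact (Nat.factorization_lt l (hA a haA).1).le.trans (Finset.le_sup (f := id) haA)
        · intro a ha b hb h
          obtain ⟨ha, haD⟩ := Finset.mem_filter.1 ha
          obtain ⟨hb, hbD⟩ := Finset.mem_filter.1 hb
          refine Nat.eq_of_factorization_eq (hA a ha).1 (hA b hb).1 fun l => ?_
          by_cases hl : l ∈ D
          · exact congrFun (congrFun h l) hl
          · have h1 : l ∉ a.factorization.support := by rwa [Nat.support_factorization, haD]
            have h2 : l ∉ b.factorization.support := by rwa [Nat.support_factorization, hbD]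
            rw [Finsupp.notMem_support_iff.1 h1, Finsupp.notMem_support_iff.1 h2]
        · intro a ha
          obtain ⟨-, rfl⟩ := Finset.mem_filter.1 ha
          exact (Finset.prod_attach a.primeFactors fun l => φ l (a.factorization l)).ge
        · exact fun p _ => Finset.prod_nonneg fun l _ => hφ _ _
    _ = ∏ l ∈ D, ∑ v ∈ Icc 1 V, φ l v := (Finset.prod_sum _ _ _).symm
    _ ≤ ∏ l ∈ D, G l := Finset.prod_le_prod
        (fun l _ => Finset.sum_nonneg fun v _ => hφ l v)
        fun l hl => hG l ((Finset.mem_powersetCard.1 hD).1 hl) V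

lemma primeFactors_prod_of_prime {D : Finset ℕ} (hD : ∀ l ∈ D, l.Prime) :
    (∏ l ∈ D, l).primeFactors = D := by
  ext l
  rw [Nat.mem_primeFactors]
  constructor
  · rintro ⟨hl, hdvd, -⟩
    obtain ⟨q, hq, h⟩ := (hl.prime.dvd_finsetProd_iff _).1 hdvd
    rwa [(Nat.prime_dvd_prime_iff_eq hl (hD q hq)).1 h]
  · exact fun hl => ⟨hD l hl, Finset.dvd_prod_of_mem _ hl,
      Finset.prod_ne_zero_iff.2 fun q hq => (hD q hq).ne_zero⟩

lemma le_pik_succ {x : ℝ} (hx1 : 1 < x) (hx : 100 ≤ x ^ (1 / 3 : ℝ))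
    (hlog : 4 * log x ≤ x ^ (1 / 3 : ℝ)) (j : ℕ) :
    x / (4 * log x) * ∑ D ∈ ((Nat.primesLE ⌊x⌋₊).powersetCard j).filter
        (fun D => ((∏ l ∈ D, l : ℕ) : ℝ) ≤ x ^ (1 / 3 : ℝ)), ∏ l ∈ D, (l : ℝ)⁻¹
      ≤ pik (j + 1) x := by
  set y := x ^ (1 / 3 : ℝ) with hy
  set T := ((Nat.primesLE ⌊x⌋₊).powersetCard j).filter
        (fun D => ((∏ l ∈ D, l : ℕ) : ℝ) ≤ y) with hT
  have hx0 : 0 < x := by linarith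
  have hL : 0 < log x := Real.log_pos hx1
  have hy3 : y * y * y = x := by
    rw [hy, ← Real.rpow_add hx0, ← Real.rpow_add hx0]; norm_num
  have hTp : ∀ D ∈ T, (∀ l ∈ D, l.Prime) ∧ D.card = j ∧ ((∏ l ∈ D, l : ℕ) : ℝ) ≤ y ∧
      (1 : ℝ) ≤ (∏ l ∈ D, l : ℕ) := by
    intro D hD
    obtain ⟨h1, h2⟩ := Finset.mem_filter.1 hD
    obtain ⟨h3, h4⟩ := Finset.mem_powersetCard.1 h1
    have hp : ∀ l ∈ D, l.Prime := fun l hl => Nat.prime_of_mem_primesLE (h3 hl)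
    exact ⟨hp, h4, h2, by exact_mod_cast Finset.prod_pos fun l hl => (hp l hl).pos⟩
  let q : Finset ℕ → Finset ℕ := fun D =>
    (Nat.primesLE ⌊x / (∏ l ∈ D, l : ℕ)⌋₊).filter fun p => y < p
  have hle_of_mem : ∀ D ∈ T, ∀ l ∈ D, (l : ℝ) ≤ y := fun D hD l hl => by
    refine le_trans ?_ (hTp D hD).2.2.1
    have h1 : (∏ l ∈ D, l : ℕ) ≠ 0 := Finset.prod_ne_zero_iff.2 fun q hq => ((hTp D hD).1 q hq).ne_zero
    exact_mod_cast Nat.le_of_dvd (Nat.pos_of_ne_zero h1) (Finset.dvd_prod_of_mem _ hl)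
  have hcount : ((T.sigma q).card : ℝ) ≤ pik (j + 1) x := by
    rw [pik]
    norm_cast
    refine Finset.card_le_card_of_injOn (fun s => (∏ l ∈ s.1, l) * s.2) ?_ ?_
    · rintro ⟨D, p⟩ h
      obtain ⟨hD, hp⟩ := Finset.mem_sigma.1 h
      obtain ⟨h1, h2⟩ := Finset.mem_filter.1 hp
      obtain ⟨h3, h4⟩ := Nat.mem_primesLE.1 h1
      obtain ⟨hDp, hDc, hDy, hD1⟩ := hTp D hD
      have hpD : p ∉ D := fun h => absurd (hle_of_mem D hD p h) (not_le.2 h2)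
      have e : (∏ l ∈ D, l) * p = ∏ l ∈ insert p D, l := by
        rw [Finset.prod_insert hpD, mul_comm]
      have hins : ∀ l ∈ insert p D, l.Prime := fun l hl => by
        rcases Finset.mem_insert.1 hl with rfl | hl
        exacts [h4, hDp l hl]
      refine Finset.mem_coe.2 (Finset.mem_filter.2 ⟨Finset.mem_Icc.2 ⟨?_, ?_⟩, ?_⟩)
      · simp only [e]; exact Finset.prod_pos fun l hl => (hins l hl).pos
      · refine Nat.le_floor ?_
        push_cast
        have h5 := (Nat.le_floor_iff (by positivity)).1 h3
        rw [le_div_iff₀ (by linarith)] at h5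
        push_cast at h5
        linarith
      · simp only [e]
        rw [primeFactors_prod_of_prime hins, Finset.card_insert_of_notMem hpD, hDc]
    · rintro ⟨D, p⟩ h ⟨D', p'⟩ h' heq
      obtain ⟨hD, hp⟩ := Finset.mem_sigma.1 h
      obtain ⟨hD', hp'⟩ := Finset.mem_sigma.1 h'
      obtain ⟨h1, h2⟩ := Finset.mem_filter.1 hp
      obtain ⟨h1', h2'⟩ := Finset.mem_filter.1 hp'
      simp only at heq
      have hprime := Nat.prime_of_mem_primesLE h1
      have hdvd : p ∣ (∏ l ∈ D', l) * p' := heq ▸ dvd_mul_left _ _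
      have hpp : p = p' := by
        rcases (Nat.Prime.dvd_mul hprime).1 hdvd with h5 | h5
        · obtain ⟨l, hl, h6⟩ := (hprime.prime.dvd_finsetProd_iff _).1 h5
          rw [(Nat.prime_dvd_prime_iff_eq hprime ((hTp D' hD').1 l hl)).1 h6] at h2
          exact absurd (hle_of_mem D' hD' l hl) (not_le.2 h2)
        · exact (Nat.prime_dvd_prime_iff_eq hprime (Nat.prime_of_mem_primesLE h1')).1 h5
      subst hpp
      have h6 := Nat.eq_of_mul_eq_mul_right hprime.pos heq
      have h7 : D = D' := by
        rw [← primeFactors_prod_of_prime (hTp D hD).1, h6, primeFactors_prod_of_prime (hTp D' hD').1]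
      rw [h7]
  refine le_trans ?_ hcount
  rw [Finset.card_sigma, Finset.mul_sum]
  push_cast
  refine Finset.sum_le_sum fun D hD => ?_
  obtain ⟨hDp, hDc, hDy, hD1⟩ := hTp D hD
  rw [Finset.prod_inv_distrib, ← Nat.cast_prod]
  generalize ha : (∏ l ∈ D, l : ℕ) = a at *
  have hq : q D = (Nat.primesLE ⌊x / a⌋₊).filter fun p : ℕ => y < p := by simp only [q, ha]
  have ha0 : (0 : ℝ) < a := by linarith
  have hxa : y * y ≤ x / a := by
    rw [le_div_iff₀ ha0, ← hy3]; nlinarith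
  have hxa' : x / a ≤ x := div_le_self hx0.le hD1
  have h100 : 100 ≤ x / a := by nlinarith
  have h1 := primeCounting_lower h100
  have h2 : x / a / (2 * log x) ≤ x / a / (2 * log (x / a)) := by
    have : 0 < log (x / a) := Real.log_pos (by linarith)
    have := Real.log_le_log (by positivity) hxa'
    gcongr
  have h3 : ((Nat.primesLE ⌊x / a⌋₊).card : ℝ) ≤ (q D).card + y := by
    have h4 := Finset.card_filter_add_card_filter_not (s := Nat.primesLE ⌊x / a⌋₊) (fun p : ℕ => y < p)
    have h5 : ((Nat.primesLE ⌊x / a⌋₊).filter fun p : ℕ => ¬ y < p).card ≤ ⌊y⌋₊ := by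
      refine (Finset.card_le_card (t := Icc 1 ⌊y⌋₊) fun p hp => ?_).trans (by simp)
      obtain ⟨h6, h7⟩ := Finset.mem_filter.1 hp
      exact Finset.mem_Icc.2 ⟨(Nat.prime_of_mem_primesLE h6).one_le, Nat.le_floor (not_lt.1 h7)⟩
    have h6 : (((Nat.primesLE ⌊x / a⌋₊).filter fun p : ℕ => ¬ y < p).card : ℝ) ≤ y :=
      le_trans (by exact_mod_cast h5) (Nat.floor_le (by linarith))
    rw [← h4, hq]
    push_cast
    linarith
  have h4 : y ≤ x / a / (4 * log x) := by
    rw [le_div_iff₀ (by positivity)]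
    nlinarith
  have h5 : x / a / (2 * log x) = 2 * (x / a / (4 * log x)) := by field_simp; ring
  have h6 : x / (4 * log x) * (a : ℝ)⁻¹ = x / a / (4 * log x) := by field_simp
  rw [h6]
  linarith

/-- The function `l ↦ 1 / l` truncated at `z`. -/
noncomputable def truncInv (z : ℝ) (l : ℕ) : ℝ := if (l : ℝ) ≤ z then (l : ℝ)⁻¹ else 0

/-- The sum of `1 / a` over the squarefree `x ^ c`-smooth `a` with `j` prime factors. -/
noncomputable def smoothSum (c x : ℝ) (j : ℕ) : ℝ :=
  esum (Nat.primesLE ⌊x⌋₊) (truncInv (x ^ c)) j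

lemma truncInv_nonneg (z : ℝ) (l : ℕ) : 0 ≤ truncInv z l := by
  unfold truncInv; split_ifs <;> positivity

lemma truncInv_le (z : ℝ) (l : ℕ) : truncInv z l ≤ (l : ℝ)⁻¹ := by
  unfold truncInv; split_ifs
  · exact le_rfl
  · positivity

lemma smoothSum_nonneg (c x : ℝ) (j : ℕ) : 0 ≤ smoothSum c x j :=
  esum_nonneg (fun l _ => truncInv_nonneg _ l) j

lemma sum_primesLE_ite {z x : ℝ} (hz : 0 ≤ z) (hzx : z ≤ x) (f : ℕ → ℝ) :
    ∑ l ∈ Nat.primesLE ⌊x⌋₊, (if (l : ℝ) ≤ z then f l else 0) = ∑ l ∈ Nat.primesLE ⌊z⌋₊, f l := by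
  rw [← Finset.sum_filter]
  congr 1
  ext l
  rw [Finset.mem_filter, Nat.mem_primesLE, Nat.mem_primesLE, Nat.le_floor_iff hz,
    Nat.le_floor_iff (hz.trans hzx)]
  exact ⟨fun h => ⟨h.2, h.1.2⟩, fun h => ⟨⟨h.1.trans hzx, h.2⟩, h.1⟩⟩

lemma sum_log_div_primesLE_floor_le {z : ℝ} (hz : 1 ≤ z) :
    ∑ l ∈ Nat.primesLE ⌊z⌋₊, log l / l ≤ 2 * log z := by
  refine (sum_log_div_primesLE_le _).trans ?_
  have h1 : 1 ≤ ⌊z⌋₊ := Nat.le_floor (by exact_mod_cast hz)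
  have := Real.log_le_log (by exact_mod_cast h1) (Nat.floor_le (by linarith : 0 ≤ z))
  linarith

lemma sum_inv_sub_truncInv_le {c x : ℝ} (hc : 0 < c) (hx : 1 < x) :
    ∑ l ∈ Nat.primesLE ⌊x⌋₊, ((l : ℝ)⁻¹ - truncInv (x ^ c) l) ≤ 2 / c := by
  have hL : 0 < log x := Real.log_pos hx
  have hcL : 0 < c * log x := mul_pos hc hL
  have key : ∀ l ∈ Nat.primesLE ⌊x⌋₊,
      (l : ℝ)⁻¹ - truncInv (x ^ c) l ≤ (c * log x)⁻¹ * (log l / l) := by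
    intro l hl
    have hl0 : (0 : ℝ) < l := by exact_mod_cast (Nat.prime_of_mem_primesLE hl).pos
    have hlog : 0 ≤ log (l : ℝ) := Real.log_natCast_nonneg l
    unfold truncInv
    split_ifs with h
    · rw [sub_self]; positivity
    · rw [sub_zero, inv_mul_eq_div, le_div_iff₀ hcL, div_eq_inv_mul]
      refine mul_le_mul_of_nonneg_left ?_ (by positivity)
      rw [← Real.log_rpow (by linarith)]
      exact Real.log_le_log (Real.rpow_pos_of_pos (by linarith) _) (not_le.1 h).le
  refine (Finset.sum_le_sum key).trans ?_
  rw [← Finset.mul_sum, inv_mul_eq_div, div_le_div_iff₀ hcL hc]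
  nlinarith [sum_log_div_primesLE_floor_le hx.le]

/-- Perturbing the weights `1 / l` by a bounded total amount costs a bounded factor. -/
lemma esum_le_mul_smoothSum {c r x H : ℝ} (hc : 0 < c) (hr : 0 ≤ r) (hx : 1 < x) {J : ℕ}
    (hrat : ∀ j < J, smoothSum c x j ≤ r * smoothSum c x (j + 1)) {g : ℕ → ℝ}
    (hg : ∀ l ∈ Nat.primesLE ⌊x⌋₊, (l : ℝ)⁻¹ ≤ g l)
    (hH : ∑ l ∈ Nat.primesLE ⌊x⌋₊, (g l - (l : ℝ)⁻¹) ≤ H) (j : ℕ) (hj : j ≤ J) :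
    esum (Nat.primesLE ⌊x⌋₊) g j ≤ exp (r * (H + 2 / c)) * smoothSum c x j := by
  let h : ℕ → ℝ := fun l => if l ∈ Nat.primesLE ⌊x⌋₊ then g l - truncInv (x ^ c) l else 0
  have hh : ∀ l, 0 ≤ h l := fun l => by
    simp only [h]
    split_ifs with hl
    · linarith [hg l hl, truncInv_le (x ^ c) l]
    · exact le_rfl
  have h1 := esum_add_le_exp_mul (Q := Nat.primesLE ⌊x⌋₊) (truncInv_nonneg (x ^ c)) hh hr hrat j hj
  have h2 : esum (Nat.primesLE ⌊x⌋₊) g j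
      ≤ esum (Nat.primesLE ⌊x⌋₊) (truncInv (x ^ c) + h) j := by
    refine esum_mono (fun l hl => (by positivity : (0 : ℝ) ≤ (l : ℝ)⁻¹).trans (hg l hl))
      (fun l hl => ?_) j
    simp only [Pi.add_apply, h]
    rw [if_pos hl]; linarith
  have h3 : ∑ l ∈ Nat.primesLE ⌊x⌋₊, h l ≤ H + 2 / c := by
    calc ∑ l ∈ Nat.primesLE ⌊x⌋₊, h l
        = ∑ l ∈ Nat.primesLE ⌊x⌋₊, (g l - (l : ℝ)⁻¹)
          + ∑ l ∈ Nat.primesLE ⌊x⌋₊, ((l : ℝ)⁻¹ - truncInv (x ^ c) l) := by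
          rw [← Finset.sum_add_distrib]
          refine Finset.sum_congr rfl fun l hl => ?_
          simp only [h]; rw [if_pos hl]; ring
      _ ≤ _ := add_le_add hH (sum_inv_sub_truncInv_le hc hx)
  refine h2.trans (h1.trans ?_)
  exact mul_le_mul_of_nonneg_right
    (Real.exp_le_exp.2 (mul_le_mul_of_nonneg_left h3 hr)) (smoothSum_nonneg c x j)

lemma inv_pow_le_smoothSum {c r x : ℝ} (hr : 0 < r) {J : ℕ}
    (hrat : ∀ j < J, smoothSum c x j ≤ r * smoothSum c x (j + 1)) :
    (r ^ J)⁻¹ ≤ smoothSum c x J := by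
  have h := esum_le_pow_mul_esum hr.le hrat J 0 (by omega)
  rw [esum_zero, zero_add] at h
  rwa [inv_le_iff_one_le_mul₀' (by positivity)]

lemma smoothSum_le_pow_mul {c r x : ℝ} (hr : 0 ≤ r) {J : ℕ}
    (hrat : ∀ j < J, smoothSum c x j ≤ r * smoothSum c x (j + 1)) (i j : ℕ) (hij : j + i ≤ J) :
    smoothSum c x j ≤ r ^ i * smoothSum c x (j + i) :=
  esum_le_pow_mul_esum hr hrat i j hij

/-- Rankin's trick: most of `smoothSum` comes from products of size at most `x ^ (1 / 3)`. -/
lemma smoothSum_le_two_mul {c r x : ℝ} (hr : 0 ≤ r) (hc : c = 1 / (3 * (4 * r + 1)))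
    (hx : 1 < x) {J : ℕ}
    (hrat : ∀ j < J, smoothSum c x j ≤ r * smoothSum c x (j + 1)) :
    smoothSum c x J ≤ 2 * ∑ D ∈ ((Nat.primesLE ⌊x⌋₊).powersetCard J).filter
        (fun D => ((∏ l ∈ D, l : ℕ) : ℝ) ≤ x ^ (1 / 3 : ℝ)), ∏ l ∈ D, (l : ℝ)⁻¹ := by
  have hc0 : 0 < c := by rw [hc]; positivity
  have hc1 : c ≤ 1 := by rw [hc, div_le_one (by positivity)]; linarith
  have hx0 : 0 < x := by linarith
  have hL : 0 < log x := Real.log_pos hx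
  set Q := Nat.primesLE ⌊x⌋₊ with hQ
  set s : ℝ := 1 / (c * log x) with hs
  have hs0 : 0 < s := by positivity
  set z := x ^ c with hz
  have hz1 : 1 ≤ z := Real.one_le_rpow hx.le hc0.le
  have hzx : z ≤ x := by
    calc z ≤ x ^ (1 : ℝ) := Real.rpow_le_rpow_of_exponent_le hx.le hc1
      _ = x := Real.rpow_one x
  have hlogz : log z = c * log x := Real.log_rpow hx0 c
  have hsz : s * log z = 1 := by rw [hs, hlogz]; field_simp
  let h : ℕ → ℝ := fun l => if (l : ℝ) ≤ z then 2 * s * (log l / l) else 0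
  have hh : ∀ l, 0 ≤ h l := fun l => by
    have : 0 ≤ log (l : ℝ) := Real.log_natCast_nonneg l
    simp only [h]; split_ifs <;> positivity
  have hhsum : ∑ l ∈ Q, h l ≤ 4 := by
    simp only [h]
    rw [sum_primesLE_ite (by linarith) hzx, ← Finset.mul_sum]
    nlinarith [sum_log_div_primesLE_floor_le hz1]
  have hpert := esum_add_le_exp_mul (Q := Q) (truncInv_nonneg z) hh hr hrat J le_rfl
  have hsplit := Finset.sum_filter_add_sum_filter_not (Q.powersetCard J)
    (fun D => ((∏ l ∈ D, l : ℕ) : ℝ) ≤ x ^ (1 / 3 : ℝ)) (fun D => ∏ l ∈ D, truncInv z l)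
  have hfirst : ∑ D ∈ (Q.powersetCard J).filter
      (fun D => ((∏ l ∈ D, l : ℕ) : ℝ) ≤ x ^ (1 / 3 : ℝ)), ∏ l ∈ D, truncInv z l
      ≤ ∑ D ∈ (Q.powersetCard J).filter
      (fun D => ((∏ l ∈ D, l : ℕ) : ℝ) ≤ x ^ (1 / 3 : ℝ)), ∏ l ∈ D, (l : ℝ)⁻¹ :=
    Finset.sum_le_sum fun D _ => Finset.prod_le_prod (fun l _ => truncInv_nonneg _ l)
      fun l _ => truncInv_le _ l
  have hsecond : ∑ D ∈ (Q.powersetCard J).filter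
      (fun D => ¬ ((∏ l ∈ D, l : ℕ) : ℝ) ≤ x ^ (1 / 3 : ℝ)), ∏ l ∈ D, truncInv z l
      ≤ exp (-(4 * r + 1)) * esum Q (truncInv z + h) J := by
    rw [esum, Finset.mul_sum]
    refine le_trans (Finset.sum_le_sum fun D hD => ?_)
      (Finset.sum_le_sum_of_subset_of_nonneg (Finset.filter_subset _ _) fun D _ _ =>
        mul_nonneg (Real.exp_pos _).le (Finset.prod_nonneg fun l _ =>
          add_nonneg (truncInv_nonneg z l) (hh l)))
    obtain ⟨hD1, hD2⟩ := Finset.mem_filter.1 hD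
    have hDp : ∀ l ∈ D, l.Prime := fun l hl =>
      Nat.prime_of_mem_primesLE ((Finset.mem_powersetCard.1 hD1).1 hl)
    have hpt : ∀ l ∈ D, (l : ℝ) ^ s * truncInv z l ≤ (truncInv z + h) l := by
      intro l hl
      have hl1 : (1 : ℝ) ≤ l := by exact_mod_cast (hDp l hl).one_le
      have hlog : 0 ≤ log (l : ℝ) := Real.log_natCast_nonneg l
      simp only [Pi.add_apply, truncInv, h]
      split_ifs with hlz
      · have h1 : log l ≤ log z := Real.log_le_log (by linarith) hlz
        have h2 : |log l * s| ≤ 1 := by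
          rw [abs_of_nonneg (by positivity)]; nlinarith
        have h3 := (abs_le.1 (Real.abs_exp_sub_one_le h2)).2
        rw [abs_of_nonneg (by positivity)] at h3
        rw [Real.rpow_def_of_pos (by linarith)]
        have h4 : (l : ℝ)⁻¹ + 2 * s * (log l / l) = (1 + 2 * (log l * s)) * (l : ℝ)⁻¹ := by ring
        rw [h4]
        exact mul_le_mul_of_nonneg_right (by linarith) (by positivity)
      · simp
    have hprod : ∏ l ∈ D, ((l : ℝ) ^ s * truncInv z l) ≤ ∏ l ∈ D, (truncInv z + h) l :=
      Finset.prod_le_prod (fun l _ => mul_nonneg (by positivity) (truncInv_nonneg z l)) hpt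
    rw [Finset.prod_mul_distrib, Real.finsetProd_rpow _ _ (fun l _ => Nat.cast_nonneg l),
      ← Nat.cast_prod] at hprod
    have hbig : exp (4 * r + 1) ≤ ((∏ l ∈ D, l : ℕ) : ℝ) ^ s := by
      have h1 : exp (4 * r + 1) = (x ^ (1 / 3 : ℝ)) ^ s := by
        rw [← Real.rpow_mul hx0.le, Real.rpow_def_of_pos hx0, hs, hc]
        congr 1
        field_simp
      rw [h1]
      exact Real.rpow_le_rpow (by positivity) (not_le.1 hD2).le hs0.le
    have hP0 : 0 ≤ ∏ l ∈ D, truncInv z l := Finset.prod_nonneg fun l _ => truncInv_nonneg z l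
    calc ∏ l ∈ D, truncInv z l
        = exp (-(4 * r + 1)) * (exp (4 * r + 1) * ∏ l ∈ D, truncInv z l) := by
          rw [← mul_assoc, ← Real.exp_add]; simp
      _ ≤ exp (-(4 * r + 1)) * ∏ l ∈ D, (truncInv z + h) l :=
          mul_le_mul_of_nonneg_left
            ((mul_le_mul_of_nonneg_right hbig hP0).trans hprod) (Real.exp_pos _).le
  have hE0 := smoothSum_nonneg c x J
  have hE : esum Q (truncInv z) J = smoothSum c x J := rfl
  have h1 : exp (-(4 * r + 1)) * esum Q (truncInv z + h) J ≤ 1 / 2 * smoothSum c x J := by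
    calc exp (-(4 * r + 1)) * esum Q (truncInv z + h) J
        ≤ exp (-(4 * r + 1)) * (exp (r * 4) * smoothSum c x J) := by
          refine mul_le_mul_of_nonneg_left (hpert.trans ?_) (Real.exp_pos _).le
          exact mul_le_mul_of_nonneg_right
            (Real.exp_le_exp.2 (mul_le_mul_of_nonneg_left hhsum hr)) hE0
      _ = exp (-1) * smoothSum c x J := by
          rw [← mul_assoc, ← Real.exp_add]; congr 2; ring
      _ ≤ _ := by
          refine mul_le_mul_of_nonneg_right ?_ hE0
          rw [Real.exp_neg, one_div]
          exact inv_anti₀ (by norm_num) (by linarith [Real.add_one_le_exp 1])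
  rw [show (Q.powersetCard J).sum (fun D => ∏ l ∈ D, truncInv z l) = smoothSum c x J from rfl]
    at hsplit
  linarith

open Filter in
/-- The parameters `c`, `r` are admissible for `k = J + 1 ≤ R log log x`. -/
lemma exists_smoothSum_ratio {R : ℝ} (hR : 0 < R) :
    ∃ r : ℝ, 1 ≤ r ∧ ∀ c : ℝ, 0 < c → c ≤ 1 → ∀ᶠ x : ℝ in Filter.atTop, ∀ J : ℕ,
      (J + 1 : ℝ) ≤ R * log (log x) →
      ∀ j < J, smoothSum c x j ≤ r * smoothSum c x (j + 1) := by
  refine ⟨8 * R + 1, by linarith, fun c hc hc1 => ?_⟩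
  have hlog := Real.tendsto_log_atTop
  have hloglog := hlog.comp hlog
  have hsq : ∀ᶠ u : ℝ in atTop, √u ≤ c * u - log 2 := by
    filter_upwards [Filter.eventually_ge_atTop ((2 / c) ^ 2), Filter.eventually_ge_atTop 1] with u hu hu1
    have h1 : 2 / c ≤ √u := Real.le_sqrt_of_sq_le hu
    rw [div_le_iff₀ hc] at h1
    have h2 := Real.mul_self_sqrt (by linarith : 0 ≤ u)
    have h3 : 1 ≤ √u := Real.one_le_sqrt.2 hu1
    have h4 : log 2 < 1 := Real.log_two_lt_d9.trans (by norm_num)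
    nlinarith
  filter_upwards [hlog.eventually hsq, hlog.eventually_ge_atTop 1, Filter.eventually_gt_atTop 1,
    hloglog.eventually_ge_atTop (8 * (8 * R + 1)),
    (tendsto_rpow_atTop hc).eventually_ge_atTop 2] with x hx1 hx2 hx3 hx4 hx5 J hJ
  simp only [Function.comp_apply] at hx4
  have hx0 : 0 < x := by linarith
  have hzx : x ^ c ≤ x := by
    calc x ^ c ≤ x ^ (1 : ℝ) := Real.rpow_le_rpow_of_exponent_le hx3.le hc1
      _ = x := Real.rpow_one x
  have hfl : (2 : ℕ) ≤ ⌊x ^ c⌋₊ := Nat.le_floor (by exact_mod_cast hx5)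
  have hlogfl : √(log x) ≤ log ⌊x ^ c⌋₊ := by
    refine hx1.trans ?_
    rw [← Real.log_rpow hx0, ← Real.log_div (by linarith) (by norm_num)]
    refine Real.log_le_log (by linarith) ?_
    have h1 := Nat.lt_floor_add_one (x ^ c)
    have h2 : (2 : ℝ) ≤ ⌊x ^ c⌋₊ := by exact_mod_cast hfl
    linarith
  have hS : 1 / 4 * log (log x) ≤ ∑ l ∈ Nat.primesLE ⌊x⌋₊, truncInv (x ^ c) l := by
    have h1 := log_log_le_sum_inv _ hfl
    have h2 : log (√(log x)) ≤ log (log ⌊x ^ c⌋₊) :=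
      Real.log_le_log (Real.sqrt_pos.2 (by linarith)) hlogfl
    rw [Real.log_sqrt (by linarith)] at h2
    simp only [truncInv]
    rw [sum_primesLE_ite (by linarith) hzx]
    linarith
  have hS2 : ∑ l ∈ Nat.primesLE ⌊x⌋₊, truncInv (x ^ c) l ^ 2 ≤ 1 := by
    refine le_trans (Finset.sum_le_sum fun l _ => ?_) (sum_primesLE_inv_sq_le ⌊x⌋₊)
    rw [← inv_pow]
    exact pow_le_pow_left₀ (truncInv_nonneg _ l) (truncInv_le _ l) 2
  refine esum_le_mul_esum_succ _ (truncInv_nonneg _) (by linarith) ?_ ?_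
  · nlinarith
  · nlinarith

/-- The main size in the problem: up to constants, `π_{J+1}(x)`. -/
noncomputable def mainSize (c x : ℝ) (J : ℕ) : ℝ := x / log x * smoothSum c x J

lemma exists_mainSize_le_pik {R : ℝ} (hR : 0 < R) :
    ∃ r c : ℝ, 1 ≤ r ∧ 0 < c ∧ ∀ᶠ x : ℝ in Filter.atTop, ∀ J : ℕ,
      (J + 1 : ℝ) ≤ R * log (log x) →
      (∀ j < J, smoothSum c x j ≤ r * smoothSum c x (j + 1)) ∧
      mainSize c x J ≤ 8 * pik (J + 1) x := by
  obtain ⟨r, hr, h⟩ := exists_smoothSum_ratio hR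
  have hc1 : 1 / (3 * (4 * r + 1)) ≤ 1 := by rw [div_le_one (by positivity)]; linarith
  refine ⟨r, 1 / (3 * (4 * r + 1)), hr, by positivity, ?_⟩
  have hlog : ∀ᶠ x : ℝ in Filter.atTop, 4 * log x ≤ x ^ (1 / 3 : ℝ) := by
    filter_upwards [(isLittleO_log_rpow_atTop (show (0 : ℝ) < 1 / 3 by norm_num)).bound
      (show (0 : ℝ) < 1 / 4 by norm_num), Filter.eventually_gt_atTop 1] with x hx hx1
    rw [Real.norm_of_nonneg (Real.log_nonneg hx1.le), Real.norm_of_nonneg (by positivity)] at hx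
    linarith
  filter_upwards [h _ (by positivity) hc1, hlog, Filter.eventually_gt_atTop 1,
    (tendsto_rpow_atTop (show (0 : ℝ) < 1 / 3 by norm_num)).eventually_ge_atTop 100]
    with x hx hx2 hx1 hx3 J hJ
  refine ⟨hx J hJ, ?_⟩
  have h1 := le_pik_succ hx1 hx3 hx2 J
  have h2 := smoothSum_le_two_mul (by linarith) rfl hx1 (hx J hJ)
  have hL : 0 < log x := Real.log_pos hx1
  have h3 : 0 ≤ x / (4 * log x) := by positivity
  have h4 := mul_le_mul_of_nonneg_left h2 h3
  have e : mainSize (1 / (3 * (4 * r + 1))) x J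
      = 4 * (x / (4 * log x) * smoothSum (1 / (3 * (4 * r + 1))) x J) := by
    rw [mainSize]; field_simp
  rw [e]
  linarith

/-- Any fixed power saving is negligible. -/
lemma rpow_le_mul_mainSize {c r R τ δ : ℝ} (hr : 1 ≤ r) (hτ : 0 < τ) (hδ : 0 < δ) :
    ∀ᶠ x : ℝ in Filter.atTop, ∀ J : ℕ, (J + 1 : ℝ) ≤ R * log (log x) →
      (∀ j < J, smoothSum c x j ≤ r * smoothSum c x (j + 1)) →
      x ^ (1 - τ) ≤ δ * mainSize c x J := by
  have hlog := Real.tendsto_log_atTop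
  have hA : ∀ᶠ u : ℝ in Filter.atTop, u ^ (1 + R * log r) * exp (-(τ * u)) ≤ δ :=
    ((tendsto_rpow_mul_exp_neg_mul_atTop_nhds_zero _ τ hτ).congr fun u => by
      rw [neg_mul]).eventually_le_const hδ
  filter_upwards [hlog.eventually hA, Filter.eventually_gt_atTop 1, hlog.eventually_ge_atTop 1]
    with x hx hx1 hx2 J hJ hrat
  have hx0 : 0 < x := by linarith
  have hL : 0 < log x := by linarith
  have hlr : 0 ≤ log r := Real.log_nonneg hr
  have h1 := inv_pow_le_smoothSum (by linarith) hrat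
  have h2 : log x ^ (-(R * log r)) ≤ (r ^ J)⁻¹ := by
    rw [Real.rpow_neg hL.le]
    refine inv_anti₀ (by positivity) ?_
    rw [Real.rpow_def_of_pos hL, ← Real.rpow_natCast, Real.rpow_def_of_pos (by linarith)]
    refine Real.exp_le_exp.2 ?_
    nlinarith
  have h3 : x ^ (1 - τ) = x * exp (-(τ * log x)) := by
    rw [sub_eq_add_neg, Real.rpow_add hx0, Real.rpow_one, Real.rpow_def_of_pos hx0]
    congr 2; ring
  rw [h3, mainSize]
  have h4 : exp (-(τ * log x)) ≤ δ * (log x ^ (-(R * log r)) / log x) := by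
    rw [Real.rpow_neg hL.le, inv_div_left, ← div_eq_mul_inv, le_div_iff₀ (by positivity)]
    rw [Real.rpow_add hL, Real.rpow_one] at hx
    linarith
  have h5 : δ * (log x ^ (-(R * log r)) / log x) ≤ δ * (smoothSum c x J / log x) := by
    have := h2.trans h1
    gcongr
  calc x * exp (-(τ * log x)) ≤ x * (δ * (smoothSum c x J / log x)) :=
        mul_le_mul_of_nonneg_left (h4.trans h5) hx0.le
    _ = _ := by ring

/-- The largest divisor of `m` composed of primes `≤ w`. -/
noncomputable def smoothPart (w : ℝ) (m : ℕ) : ℕ :=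
  ∏ l ∈ m.primeFactors.filter (fun l : ℕ => (l : ℝ) ≤ w), l ^ m.factorization l

/-- The largest divisor of `m` composed of primes `> w`. -/
noncomputable def roughPart (w : ℝ) (m : ℕ) : ℕ :=
  ∏ l ∈ m.primeFactors.filter (fun l : ℕ => ¬ (l : ℝ) ≤ w), l ^ m.factorization l

lemma smoothPart_mul_roughPart (w : ℝ) {m : ℕ} (hm : m ≠ 0) :
    smoothPart w m * roughPart w m = m := by
  rw [smoothPart, roughPart, Finset.prod_filter_mul_prod_filter_not]
  exact Nat.prod_factorization_pow_eq_self hm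

lemma primeFactors_prod_pow_of_prime {D : Finset ℕ} (hD : ∀ l ∈ D, l.Prime) {v : ℕ → ℕ}
    (hv : ∀ l ∈ D, v l ≠ 0) : (∏ l ∈ D, l ^ v l).primeFactors = D := by
  ext l
  rw [Nat.mem_primeFactors]
  constructor
  · rintro ⟨hl, hdvd, -⟩
    obtain ⟨q, hq, h⟩ := (hl.prime.dvd_finsetProd_iff _).1 hdvd
    rwa [(Nat.prime_dvd_prime_iff_eq hl (hD q hq)).1 (hl.dvd_of_dvd_pow h)]
  · exact fun hl => ⟨hD l hl, (dvd_pow_self l (hv l hl)).trans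
      (Finset.dvd_prod_of_mem (fun l => l ^ v l) hl),
      Finset.prod_ne_zero_iff.2 fun q hq => pow_ne_zero _ (hD q hq).ne_zero⟩

lemma factorization_ne_zero_of_mem {m l : ℕ} (hl : l ∈ m.primeFactors) :
    m.factorization l ≠ 0 :=
  Finsupp.mem_support_iff.1 (by rwa [Nat.support_factorization])

lemma primeFactors_smoothPart (w : ℝ) (m : ℕ) :
    (smoothPart w m).primeFactors = m.primeFactors.filter (fun l : ℕ => (l : ℝ) ≤ w) :=
  primeFactors_prod_pow_of_prime
    (fun _ hl => Nat.prime_of_mem_primeFactors (Finset.mem_filter.1 hl).1)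
    fun _ hl => factorization_ne_zero_of_mem (Finset.mem_filter.1 hl).1

lemma primeFactors_roughPart (w : ℝ) (m : ℕ) :
    (roughPart w m).primeFactors = m.primeFactors.filter (fun l : ℕ => ¬ (l : ℝ) ≤ w) :=
  primeFactors_prod_pow_of_prime
    (fun _ hl => Nat.prime_of_mem_primeFactors (Finset.mem_filter.1 hl).1)
    fun _ hl => factorization_ne_zero_of_mem (Finset.mem_filter.1 hl).1

lemma smoothPart_pos (w : ℝ) (m : ℕ) : 0 < smoothPart w m :=
  Finset.prod_pos fun _ hl =>
    pow_pos (Nat.prime_of_mem_primeFactors (Finset.mem_filter.1 hl).1).pos _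

lemma roughPart_pos (w : ℝ) (m : ℕ) : 0 < roughPart w m :=
  Finset.prod_pos fun _ hl =>
    pow_pos (Nat.prime_of_mem_primeFactors (Finset.mem_filter.1 hl).1).pos _

lemma smoothPart_dvd (w : ℝ) {m : ℕ} (hm : m ≠ 0) : smoothPart w m ∣ m :=
  ⟨_, (smoothPart_mul_roughPart w hm).symm⟩

lemma card_primeFactors_smoothPart_add (w : ℝ) (m : ℕ) :
    (smoothPart w m).primeFactors.card + (roughPart w m).primeFactors.card
      = m.primeFactors.card := by
  rw [primeFactors_smoothPart, primeFactors_roughPart]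
  exact Finset.card_filter_add_card_filter_not _

lemma log_smoothPart (w : ℝ) (m : ℕ) :
    log (smoothPart w m) = ∑ l ∈ m.primeFactors.filter (fun l : ℕ => (l : ℝ) ≤ w),
      (m.factorization l : ℝ) * log l := by
  rw [smoothPart]
  push_cast
  rw [Real.log_prod fun l hl => pow_ne_zero _ (Nat.cast_ne_zero.2
    (Nat.prime_of_mem_primeFactors (Finset.mem_filter.1 hl).1).ne_zero)]
  exact Finset.sum_congr rfl fun l _ => Real.log_pow _ _

lemma primeFactors_ordCompl {m l : ℕ} :
    (m / l ^ m.factorization l).primeFactors = m.primeFactors.erase l := by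
  rw [← Nat.support_factorization, Nat.factorization_ordCompl, Finsupp.support_erase,
    Nat.support_factorization]

lemma smoothPart_ordCompl_mul {w : ℝ} {m l : ℕ} (hl : l ∈ m.primeFactors) (hlw : (l : ℝ) ≤ w) :
    smoothPart w (m / l ^ m.factorization l) * l ^ m.factorization l = smoothPart w m := by
  rw [smoothPart, smoothPart, primeFactors_ordCompl, Nat.factorization_ordCompl,
    Finset.filter_erase, mul_comm,
    ← Finset.mul_prod_erase _ _ (Finset.mem_filter.2 ⟨hl, hlw⟩)]
  congr 1
  refine Finset.prod_congr rfl fun q hq => ?_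
  rw [Finsupp.erase_ne (Finset.ne_of_mem_erase hq)]

lemma sum_Icc_pow_le {y : ℝ} (h0 : 0 ≤ y) (h1 : y < 1) (V : ℕ) :
    ∑ v ∈ Icc 1 V, y ^ v ≤ y / (1 - y) := by
  have h := geom_sum_Ico_le_of_lt_one (m := 1) (n := V + 1) h0 h1
  rw [pow_one] at h
  exact h

/-- The number of `m ≤ x` divisible by a high power of a small prime. -/
lemma card_large_prime_power_le {x w y : ℝ} (hx : 0 ≤ x) (hw : 0 ≤ w) (hy : 1 ≤ y) :
    (((Icc 1 ⌊x⌋₊).filter fun m => ∃ l : ℕ, l ∈ m.primeFactors ∧ (l : ℝ) ≤ w ∧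
      y < (l : ℝ) ^ m.factorization l).card : ℝ) ≤ w * (x / y) := by
  have hsub : (Icc 1 ⌊x⌋₊).filter (fun m => ∃ l : ℕ, l ∈ m.primeFactors ∧ (l : ℝ) ≤ w ∧
      y < (l : ℝ) ^ m.factorization l)
      ⊆ (Nat.primesLE ⌊w⌋₊).biUnion fun l =>
        (Ioc 0 ⌊x⌋₊).filter fun m => l ^ (Nat.log l ⌊y⌋₊ + 1) ∣ m := by
    intro m hm
    obtain ⟨hm, l, hl, hlw, hly⟩ := Finset.mem_filter.1 hm
    have hp := Nat.prime_of_mem_primeFactors hl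
    refine Finset.mem_biUnion.2 ⟨l, Nat.mem_primesLE.2 ⟨Nat.le_floor hlw, hp⟩,
      Finset.mem_filter.2 ⟨?_, ?_⟩⟩
    · exact Finset.mem_Ioc.2 (Finset.mem_Icc.1 hm)
    · refine (pow_dvd_pow l ?_).trans (Nat.ordProj_dvd m l)
      refine Nat.succ_le_of_lt ((Nat.log_lt_iff_lt_pow hp.one_lt ?_).2 ?_)
      · exact (Nat.floor_pos.2 hy).ne'
      · exact (Nat.floor_lt (by linarith)).2 (by exact_mod_cast hly)
  refine (Nat.cast_le.2 ((Finset.card_le_card hsub).trans Finset.card_biUnion_le)).trans ?_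
  push_cast
  have hterm : ∀ l ∈ Nat.primesLE ⌊w⌋₊,
      (((Ioc 0 ⌊x⌋₊).filter fun m => l ^ (Nat.log l ⌊y⌋₊ + 1) ∣ m).card : ℝ) ≤ x / y := by
    intro l hl
    have hp := Nat.prime_of_mem_primesLE hl
    rw [Nat.Ioc_filter_dvd_card_eq_div]
    refine Nat.cast_div_le.trans ?_
    have h1 : y ≤ ((l ^ (Nat.log l ⌊y⌋₊ + 1) : ℕ) : ℝ) := by
      have := Nat.lt_pow_succ_log_self hp.one_lt ⌊y⌋₊
      refine (Nat.lt_floor_add_one y).le.trans ?_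
      exact_mod_cast this
    have h2 := Nat.floor_le hx
    gcongr
  refine (Finset.sum_le_sum hterm).trans ?_
  rw [Finset.sum_const, nsmul_eq_mul]
  refine mul_le_mul_of_nonneg_right ?_ (by positivity)
  have : (Nat.primesLE ⌊w⌋₊).card ≤ ⌊w⌋₊ := by
    refine (Finset.card_le_card (t := Icc 1 ⌊w⌋₊) fun p hp => ?_).trans (by simp)
    exact Finset.mem_Icc.2 ⟨(Nat.prime_of_mem_primesLE hp).one_le, (Nat.mem_primesLE.1 hp).1⟩
  exact le_trans (by exact_mod_cast this) (Nat.floor_le hw)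

/-- Removing one prime power at a time, weighted by its logarithm. -/
lemma sum_log_smoothPart_le {x w y : ℝ} (hx : 0 ≤ x) (J : ℕ) (M : Finset ℕ)
    (hM : ∀ m ∈ M, m ∈ Icc 1 ⌊x⌋₊ ∧ m.primeFactors.card = J + 1 ∧ y ^ 2 < smoothPart w m ∧
      ∀ l ∈ m.primeFactors, (l : ℝ) ≤ w → (l : ℝ) ^ m.factorization l ≤ y) (hy : 0 < y) :
    ∑ m ∈ M, log (smoothPart w m) ≤ 34 * x * ∑ a ∈ (Icc 1 ⌊x⌋₊).filter
      (fun a => a.primeFactors.card = J ∧ y < smoothPart w a), (a : ℝ)⁻¹ := by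
  set X := ⌊x⌋₊ with hX
  set A := (Icc 1 X).filter (fun a => a.primeFactors.card = J ∧ y < smoothPart w a) with hA
  have h1 : ∑ a ∈ A, ∑ l ∈ (X / a).primesLE, ∑ v ∈ (Icc 1 X).filter (fun v => l ^ v ≤ X / a),
      (v : ℝ) * log l ≤ 34 * x * ∑ a ∈ A, (a : ℝ)⁻¹ := by
    rw [Finset.mul_sum]
    refine Finset.sum_le_sum fun a _ => (sum_log_prime_pow_le (X / a) X).trans ?_
    have h2 : ((X / a : ℕ) : ℝ) ≤ x / a := Nat.cast_div_le.trans
      (div_le_div_of_nonneg_right (Nat.floor_le hx) (Nat.cast_nonneg a))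
    rw [mul_assoc, ← div_eq_mul_inv]
    linarith
  refine le_trans ?_ h1
  simp_rw [log_smoothPart]
  rw [Finset.sum_sigma', Finset.sum_sigma', Finset.sum_sigma']
  refine sum_le_sum_of_injOn (fun s => ⟨⟨s.1 / s.2 ^ s.1.factorization s.2, s.2⟩,
    s.1.factorization s.2⟩) ?_ ?_ ?_ ?_
  · rintro ⟨m, l⟩ h
    obtain ⟨hm, hl⟩ := Finset.mem_sigma.1 h
    obtain ⟨hl, hlw⟩ := Finset.mem_filter.1 hl
    obtain ⟨hmX, hmJ, hmy, hmpow⟩ := hM m hm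
    simp only at hl hlw
    have hp := Nat.prime_of_mem_primeFactors hl
    obtain ⟨hm1, hmX⟩ := Finset.mem_Icc.1 hmX
    have hpos : 0 < m / l ^ m.factorization l := Nat.ordCompl_pos l (by omega)
    have hmul := Nat.ordProj_mul_ordCompl_eq_self m l
    have hfac := factorization_ne_zero_of_mem hl
    have hpow : l ^ m.factorization l ≤ X / (m / l ^ m.factorization l) := by
      rw [Nat.le_div_iff_mul_le hpos, hmul]; exact hmX
    refine Finset.mem_sigma.2 ⟨Finset.mem_sigma.2 ⟨Finset.mem_filter.2
      ⟨Finset.mem_Icc.2 ⟨hpos, ?_⟩, ?_, ?_⟩, ?_⟩, Finset.mem_filter.2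
      ⟨Finset.mem_Icc.2 ⟨Nat.one_le_iff_ne_zero.2 hfac, ?_⟩, hpow⟩⟩
    · exact (Nat.div_le_self _ _).trans hmX
    · rw [primeFactors_ordCompl, Finset.card_erase_of_mem hl, hmJ]; omega
    · have h3 := smoothPart_ordCompl_mul hl hlw
      have h4 := hmpow l hl hlw
      rw [← h3] at hmy
      push_cast at hmy
      by_contra h5
      have h5 := not_lt.1 h5
      have h6 : (0 : ℝ) ≤ smoothPart w (m / l ^ m.factorization l) := Nat.cast_nonneg _
      have h7 : (0 : ℝ) ≤ (l : ℝ) ^ m.factorization l := by positivity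
      nlinarith
    · exact Nat.mem_primesLE.2 ⟨(Nat.le_self_pow hfac l).trans hpow, hp⟩
    · exact ((Nat.factorization_lt (n := m) l (by omega)).le).trans hmX
  · rintro ⟨m, l⟩ h ⟨m', l'⟩ h' heq
    simp only [Sigma.mk.injEq, heq_eq_eq] at heq
    obtain ⟨⟨h1, rfl⟩, h2⟩ := heq
    have e := Nat.ordProj_mul_ordCompl_eq_self m l
    have e' := Nat.ordProj_mul_ordCompl_eq_self m' l
    have : m = m' := by rw [← e, ← e', h1, h2]
    rw [this]
  · rintro ⟨m, l⟩ _
    exact le_rfl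
  · rintro ⟨⟨a, l⟩, v⟩ _
    exact mul_nonneg (Nat.cast_nonneg _) (Real.log_natCast_nonneg _)

/-- The weight `l ^ (s - 1)` for `l ≤ w` and `1 / l` for `l > w`. -/
noncomputable def rankinWeight (s w : ℝ) (l : ℕ) : ℝ :=
  if (l : ℝ) ≤ w then (l : ℝ) ^ s * (l : ℝ)⁻¹ else (l : ℝ)⁻¹

lemma rankinWeight_nonneg (s w : ℝ) (l : ℕ) : 0 ≤ rankinWeight s w l := by
  unfold rankinWeight; split_ifs <;> positivity

lemma rankinWeight_bounds {s w : ℝ} (hs0 : 0 < s) (hs : s ≤ 1 / 2)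
    (hw : s * log w = 1) {l : ℕ} (hl : l.Prime) :
    (l : ℝ)⁻¹ ≤ rankinWeight s w l ∧ rankinWeight s w l ≤ 3 / 4 ∧
    rankinWeight s w l ≤ 3 * (l : ℝ)⁻¹ ∧
    rankinWeight s w l ≤ (l : ℝ)⁻¹ + if (l : ℝ) ≤ w then 2 * s * (log l / l) else 0 := by
  have hl2 : (2 : ℝ) ≤ l := by exact_mod_cast hl.two_le
  have hlog : 0 ≤ log (l : ℝ) := Real.log_natCast_nonneg l
  have hinv : 0 < (l : ℝ)⁻¹ := by positivity
  have hinv2 : (l : ℝ)⁻¹ ≤ 1 / 2 := by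
    rw [one_div]; exact inv_anti₀ (by norm_num) hl2
  unfold rankinWeight
  split_ifs with h
  · have h1 : log l ≤ log w := Real.log_le_log (by linarith) h
    have h2 : |log l * s| ≤ 1 := by
      rw [abs_of_nonneg (by positivity)]; nlinarith
    have h3 := (abs_le.1 (Real.abs_exp_sub_one_le h2)).2
    rw [abs_of_nonneg (by positivity)] at h3
    rw [abs_of_nonneg (by positivity)] at h2
    have h4 : (l : ℝ) ^ s = exp (log l * s) := Real.rpow_def_of_pos (by linarith) s
    have h5 : (1 : ℝ) ≤ (l : ℝ) ^ s := Real.one_le_rpow (by linarith) hs0.le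
    have h6 : (l : ℝ) ^ s ≤ √l := by
      rw [Real.sqrt_eq_rpow]
      exact Real.rpow_le_rpow_of_exponent_le (by linarith) hs
    have h7 : √(l : ℝ) * √l = l := Real.mul_self_sqrt (by linarith)
    refine ⟨by nlinarith, ?_, ?_, ?_⟩
    · rw [← div_eq_mul_inv, div_le_iff₀ (by linarith)]
      have h8 : 4 / 3 ≤ √(l : ℝ) := Real.le_sqrt_of_sq_le (by linarith)
      nlinarith
    · exact mul_le_mul_of_nonneg_right (by rw [h4]; linarith) hinv.le
    · have h9 : (l : ℝ)⁻¹ + 2 * s * (log l / l) = (1 + 2 * (log l * s)) * (l : ℝ)⁻¹ := by ring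
      rw [h9]
      exact mul_le_mul_of_nonneg_right (by rw [h4]; linarith) hinv.le
  · exact ⟨le_rfl, by linarith, by linarith, by linarith⟩

lemma sum_rankinWeight_geom_le {s w x : ℝ} (hs0 : 0 < s) (hs : s ≤ 1 / 2) (hw1 : 1 ≤ w)
    (hwx : w ≤ x) (hw : s * log w = 1) :
    ∑ l ∈ Nat.primesLE ⌊x⌋₊,
      (rankinWeight s w l / (1 - rankinWeight s w l) - (l : ℝ)⁻¹) ≤ 40 := by
  have key : ∀ l ∈ Nat.primesLE ⌊x⌋₊,
      rankinWeight s w l / (1 - rankinWeight s w l) - (l : ℝ)⁻¹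
        ≤ (if (l : ℝ) ≤ w then 2 * s * (log l / l) else 0) + 36 * ((l : ℝ) ^ 2)⁻¹ := by
    intro l hl
    obtain ⟨h1, h2, h3, h4⟩ :=
      rankinWeight_bounds hs0 hs hw (Nat.prime_of_mem_primesLE hl)
    have h0 := rankinWeight_nonneg s w l
    generalize rankinWeight s w l = y at *
    have e : y / (1 - y) = y + y ^ 2 / (1 - y) := by
      have : 1 - y ≠ 0 := by linarith
      field_simp; ring
    have h5 : y ^ 2 / (1 - y) ≤ 36 * ((l : ℝ) ^ 2)⁻¹ := by
      rw [div_le_iff₀ (by linarith), ← inv_pow]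
      have h6 : y ^ 2 ≤ 9 * ((l : ℝ)⁻¹) ^ 2 := by
        calc y ^ 2 ≤ (3 * (l : ℝ)⁻¹) ^ 2 := pow_le_pow_left₀ h0 h3 2
          _ = _ := by ring
      nlinarith [sq_nonneg ((l : ℝ)⁻¹)]
    rw [e]; linarith
  refine (Finset.sum_le_sum key).trans ?_
  rw [Finset.sum_add_distrib, ← Finset.mul_sum, sum_primesLE_ite (by linarith) hwx,
    ← Finset.mul_sum]
  nlinarith [sum_log_div_primesLE_floor_le hw1, sum_primesLE_inv_sq_le ⌊x⌋₊]

lemma inv_eq_prod_primeFactors {a : ℕ} (ha : a ≠ 0) :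
    (a : ℝ)⁻¹ = ∏ l ∈ a.primeFactors, ((l : ℝ)⁻¹) ^ a.factorization l := by
  conv_lhs => rw [← Nat.prod_factorization_pow_eq_self ha]
  rw [Finsupp.prod, Nat.support_factorization]
  push_cast
  rw [← Finset.prod_inv_distrib]
  exact Finset.prod_congr rfl fun l _ => (inv_pow _ _).symm

lemma prod_rankinWeight_pow {s w : ℝ} {a : ℕ} (ha : a ≠ 0) :
    ∏ l ∈ a.primeFactors, rankinWeight s w l ^ a.factorization l
      = (smoothPart w a : ℝ) ^ s * (a : ℝ)⁻¹ := by
  rw [inv_eq_prod_primeFactors ha, smoothPart, Finset.prod_filter]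
  push_cast
  rw [← Real.finsetProd_rpow _ _ (fun l _ => by split_ifs <;> positivity),
    ← Finset.prod_mul_distrib]
  refine Finset.prod_congr rfl fun l _ => ?_
  unfold rankinWeight
  split_ifs with h
  · rw [mul_pow, ← Real.rpow_natCast, ← Real.rpow_natCast (l : ℝ),
      ← Real.rpow_mul (Nat.cast_nonneg l), ← Real.rpow_mul (Nat.cast_nonneg l),
      mul_comm s]
  · rw [Real.one_rpow, one_mul]

lemma sum_inv_large_smoothPart_le {s w x y : ℝ} (hs0 : 0 < s) (hs : s ≤ 1 / 2)
    (hw : s * log w = 1) (hy : 0 < y) (J : ℕ) :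
    ∑ a ∈ (Icc 1 ⌊x⌋₊).filter (fun a => a.primeFactors.card = J ∧ y < smoothPart w a), (a : ℝ)⁻¹
      ≤ y ^ (-s) * esum (Nat.primesLE ⌊x⌋₊)
          (fun l => rankinWeight s w l / (1 - rankinWeight s w l)) J := by
  have h := sum_prod_factorization_le (Q := Nat.primesLE ⌊x⌋₊) (j := J)
    (A := (Icc 1 ⌊x⌋₊).filter (fun a => a.primeFactors.card = J ∧ y < smoothPart w a))
    (fun a ha => by
      obtain ⟨h1, h2, -⟩ := Finset.mem_filter.1 ha
      obtain ⟨h3, h4⟩ := Finset.mem_Icc.1 h1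
      refine ⟨by omega, fun l hl => Nat.mem_primesLE.2
        ⟨(Nat.le_of_mem_primeFactors hl).trans h4, Nat.prime_of_mem_primeFactors hl⟩, h2⟩)
    (φ := fun l v => rankinWeight s w l ^ v) (fun l v => pow_nonneg (rankinWeight_nonneg s w l) v)
    (G := fun l => rankinWeight s w l / (1 - rankinWeight s w l))
    (fun l hl V => by
      have hb := rankinWeight_bounds hs0 hs hw (Nat.prime_of_mem_primesLE hl)
      exact sum_Icc_pow_le (rankinWeight_nonneg s w l) (by linarith [hb.2.1]) V)
  refine le_trans ?_ (mul_le_mul_of_nonneg_left h (by positivity))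
  rw [Finset.mul_sum]
  refine Finset.sum_le_sum fun a ha => ?_
  obtain ⟨h1, -, h2⟩ := Finset.mem_filter.1 ha
  have ha0 : a ≠ 0 := by have := Finset.mem_Icc.1 h1; omega
  rw [prod_rankinWeight_pow ha0, ← mul_assoc, Real.rpow_neg hy.le]
  refine le_mul_of_one_le_left (by positivity) ?_
  rw [inv_mul_eq_div, one_le_div (by positivity)]
  exact Real.rpow_le_rpow hy.le h2.le hs0.le

open Filter in
/-- Integers whose `x ^ θ`-smooth part exceeds `x ^ ε` are negligible on a level set of `ω`,
for `θ` small enough. -/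
theorem exists_card_large_smoothPart_le {c r R ε δ : ℝ} (hc : 0 < c) (hr : 1 ≤ r)
    (hε : 0 < ε) (hε1 : ε ≤ 1) (hδ : 0 < δ) :
    ∃ θ : ℝ, 0 < θ ∧ θ ≤ ε / 8 ∧ ∀ᶠ x : ℝ in atTop, ∀ J : ℕ, (J + 1 : ℝ) ≤ R * log (log x) →
      (∀ j < J, smoothSum c x j ≤ r * smoothSum c x (j + 1)) →
      (((Icc 1 ⌊x⌋₊).filter fun m => m.primeFactors.card = J + 1 ∧
        x ^ ε < smoothPart (x ^ θ) m).card : ℝ) ≤ δ * mainSize c x J := by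
  set K : ℝ := exp (r * (40 + 2 / c)) with hK
  have hK0 : 0 < K := Real.exp_pos _
  refine ⟨min (ε / 8) (δ * ε ^ 2 / (136 * K)), by positivity, min_le_left _ _, ?_⟩
  set θ := min (ε / 8) (δ * ε ^ 2 / (136 * K)) with hθ
  have hθ0 : 0 < θ := by positivity
  have hθε : θ ≤ ε / 8 := min_le_left _ _
  have hθK : θ * (136 * K) ≤ δ * ε ^ 2 := by
    rw [← le_div_iff₀ (by positivity)]; exact min_le_right _ _
  filter_upwards [rpow_le_mul_mainSize (c := c) (R := R) hr (show (0 : ℝ) < ε / 4 by positivity)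
      (show 0 < δ / 2 by positivity), Filter.eventually_gt_atTop 1,
      Real.tendsto_log_atTop.eventually_ge_atTop (2 / θ)]
    with x hpow hx1 hxL J hJ hrat
  have hx0 : 0 < x := by linarith
  have hL : 0 < log x := Real.log_pos hx1
  set w := x ^ θ with hw
  set y := x ^ (ε / 2) with hy
  have hy0 : 0 < y := by positivity
  have hw1 : 1 ≤ w := Real.one_le_rpow hx1.le hθ0.le
  have hwx : w ≤ x := by
    calc w ≤ x ^ (1 : ℝ) := Real.rpow_le_rpow_of_exponent_le hx1.le (by linarith)
      _ = x := Real.rpow_one x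
  have hlogw : log w = θ * log x := Real.log_rpow hx0 θ
  have hy2 : y ^ 2 = x ^ ε := by
    rw [hy, ← Real.rpow_natCast, ← Real.rpow_mul hx0.le]; congr 1; push_cast; ring
  set s := 1 / (θ * log x) with hs
  have hs0 : 0 < s := by positivity
  have hs2 : s ≤ 1 / 2 := by
    rw [div_le_iff₀ hθ0] at hxL
    rw [hs]
    exact one_div_le_one_div_of_le (by norm_num) (by linarith)
  have hsw : s * log w = 1 := by rw [hlogw, hs]; field_simp
  set M := (Icc 1 ⌊x⌋₊).filter fun m => m.primeFactors.card = J + 1 ∧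
        x ^ ε < smoothPart w m with hM
  set B := (Icc 1 ⌊x⌋₊).filter fun m => ∃ l : ℕ, l ∈ m.primeFactors ∧ (l : ℝ) ≤ w ∧
      y < (l : ℝ) ^ m.factorization l with hB
  have hBcard : (B.card : ℝ) ≤ δ / 2 * mainSize c x J := by
    refine (card_large_prime_power_le hx0.le (by linarith)
      (Real.one_le_rpow hx1.le (by positivity))).trans (le_trans ?_ (hpow J hJ hrat))
    rw [hw, mul_div_assoc', ← Real.rpow_add_one hx0.ne', ← Real.rpow_sub hx0]
    exact Real.rpow_le_rpow_of_exponent_le hx1.le (by linarith)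
  have hMB : ∀ m ∈ M \ B, m ∈ Icc 1 ⌊x⌋₊ ∧ m.primeFactors.card = J + 1 ∧ y ^ 2 < smoothPart w m ∧
      ∀ l ∈ m.primeFactors, (l : ℝ) ≤ w → (l : ℝ) ^ m.factorization l ≤ y := by
    intro m hm
    obtain ⟨hm, hmB⟩ := Finset.mem_sdiff.1 hm
    obtain ⟨h1, h2, h3⟩ := Finset.mem_filter.1 hm
    refine ⟨h1, h2, hy2 ▸ h3, fun l hl hlw => ?_⟩
    by_contra h
    exact hmB (Finset.mem_filter.2 ⟨h1, l, hl, hlw, not_le.1 h⟩)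
  have hsum := sum_log_smoothPart_le hx0.le J (M \ B) hMB hy0
  have hlow : ((M \ B).card : ℝ) * (ε * log x) ≤ ∑ m ∈ M \ B, log (smoothPart w m) := by
    rw [← nsmul_eq_mul, ← Finset.sum_const]
    refine Finset.sum_le_sum fun m hm => ?_
    rw [← Real.log_rpow hx0, ← hy2]
    exact Real.log_le_log (by positivity) (hMB m hm).2.2.1.le
  have hrank := sum_inv_large_smoothPart_le (x := x) hs0 hs2 hsw hy0 J
  have hE := esum_le_mul_smoothSum (H := 40) hc (by linarith) hx1 hrat
    (g := fun l => rankinWeight s w l / (1 - rankinWeight s w l)) (fun l hl => by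
      have hb := rankinWeight_bounds hs0 hs2 hsw (Nat.prime_of_mem_primesLE hl)
      have h0 := rankinWeight_nonneg s w l
      refine hb.1.trans ?_
      rw [le_div_iff₀ (by linarith [hb.2.1])]
      nlinarith) (sum_rankinWeight_geom_le hs0 hs2 hw1 hwx hsw) J le_rfl
  have hys : y ^ (-s) = exp (-(ε / (2 * θ))) := by
    rw [hy, ← Real.rpow_mul hx0.le, Real.rpow_def_of_pos hx0, hs]
    congr 1; field_simp
  have hexp : exp (-(ε / (2 * θ))) ≤ 2 * θ / ε := by
    rw [Real.exp_neg, inv_le_comm₀ (Real.exp_pos _) (by positivity), inv_div]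
    linarith [Real.add_one_le_exp (ε / (2 * θ))]
  have hE0 := smoothSum_nonneg c x J
  have hMBcard : ((M \ B).card : ℝ) ≤ δ / 2 * mainSize c x J := by
    have h1 : ((M \ B).card : ℝ) * (ε * log x)
        ≤ 34 * x * (2 * θ / ε * (K * smoothSum c x J)) := by
      refine hlow.trans (hsum.trans (mul_le_mul_of_nonneg_left ?_ (by positivity)))
      rw [hys] at hrank
      exact hrank.trans (mul_le_mul hexp hE
        (esum_nonneg (fun l hl => div_nonneg (rankinWeight_nonneg s w l) (by
          linarith [(rankinWeight_bounds hs0 hs2 hsw (Nat.prime_of_mem_primesLE hl)).2.1])) J)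
        (by positivity))
    rw [← le_div_iff₀ (by positivity)] at h1
    refine h1.trans ?_
    rw [mainSize, div_le_iff₀ (by positivity)]
    have e1 : 34 * x * (2 * θ / ε * (K * smoothSum c x J))
        = (θ * (136 * K)) * (x * smoothSum c x J / (2 * ε)) := by field_simp; ring
    have e2 : δ / 2 * (x / log x * smoothSum c x J) * (ε * log x)
        = (δ * ε ^ 2) * (x * smoothSum c x J / (2 * ε)) := by field_simp
    rw [e1, e2]
    exact mul_le_mul_of_nonneg_right hθK (by positivity)
  have hfin : (M.card : ℝ) ≤ (M \ B).card + B.card := by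
    have := Finset.card_le_card_sdiff_add_card (s := M) (t := B)
    exact_mod_cast this
  linarith

lemma card_filter_range_dvd_add_mul {l : ℕ} (hl : l.Prime) {b u : ℕ} (hu : ¬ l ∣ u) :
    ((range l).filter fun s => l ∣ b + u * s).card = 1 := by
  have := Fact.mk hl
  have hu' : (u : ZMod l) ≠ 0 := by rwa [Ne, ZMod.natCast_eq_zero_iff]
  rw [Finset.card_eq_one]
  refine ⟨((-(b : ZMod l)) / u).val, ?_⟩
  ext s
  rw [Finset.mem_filter, Finset.mem_range, Finset.mem_singleton]
  have key : l ∣ b + u * s ↔ (s : ZMod l) = -(b : ZMod l) / u := by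
    rw [← ZMod.natCast_eq_zero_iff, eq_div_iff hu', eq_neg_iff_add_eq_zero]
    push_cast
    rw [add_comm, mul_comm]
  constructor
  · rintro ⟨h1, h2⟩
    rw [← key.1 h2, ZMod.val_natCast_of_lt h1]
  · rintro rfl
    exact ⟨ZMod.val_lt _, key.2 (ZMod.natCast_zmod_val _)⟩

/-- The number of residue classes modulo `l` removed when sieving `m / a` by `l` and, if `l ∈ F`,
also `(m + 1) / u`. -/
noncomputable def sieveDim (F : Finset ℕ) (a u l : ℕ) : ℕ :=
  (if l ∣ u then 0 else 1) + if l ∈ F ∧ ¬ l ∣ a then 1 else 0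

lemma card_filter_range_dvd_or {l : ℕ} (hl : l.Prime) (F : Finset ℕ) {a u b v : ℕ}
    (h : u * v = a * b + 1) :
    ((range l).filter fun s => l ∣ b + u * s ∨ l ∈ F ∧ l ∣ v + a * s).card
      = sieveDim F a u l := by
  have hdisj : Disjoint ((range l).filter fun s => l ∣ b + u * s)
      ((range l).filter fun s => l ∈ F ∧ l ∣ v + a * s) := by
    refine Finset.disjoint_filter.2 fun s _ h1 h2 => hl.one_lt.ne' ?_
    have h3 := (h1.mul_left a)
    have h4 := (h2.2.mul_left u)
    have e : u * (v + a * s) = a * (b + u * s) + 1 := by rw [mul_add, h]; ring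
    rw [e] at h4
    exact Nat.dvd_one.1 ((Nat.dvd_add_right h3).1 h4)
  rw [Finset.filter_or, Finset.card_union_of_disjoint hdisj, sieveDim]
  congr 1
  · split_ifs with hu
    · rw [Finset.card_eq_zero, Finset.filter_eq_empty_iff]
      intro s _ h1
      have h2 : l ∣ b := (Nat.dvd_add_left (hu.mul_right s)).1 h1
      have h3 : l ∣ a * b + 1 := h ▸ hu.mul_right v
      exact hl.one_lt.ne' (Nat.dvd_one.1 ((Nat.dvd_add_right (h2.mul_left a)).1 h3))
    · exact card_filter_range_dvd_add_mul hl hu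
  · by_cases hF : l ∈ F
    · simp only [hF, true_and]
      by_cases ha : l ∣ a
      swap
      · rw [if_pos ha]; exact card_filter_range_dvd_add_mul hl ha
      · rw [if_neg (not_not.2 ha), Finset.card_eq_zero, Finset.filter_eq_empty_iff]
        intro s _ h1
        have h2 : l ∣ v := (Nat.dvd_add_left (ha.mul_right s)).1 h1
        have h3 : l ∣ a * b + 1 := h ▸ h2.mul_left u
        exact hl.one_lt.ne' (Nat.dvd_one.1 ((Nat.dvd_add_right (ha.mul_right b)).1 h3))
    · simp [hF]

/-- The integers `m ≤ x` with `a ∣ m` and `u ∣ m + 1` such that `m / a` is free of prime factors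
in `Q` and `(m + 1) / u` is free of prime factors in `Q ∩ F`. -/
noncomputable def siftedPairs (Q F : Finset ℕ) (x : ℝ) (a u : ℕ) : Finset ℕ :=
  (Icc 1 ⌊x⌋₊).filter fun m => a ∣ m ∧ u ∣ m + 1 ∧
    ∀ l ∈ Q, ¬ l ∣ m / a ∧ (l ∈ F → ¬ l ∣ (m + 1) / u)

theorem exists_card_siftedPairs_le : ∃ C : ℝ, 0 < C ∧ ∀ (J : ℕ) (Q F : Finset ℕ) (x : ℝ)
    (a u : ℕ), (∀ l ∈ Q, l.Prime ∧ 3 ≤ l ∧ l ≤ 2 ^ 2 ^ J) → 0 < a → 0 < u →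
    ((2 : ℝ) ^ 2 ^ J) ^ 10 ≤ x / (a * u) →
    ((siftedPairs Q F x a u).card : ℝ)
      ≤ C * (x / (a * u)) * ∏ l ∈ Q, (1 - (sieveDim F a u l : ℝ) / l) := by
  obtain ⟨C, hC, H⟩ := exists_sieve_upper_bound
  refine ⟨2 * C, by positivity, fun J Q F x a u hQ ha hu hx => ?_⟩
  have hdim : ∀ l, sieveDim F a u l ≤ 2 := fun l => by
    unfold sieveDim; split_ifs <;> omega
  have hau : (0 : ℝ) < a * u := by positivity
  have hone : (1 : ℝ) ≤ x / (a * u) :=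
    le_trans (one_le_pow₀ (one_le_pow₀ (by norm_num))) hx
  have hx0 : 0 ≤ x := by
    rw [le_div_iff₀ hau] at hone; linarith
  have hprod : 0 ≤ ∏ l ∈ Q, (1 - (sieveDim F a u l : ℝ) / l) := by
    refine Finset.prod_nonneg fun l hl => ?_
    have h3 : (3 : ℝ) ≤ l := by exact_mod_cast (hQ l hl).2.1
    have h2 : (sieveDim F a u l : ℝ) ≤ 2 := by exact_mod_cast hdim l
    rw [sub_nonneg, div_le_one (by linarith)]; linarith
  rcases (siftedPairs Q F x a u).eq_empty_or_nonempty with he | hne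
  · rw [he]; simp only [Finset.card_empty, Nat.cast_zero]; positivity
  obtain ⟨m₀, hm₀, hmin⟩ := (siftedPairs Q F x a u).exists_min_image id hne
  obtain ⟨hm₀X, ⟨b, hb⟩, ⟨v, hv⟩, -⟩ := Finset.mem_filter.1 hm₀
  have hrel : u * v = a * b + 1 := by omega
  have hcop : a.Coprime u := by
    have h1 : a.gcd u ∣ a * b := (Nat.gcd_dvd_left a u).mul_right b
    have h2 : a.gcd u ∣ a * b + 1 := hrel ▸ (Nat.gcd_dvd_right a u).mul_right v
    exact Nat.dvd_one.1 ((Nat.dvd_add_right h1).1 h2)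
  set N := ⌊x⌋₊ / (a * u) + 1 with hN
  have hNle : (N : ℝ) ≤ 2 * (x / (a * u)) := by
    rw [hN]; push_cast
    have : ((⌊x⌋₊ / (a * u) : ℕ) : ℝ) ≤ x / (a * u) := by
      refine Nat.cast_div_le.trans ?_
      push_cast
      exact div_le_div_of_nonneg_right (Nat.floor_le hx0) hau.le
    linarith
  have hNge : (2 ^ 2 ^ J) ^ 10 ≤ N := by
    have h1 : x / (a * u) < N := by
      have := Nat.lt_floor_add_one (x / ((a * u : ℕ) : ℝ))
      rw [Nat.floor_div_natCast] at this
      rw [hN]; push_cast at this ⊢; exact this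
    have h2 : (((2 ^ 2 ^ J) ^ 10 : ℕ) : ℝ) ≤ N := by push_cast; linarith
    exact_mod_cast h2
  have hsieve := H J Q (fun l => (range l).filter fun s => l ∣ b + u * s ∨ l ∈ F ∧ l ∣ v + a * s) N
    hQ (fun l _ => Finset.filter_subset _ _)
    (fun l hl => by rw [card_filter_range_dvd_or (hQ l hl).1 F hrel]; exact hdim l) hNge
  have hcongr : ∏ l ∈ Q, (1 - (((range l).filter
      fun s => l ∣ b + u * s ∨ l ∈ F ∧ l ∣ v + a * s).card : ℝ) / l)
      = ∏ l ∈ Q, (1 - (sieveDim F a u l : ℝ) / l) :=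
    Finset.prod_congr rfl fun l hl => by rw [card_filter_range_dvd_or (hQ l hl).1 F hrel]
  rw [hcongr] at hsieve
  have hstep : ∀ m ∈ siftedPairs Q F x a u, ∃ s < N, m = m₀ + a * u * s := by
    intro m hm
    obtain ⟨hmX, ha', hu', -⟩ := Finset.mem_filter.1 hm
    have hle : m₀ ≤ m := hmin m hm
    have h1 : a ∣ m - m₀ := Nat.dvd_sub ha' ⟨b, hb⟩
    have h2 : u ∣ m - m₀ := by
      have := Nat.dvd_sub hu' ⟨v, hv⟩
      rwa [Nat.add_sub_add_right] at this
    obtain ⟨s, hs⟩ := hcop.mul_dvd_of_dvd_of_dvd h1 h2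
    refine ⟨s, ?_, by omega⟩
    rw [hN, Nat.lt_succ_iff, Nat.le_div_iff_mul_le (by positivity), mul_comm]
    have := (Finset.mem_Icc.1 hmX).2
    omega
  have hcard : (siftedPairs Q F x a u).card ≤ ((range N).filter fun s => ∀ l ∈ Q,
      s % l ∉ (range l).filter fun s => l ∣ b + u * s ∨ l ∈ F ∧ l ∣ v + a * s).card := by
    refine (Finset.card_le_card (t := (((range N).filter fun s => ∀ l ∈ Q,
      s % l ∉ (range l).filter fun s => l ∣ b + u * s ∨ l ∈ F ∧ l ∣ v + a * s)).image
        fun s => m₀ + a * u * s) fun m hm => ?_).trans Finset.card_image_le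
    obtain ⟨s, hsN, hs⟩ := hstep m hm
    refine Finset.mem_image.2 ⟨s, Finset.mem_filter.2 ⟨Finset.mem_range.2 hsN,
      fun l hl hmem => ?_⟩, hs.symm⟩
    obtain ⟨-, -, -, hrough⟩ := Finset.mem_filter.1 hm
    have e1 : m / a = b + u * s := by
      rw [hs, hb, mul_assoc, ← mul_add, Nat.mul_div_cancel_left _ ha]
    have e2 : (m + 1) / u = v + a * s := by
      rw [hs, add_right_comm, hv, mul_comm a u, mul_assoc, ← mul_add,
        Nat.mul_div_cancel_left _ hu]
    have hmod : ∀ c d, l ∣ c + d * (s % l) ↔ l ∣ c + d * s := fun c d => by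
      rw [Nat.dvd_iff_mod_eq_zero, Nat.dvd_iff_mod_eq_zero]
      simp [Nat.add_mod, Nat.mul_mod]
    obtain ⟨h1, h2⟩ := hrough l hl
    rw [e1] at h1
    rw [e2] at h2
    rcases (Finset.mem_filter.1 hmem).2 with h | ⟨hF, h⟩
    · exact h1 ((hmod _ _).1 h)
    · exact h2 hF ((hmod _ _).1 h)
  calc ((siftedPairs Q F x a u).card : ℝ) ≤ _ := Nat.cast_le.2 hcard
    _ ≤ _ := hsieve
    _ ≤ C * (2 * (x / (a * u))) * ∏ l ∈ Q, (1 - (sieveDim F a u l : ℝ) / l) := by gcongr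
    _ = _ := by ring

/-- The product of `(1 - 1 / l)⁻¹` over the primes `l` dividing `n`. -/
noncomputable def totientRatio (n : ℕ) : ℝ := ∏ l ∈ n.primeFactors, (1 - (l : ℝ)⁻¹)⁻¹

lemma one_le_inv_one_sub_inv_prime {l : ℕ} (hl : l.Prime) : 1 ≤ (1 - (l : ℝ)⁻¹)⁻¹ :=
  (one_le_inv₀ (one_sub_inv_prime_pos hl)).2 (sub_le_self _ (by positivity))

lemma one_le_totientRatio (n : ℕ) : 1 ≤ totientRatio n :=
  Finset.one_le_prod fun _ hl => one_le_inv_one_sub_inv_prime (Nat.prime_of_mem_primeFactors hl)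

lemma totientRatio_prime_le {p : ℕ} (hp : p.Prime) : totientRatio p ≤ 2 := by
  rw [totientRatio, hp.primeFactors, Finset.prod_singleton]
  refine inv_le_of_inv_le₀ (by norm_num) ?_
  have : (p : ℝ)⁻¹ ≤ 2⁻¹ := inv_anti₀ (by norm_num) (by exact_mod_cast hp.two_le)
  linarith

lemma totientRatio_le_sum_divisors {t : ℕ} (ht : t ≠ 0) :
    totientRatio t ≤ 2 * ∑ d ∈ t.divisors, (d : ℝ) ^ (-(1 / 2) : ℝ) := by
  have h1 : ∏ l ∈ t.primeFactors, (1 + (l : ℝ) ^ (-(1 / 2) : ℝ))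
      ≤ ∑ d ∈ t.divisors, (d : ℝ) ^ (-(1 / 2) : ℝ) := by
    rw [Finset.prod_one_add]
    refine sum_le_sum_of_injOn (fun D => ∏ l ∈ D, l) ?_ ?_ ?_ fun d _ => by positivity
    · intro D hD
      exact Nat.mem_divisors.2 ⟨(Finset.prod_dvd_prod_of_subset _ _ _
        (Finset.mem_powerset.1 hD)).trans (Nat.prod_primeFactors_dvd t), ht⟩
    · intro D hD D' hD' h
      have hprime : ∀ D ∈ t.primeFactors.powerset, ∀ l ∈ D, l.Prime := fun D hD l hl =>
        Nat.prime_of_mem_primeFactors (Finset.mem_powerset.1 hD hl)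
      rw [← primeFactors_prod_of_prime (hprime D hD), ← primeFactors_prod_of_prime (hprime D' hD')]
      exact congrArg Nat.primeFactors h
    · intro D _
      rw [Nat.cast_prod, Real.finsetProd_rpow _ _ fun l _ => Nat.cast_nonneg l]
  have h2 : totientRatio t ≤ ∏ l ∈ t.primeFactors,
      ((if l = 2 then 2 else 1) * (1 + (l : ℝ) ^ (-(1 / 2) : ℝ))) := by
    refine Finset.prod_le_prod (fun l hl => zero_le_one.trans
      (one_le_inv_one_sub_inv_prime (Nat.prime_of_mem_primeFactors hl))) fun l hl => ?_
    have hp := Nat.prime_of_mem_primeFactors hl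
    have hpos : 0 < (l : ℝ) ^ (-(1 / 2) : ℝ) :=
      Real.rpow_pos_of_pos (by exact_mod_cast hp.pos) _
    split_ifs with h
    · subst h; push_cast at hpos ⊢; norm_num at hpos ⊢; linarith
    · have h3 : (3 : ℝ) ≤ l := by
        have := hp.two_le
        exact_mod_cast (show 3 ≤ l by omega)
      have h4 : √(l : ℝ) ≤ l - 1 := Real.sqrt_le_iff.2 ⟨by linarith, by nlinarith⟩
      have h5 : 0 < √(l : ℝ) := Real.sqrt_pos.2 (by linarith)
      rw [one_mul, Real.rpow_neg (by linarith), ← Real.sqrt_eq_rpow]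
      have e : (1 - (l : ℝ)⁻¹)⁻¹ = 1 + ((l : ℝ) - 1)⁻¹ := by
        have : (l : ℝ) - 1 ≠ 0 := by linarith
        have : (l : ℝ) ≠ 0 := by linarith
        field_simp; ring
      rw [e]
      linarith [inv_anti₀ h5 h4]
  rw [Finset.prod_mul_distrib, Finset.prod_ite_eq'] at h2
  have h3 : 0 ≤ ∏ l ∈ t.primeFactors, (1 + (l : ℝ) ^ (-(1 / 2) : ℝ)) :=
    Finset.prod_nonneg fun l _ => by positivity
  have h4 : (if 2 ∈ t.primeFactors then (2 : ℝ) else 1) ≤ 2 := by split_ifs <;> norm_num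
  exact h2.trans ((mul_le_mul_of_nonneg_right h4 h3).trans
    (mul_le_mul_of_nonneg_left h1 zero_le_two))

lemma prod_ite_dvd_le_totientRatio {Q : Finset ℕ} (hQ : ∀ l ∈ Q, l.Prime) {n : ℕ} (hn : n ≠ 0) :
    ∏ l ∈ Q, (if l ∣ n then (1 - (l : ℝ)⁻¹)⁻¹ else 1) ≤ totientRatio n := by
  rw [← Finset.prod_filter]
  have hp : ∀ l ∈ n.primeFactors, l.Prime := fun _ => Nat.prime_of_mem_primeFactors
  refine Finset.prod_le_prod_of_subset_of_one_le (fun l hl => ?_) (fun l hl => ?_)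
    fun l hl _ => one_le_inv_one_sub_inv_prime (hp l hl)
  · obtain ⟨h1, h2⟩ := Finset.mem_filter.1 hl
    exact Nat.mem_primeFactors.2 ⟨hQ l h1, h2, hn⟩
  · exact zero_le_one.trans (one_le_inv_one_sub_inv_prime (hQ l (Finset.mem_filter.1 hl).1))

lemma prod_odd_primesLE_le {W : ℕ} (hW : 2 ≤ W) :
    ∏ l ∈ W.primesLE.erase 2, (1 - (l : ℝ)⁻¹) ≤ 2 / log W := by
  have h := prod_one_sub_inv_primesLE_le W hW
  rw [← Finset.mul_prod_erase _ _ (Nat.mem_primesLE.2 ⟨hW, Nat.prime_two⟩)] at h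
  push_cast at h
  have e : 2 / log (W : ℝ) = 2 * (1 / log W) := by ring
  rw [e]
  linarith

lemma prod_one_sub_sieveDim_empty_le {W : ℕ} (hW : 2 ≤ W) {a u : ℕ} (hu : u ≠ 0) :
    ∏ l ∈ W.primesLE.erase 2, (1 - (sieveDim ∅ a u l : ℝ) / l) ≤ 2 / log W * totientRatio u := by
  have hQ : ∀ l ∈ W.primesLE.erase 2, l.Prime := fun l hl =>
    Nat.prime_of_mem_primesLE (Finset.mem_of_mem_erase hl)
  have hlog : 0 ≤ log (W : ℝ) := Real.log_natCast_nonneg W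
  calc _ = (∏ l ∈ W.primesLE.erase 2, (1 - (l : ℝ)⁻¹)) *
        ∏ l ∈ W.primesLE.erase 2, (if l ∣ u then (1 - (l : ℝ)⁻¹)⁻¹ else 1) := by
        rw [← Finset.prod_mul_distrib]
        refine Finset.prod_congr rfl fun l hl => ?_
        have h1 := one_sub_inv_prime_pos (hQ l hl)
        simp only [sieveDim, Finset.notMem_empty, false_and, if_false, add_zero]
        split_ifs
        · rw [mul_inv_cancel₀ h1.ne']; simp
        · rw [mul_one, Nat.cast_one, one_div]
    _ ≤ _ := mul_le_mul (prod_odd_primesLE_le hW) (prod_ite_dvd_le_totientRatio hQ hu)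
        (Finset.prod_nonneg fun l hl => by
          have := one_sub_inv_prime_pos (hQ l hl)
          split_ifs <;> positivity) (by positivity)

lemma prod_one_sub_sieveDim_self_le {W : ℕ} (hW : 2 ≤ W) {a u : ℕ} (ha : a ≠ 0) (hu : u ≠ 0) :
    ∏ l ∈ W.primesLE.erase 2, (1 - (sieveDim (W.primesLE.erase 2) a u l : ℝ) / l)
      ≤ (2 / log W) ^ 2 * totientRatio u * totientRatio a := by
  have hQ : ∀ l ∈ W.primesLE.erase 2, l.Prime := fun l hl =>
    Nat.prime_of_mem_primesLE (Finset.mem_of_mem_erase hl)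
  have hlog : 0 ≤ log (W : ℝ) := Real.log_natCast_nonneg W
  have hpos : ∀ n : ℕ, 0 ≤ ∏ l ∈ W.primesLE.erase 2,
      (if l ∣ n then (1 - (l : ℝ)⁻¹)⁻¹ else 1) := fun n =>
    Finset.prod_nonneg fun l hl => by
      have := one_sub_inv_prime_pos (hQ l hl)
      split_ifs <;> positivity
  have hpos' : 0 ≤ ∏ l ∈ W.primesLE.erase 2, (1 - (l : ℝ)⁻¹) :=
    Finset.prod_nonneg fun l hl => (one_sub_inv_prime_pos (hQ l hl)).le
  calc _ ≤ (∏ l ∈ W.primesLE.erase 2, (1 - (l : ℝ)⁻¹)) ^ 2 *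
        (∏ l ∈ W.primesLE.erase 2, (if l ∣ u then (1 - (l : ℝ)⁻¹)⁻¹ else 1)) *
        ∏ l ∈ W.primesLE.erase 2, (if l ∣ a then (1 - (l : ℝ)⁻¹)⁻¹ else 1) := by
        rw [← Finset.prod_pow, ← Finset.prod_mul_distrib, ← Finset.prod_mul_distrib]
        refine Finset.prod_le_prod (fun l hl => ?_) fun l hl => ?_
        · have h3 : (2 : ℝ) ≤ l := by exact_mod_cast (hQ l hl).two_le
          have h4 : (sieveDim (W.primesLE.erase 2) a u l : ℝ) ≤ 2 := by
            have : sieveDim (W.primesLE.erase 2) a u l ≤ 2 := by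
              unfold sieveDim; split_ifs <;> omega
            exact_mod_cast this
          rw [sub_nonneg, div_le_one (by linarith)]; linarith
        · have h1 := one_sub_inv_prime_pos (hQ l hl)
          simp only [sieveDim, hl, true_and]
          rw [div_eq_mul_inv]
          generalize (l : ℝ)⁻¹ = y at *
          have h2 : (1 - y) ^ 2 * (1 - y)⁻¹ = 1 - y := by field_simp
          have h3 : (1 - y) * (1 - y)⁻¹ = 1 := mul_inv_cancel₀ h1.ne'
          split_ifs <;> push_cast <;> simp only [mul_one, h2, h3] <;> nlinarith [sq_nonneg y]
    _ ≤ _ := mul_le_mul (mul_le_mul (pow_le_pow_left₀ hpos' (prod_odd_primesLE_le hW) 2)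
        (prod_ite_dvd_le_totientRatio hQ hu) (hpos u) (by positivity))
        (prod_ite_dvd_le_totientRatio hQ ha) (hpos a)
        (mul_nonneg (by positivity) (zero_le_one.trans (one_le_totientRatio u)))

lemma totientRatio_weight_bounds {l : ℕ} (hl : l.Prime) :
    (l : ℝ)⁻¹ ≤ (1 - (l : ℝ)⁻¹)⁻¹ * ((l : ℝ)⁻¹ / (1 - (l : ℝ)⁻¹)) ∧
    (1 - (l : ℝ)⁻¹)⁻¹ * ((l : ℝ)⁻¹ / (1 - (l : ℝ)⁻¹)) - (l : ℝ)⁻¹ ≤ 8 * ((l : ℝ) ^ 2)⁻¹ := by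
  have h1 := one_sub_inv_prime_pos hl
  have h2 : (l : ℝ)⁻¹ ≤ 2⁻¹ := inv_anti₀ (by norm_num) (by exact_mod_cast hl.two_le)
  have h0 : 0 < (l : ℝ)⁻¹ := inv_pos.2 (by exact_mod_cast hl.pos)
  rw [← inv_pow]
  generalize (l : ℝ)⁻¹ = y at *
  have e : (1 - y)⁻¹ * (y / (1 - y)) = y / (1 - y) ^ 2 := by field_simp
  rw [e]
  constructor
  · rw [le_div_iff₀ (by positivity)]; nlinarith [mul_pos h0 h1]
  · rw [sub_le_iff_le_add, div_le_iff₀ (by positivity)]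
    nlinarith [mul_pos h0 h1, mul_pos h0 h0, mul_nonneg (mul_pos h0 h0).le (sub_nonneg.2 h2),
      mul_nonneg (mul_nonneg (mul_pos h0 h0).le (sub_nonneg.2 h2)) (sub_nonneg.2 h2),
      mul_nonneg (mul_nonneg (mul_pos h0 h0).le (sub_nonneg.2 h2)) h0.le]

lemma sum_totientRatio_div_le {c r x : ℝ} (hc : 0 < c) (hr : 1 ≤ r) (hx : 1 < x) {J : ℕ}
    (hrat : ∀ j < J, smoothSum c x j ≤ r * smoothSum c x (j + 1)) (I : ℕ) :
    ∑ a ∈ (Icc 1 ⌊x⌋₊).filter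
      (fun a => a.primeFactors.card ≤ J ∧ J + 1 ≤ a.primeFactors.card + I), totientRatio a / a
      ≤ I * (exp (r * (8 + 2 / c)) * r ^ I) * smoothSum c x J := by
  set A := (Icc 1 ⌊x⌋₊).filter
    (fun a => a.primeFactors.card ≤ J ∧ J + 1 ≤ a.primeFactors.card + I) with hA
  have hmaps : ∀ a ∈ A, J - a.primeFactors.card ∈ range I := fun a ha => by
    have := (Finset.mem_filter.1 ha).2
    exact Finset.mem_range.2 (by omega)
  rw [← Finset.sum_fiberwise_of_maps_to hmaps]
  have hterm : ∀ i ∈ range I, ∑ a ∈ A with J - a.primeFactors.card = i, totientRatio a / a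
      ≤ exp (r * (8 + 2 / c)) * r ^ I * smoothSum c x J := by
    intro i hi
    have hi := Finset.mem_range.1 hi
    have h1 := sum_prod_factorization_le (Q := Nat.primesLE ⌊x⌋₊) (j := J - i)
      (A := A.filter fun a => J - a.primeFactors.card = i) (fun a ha => by
        obtain ⟨ha, hai⟩ := Finset.mem_filter.1 ha
        obtain ⟨h1, h2⟩ := Finset.mem_filter.1 ha
        obtain ⟨h3, h4⟩ := Finset.mem_Icc.1 h1
        refine ⟨by omega, fun l hl => Nat.mem_primesLE.2
          ⟨(Nat.le_of_mem_primeFactors hl).trans h4, Nat.prime_of_mem_primeFactors hl⟩, by omega⟩)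
      (φ := fun l v => |(1 - (l : ℝ)⁻¹)⁻¹| * ((l : ℝ)⁻¹) ^ v) (fun l v => by positivity)
      (G := fun l => (1 - (l : ℝ)⁻¹)⁻¹ * ((l : ℝ)⁻¹ / (1 - (l : ℝ)⁻¹))) (fun l hl V => by
        have hp := one_sub_inv_prime_pos (Nat.prime_of_mem_primesLE hl)
        rw [← Finset.mul_sum, abs_of_pos (inv_pos.2 hp)]
        exact mul_le_mul_of_nonneg_left (sum_Icc_pow_le (by positivity) (by linarith) V)
          (inv_pos.2 hp).le)
    have h2 := esum_le_mul_smoothSum (H := 8) hc (by linarith) hx hrat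
      (g := fun l : ℕ => (1 - (l : ℝ)⁻¹)⁻¹ * ((l : ℝ)⁻¹ / (1 - (l : ℝ)⁻¹)))
      (fun l hl => (totientRatio_weight_bounds (Nat.prime_of_mem_primesLE hl)).1) (by
        refine (Finset.sum_le_sum fun l hl =>
          (totientRatio_weight_bounds (Nat.prime_of_mem_primesLE hl)).2).trans ?_
        rw [← Finset.mul_sum]
        linarith [sum_primesLE_inv_sq_le ⌊x⌋₊]) (J - i) (Nat.sub_le _ _)
    have h3 := smoothSum_le_pow_mul (by linarith) hrat (J - (J - i)) (J - i) (by omega)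
    have h4 : J - i + (J - (J - i)) = J := by omega
    rw [h4] at h3
    have h5 : r ^ (J - (J - i)) ≤ r ^ I := pow_le_pow_right₀ hr (by omega)
    calc _ ≤ ∑ a ∈ A with J - a.primeFactors.card = i,
          ∏ l ∈ a.primeFactors, (|(1 - (l : ℝ)⁻¹)⁻¹| * ((l : ℝ)⁻¹) ^ a.factorization l) := by
          refine Finset.sum_le_sum fun a ha => ?_
          have ha0 : a ≠ 0 := by
            have := Finset.mem_Icc.1 (Finset.mem_filter.1 (Finset.mem_filter.1 ha).1).1
            omega
          rw [Finset.prod_mul_distrib, ← inv_eq_prod_primeFactors ha0, div_eq_mul_inv,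
            totientRatio]
          refine mul_le_mul_of_nonneg_right (Finset.prod_le_prod (fun l hl => ?_)
            fun l _ => le_abs_self _) (by positivity)
          exact zero_le_one.trans
            (one_le_inv_one_sub_inv_prime (Nat.prime_of_mem_primeFactors hl))
      _ ≤ exp (r * (8 + 2 / c)) * smoothSum c x (J - i) := h1.trans h2
      _ ≤ exp (r * (8 + 2 / c)) * (r ^ I * smoothSum c x J) := by
          refine mul_le_mul_of_nonneg_left (h3.trans ?_) (Real.exp_pos _).le
          exact mul_le_mul_of_nonneg_right h5 (smoothSum_nonneg c x J)
      _ = _ := by ring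
  refine (Finset.sum_le_sum hterm).trans ?_
  rw [Finset.sum_const, Finset.card_range, nsmul_eq_mul, ← mul_assoc]

lemma exists_tower_le {y : ℝ} (hy : 2 ≤ y) :
    ∃ J : ℕ, (2 : ℝ) ^ 2 ^ J ≤ y ∧ log y ≤ 2 * log ((2 : ℝ) ^ 2 ^ J) := by
  have hex : ∃ K : ℕ, y < (2 : ℝ) ^ 2 ^ K := by
    obtain ⟨n, hn⟩ := pow_unbounded_of_one_lt y (one_lt_two (α := ℝ))
    exact ⟨n, hn.trans_le (pow_le_pow_right₀ one_le_two Nat.lt_two_pow_self.le)⟩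
  obtain ⟨K, hK⟩ : ∃ K, Nat.find hex = K + 1 := by
    refine Nat.exists_eq_succ_of_ne_zero fun h => ?_
    have := Nat.find_spec hex
    rw [h] at this
    norm_num at this
    linarith
  refine ⟨K, not_lt.1 (Nat.find_min hex (by omega)), ?_⟩
  have h := Nat.find_spec hex
  rw [hK, pow_succ, pow_mul] at h
  have h2 := Real.log_le_log (by linarith) h.le
  rw [Real.log_pow] at h2
  exact_mod_cast h2

/-- The divisors `a` of integers with `J + 1` prime factors that miss between one and `I` of
them. -/
noncomputable def cofactors (x : ℝ) (J I : ℕ) : Finset ℕ :=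
  (Icc 1 ⌊x⌋₊).filter fun a => a.primeFactors.card ≤ J ∧ J + 1 ≤ a.primeFactors.card + I

lemma pow_card_le_roughPart {w : ℝ} (hw : 0 ≤ w) {m : ℕ} :
    w ^ (roughPart w m).primeFactors.card ≤ roughPart w m := by
  rw [primeFactors_roughPart, roughPart, ← Finset.prod_const]
  push_cast
  refine Finset.prod_le_prod (fun _ _ => hw) fun l hl => ?_
  obtain ⟨h1, h2⟩ := Finset.mem_filter.1 hl
  refine (not_le.1 h2).le.trans (le_self_pow₀ ?_ (factorization_ne_zero_of_mem h1))
  exact_mod_cast (Nat.prime_of_mem_primeFactors h1).one_le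

lemma smoothPart_mem_cofactors {x θ : ℝ} (hx : 1 < x) (hθ : 0 < θ) {m J : ℕ}
    (hm : m ∈ Icc 1 ⌊x⌋₊) (hJ : m.primeFactors.card = J + 1) (hlarge : √x < m)
    (hsmall : (smoothPart (x ^ θ) m : ℝ) ≤ √x) :
    smoothPart (x ^ θ) m ∈ cofactors x J ⌊1 / θ⌋₊ := by
  obtain ⟨h1, h2⟩ := Finset.mem_Icc.1 hm
  have hm0 : m ≠ 0 := by omega
  have hmx : (m : ℝ) ≤ x := (Nat.le_floor_iff (by linarith)).1 h2
  have hmul := smoothPart_mul_roughPart (x ^ θ) hm0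
  have hcard := card_primeFactors_smoothPart_add (x ^ θ) m
  have hrough : (roughPart (x ^ θ) m).primeFactors.card ≠ 0 := by
    intro h
    rw [Finset.card_eq_zero, Nat.primeFactors_eq_empty] at h
    have := roughPart_pos (x ^ θ) m
    have h : roughPart (x ^ θ) m = 1 := by omega
    rw [h, mul_one] at hmul
    rw [hmul] at hsmall
    linarith
  have hI : (roughPart (x ^ θ) m).primeFactors.card ≤ ⌊1 / θ⌋₊ := by
    refine Nat.le_floor ((le_div_iff₀ hθ).2 ?_)
    have h3 : (x ^ θ) ^ (roughPart (x ^ θ) m).primeFactors.card ≤ x := by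
      refine (pow_card_le_roughPart (by positivity)).trans (le_trans ?_ hmx)
      exact_mod_cast Nat.le_of_dvd (by omega) ⟨_, (mul_comm _ _).trans hmul |>.symm⟩
    rw [← Real.rpow_natCast, ← Real.rpow_mul (by linarith)] at h3
    have h4 := (Real.rpow_le_rpow_left_iff hx).1 (h3.trans (Real.rpow_one x).ge)
    linarith
  exact Finset.mem_filter.2 ⟨Finset.mem_Icc.2 ⟨smoothPart_pos _ _,
    (Nat.le_of_dvd (by omega) (smoothPart_dvd _ hm0)).trans h2⟩, by omega, by omega⟩

lemma not_dvd_div_smoothPart {w : ℝ} {m l : ℕ} (hm : m ≠ 0) (hl : l.Prime) (hlw : (l : ℝ) ≤ w) :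
    ¬ l ∣ m / smoothPart w m := by
  have h : m / smoothPart w m = roughPart w m :=
    Nat.div_eq_of_eq_mul_right (smoothPart_pos w m) (smoothPart_mul_roughPart w hm).symm
  rw [h]
  intro hdvd
  have := Nat.mem_primeFactors.2 ⟨hl, hdvd, (roughPart_pos w m).ne'⟩
  rw [primeFactors_roughPart] at this
  exact (Finset.mem_filter.1 this).2 hlw

lemma card_le_sum_siftedPairs {S U A Q F : Finset ℕ} {x D B : ℝ} {g h : ℕ → ℝ} (hD : 0 ≤ D)
    (hg : ∀ u ∈ U, 0 ≤ g u) (hS : ∀ m ∈ S, ∃ u ∈ U, ∃ a ∈ A, m ∈ siftedPairs Q F x a u)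
    (hbound : ∀ u ∈ U, ∀ a ∈ A, ((siftedPairs Q F x a u).card : ℝ) ≤ D * g u * h a)
    (hA : ∑ a ∈ A, h a ≤ B) :
    (S.card : ℝ) ≤ D * (∑ u ∈ U, g u) * B := by
  have hsub : S ⊆ U.biUnion fun u => A.biUnion fun a => siftedPairs Q F x a u := fun m hm => by
    obtain ⟨u, hu, a, ha, h⟩ := hS m hm
    exact Finset.mem_biUnion.2 ⟨u, hu, Finset.mem_biUnion.2 ⟨a, ha, h⟩⟩
  have hcard : S.card ≤ ∑ u ∈ U, ∑ a ∈ A, (siftedPairs Q F x a u).card :=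
    (Finset.card_le_card hsub).trans (Finset.card_biUnion_le.trans
      (Finset.sum_le_sum fun _ _ => Finset.card_biUnion_le))
  calc (S.card : ℝ) ≤ ∑ u ∈ U, ∑ a ∈ A, ((siftedPairs Q F x a u).card : ℝ) := by
        exact_mod_cast hcard
    _ ≤ ∑ u ∈ U, ∑ a ∈ A, D * g u * h a :=
        Finset.sum_le_sum fun u hu => Finset.sum_le_sum fun a ha => hbound u hu a ha
    _ = D * (∑ u ∈ U, g u) * ∑ a ∈ A, h a := by
        simp_rw [← Finset.mul_sum]
        rw [← Finset.sum_mul, ← Finset.mul_sum]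
    _ ≤ _ := mul_le_mul_of_nonneg_left hA (mul_nonneg hD (Finset.sum_nonneg hg))

open Filter in
/-- The integers `m ≤ x` with `J + 1` prime factors and small smooth part such that `m + 1` has a
prime factor in a sparse set of not too large primes. -/
theorem exists_card_shift_dvd_le {c r θ ε : ℝ} (hc : 0 < c) (hr : 1 ≤ r) (hθ : 0 < θ)
    (hθε : 20 * θ ≤ ε) (hε1 : ε ≤ 1) :
    ∃ C : ℝ, 0 < C ∧ ∀ᶠ x : ℝ in atTop, ∀ J : ℕ,
      (∀ j < J, smoothSum c x j ≤ r * smoothSum c x (j + 1)) →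
      ∀ P : Finset ℕ, (∀ p ∈ P, p.Prime ∧ (p : ℝ) ≤ x ^ (1 - ε)) →
      ∀ S : Finset ℕ, (∀ m ∈ S, m ∈ Icc 1 ⌊x⌋₊ ∧ m.primeFactors.card = J + 1 ∧ √x < m ∧
        (smoothPart (x ^ θ) m : ℝ) ≤ x ^ (ε / 2) ∧ ∃ p ∈ P, p ∣ m + 1) →
      (S.card : ℝ) ≤ C * (∑ p ∈ P, (1 : ℝ) / p) * mainSize c x J := by
  obtain ⟨C, hC, H⟩ := exists_card_siftedPairs_le
  set I := ⌊1 / θ⌋₊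
  refine ⟨C * (8 / θ) * (I * (exp (r * (8 + 2 / c)) * r ^ I) + 1), by positivity, ?_⟩
  filter_upwards [eventually_gt_atTop 1, (tendsto_rpow_atTop hθ).eventually_ge_atTop 2]
    with x hx hxθ J hrat P hP S hS
  have hx0 : 0 < x := by linarith
  have hL : 0 < log x := Real.log_pos hx
  obtain ⟨n, hn1, hn2⟩ := exists_tower_le hxθ
  rw [Real.log_rpow hx0] at hn2
  set W : ℕ := 2 ^ 2 ^ n with hW
  have hWc : ((2 : ℝ) ^ 2 ^ n) = W := by rw [hW]; push_cast; rfl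
  rw [hWc] at hn1 hn2
  have hW2 : 2 ≤ W := le_self_pow₀ one_le_two (by positivity)
  have hQ : ∀ l ∈ W.primesLE.erase 2, l.Prime ∧ 3 ≤ l ∧ l ≤ W := fun l hl => by
    obtain ⟨h1, h2⟩ := Finset.mem_erase.1 hl
    obtain ⟨h3, h4⟩ := Nat.mem_primesLE.1 h2
    have := h4.two_le
    exact ⟨h4, by omega, h3⟩
  have hW10 : (W : ℝ) ^ 10 ≤ x ^ (ε / 2) := by
    calc (W : ℝ) ^ 10 ≤ (x ^ θ) ^ 10 := pow_le_pow_left₀ (Nat.cast_nonneg W) hn1 10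
      _ = x ^ (θ * 10) := by
        rw [← Real.rpow_natCast, ← Real.rpow_mul hx0.le]; norm_num
      _ ≤ x ^ (ε / 2) := Real.rpow_le_rpow_of_exponent_le hx.le (by linarith)
  have hsqrt : x ^ (ε / 2) ≤ √x := by
    rw [Real.sqrt_eq_rpow]
    exact Real.rpow_le_rpow_of_exponent_le hx.le (by linarith)
  have hmain := card_le_sum_siftedPairs (U := P) (x := x) (F := ∅) (Q := W.primesLE.erase 2)
    (A := (cofactors x J I).filter fun a => (a : ℝ) ≤ x ^ (ε / 2))
    (S := S)
    (D := C * (8 / θ) * (x / log x)) (g := fun p => 1 / (p : ℝ))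
    (h := fun a => totientRatio a / a)
    (B := I * (exp (r * (8 + 2 / c)) * r ^ I) * smoothSum c x J)
    (by positivity) (fun _ _ => by positivity) ?_ ?_ ?_
  · refine hmain.trans ?_
    have e : C * (8 / θ) * (I * (exp (r * (8 + 2 / c)) * r ^ I) + 1) * (∑ p ∈ P, (1 : ℝ) / p) *
        mainSize c x J = C * (8 / θ) * (x / log x) * (∑ p ∈ P, (1 : ℝ) / p) *
        ((I * (exp (r * (8 + 2 / c)) * r ^ I) + 1) * smoothSum c x J) := by
      rw [mainSize]; ring
    rw [e]
    have := smoothSum_nonneg c x J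
    gcongr
    linarith
  · intro m hm
    obtain ⟨hm, hJ, hlarge, hsmall, p, hp, hpm⟩ := hS m hm
    have hm0 : m ≠ 0 := by have := Finset.mem_Icc.1 hm; omega
    refine ⟨p, hp, smoothPart (x ^ θ) m, Finset.mem_filter.2
      ⟨smoothPart_mem_cofactors hx hθ hm hJ hlarge (hsmall.trans hsqrt), hsmall⟩,
      Finset.mem_filter.2 ⟨hm, smoothPart_dvd _ hm0, hpm, fun l hl => ⟨?_, by simp⟩⟩⟩
    exact not_dvd_div_smoothPart hm0 (hQ l hl).1
      (le_trans (by exact_mod_cast (hQ l hl).2.2) hn1)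
  · intro p hp a ha
    obtain ⟨ha, hax⟩ := Finset.mem_filter.1 ha
    have ha0 : 0 < a := (Finset.mem_Icc.1 (Finset.mem_filter.1 ha).1).1
    obtain ⟨hp, hpx⟩ := hP p hp
    have hp0 := hp.pos
    have hcond : ((2 : ℝ) ^ 2 ^ n) ^ 10 ≤ x / (a * p) := by
      rw [hWc, le_div_iff₀ (by positivity)]
      calc (W : ℝ) ^ 10 * (a * p) ≤ x ^ (ε / 2) * (x ^ (ε / 2) * x ^ (1 - ε)) := by gcongr
        _ = x := by
          rw [← Real.rpow_add hx0, ← Real.rpow_add hx0]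
          ring_nf
          exact Real.rpow_one x
    have hlogW : 0 < log (W : ℝ) := Real.log_pos (by exact_mod_cast hW2)
    have h1 := one_le_totientRatio a
    calc _ ≤ C * (x / (a * p)) * ∏ l ∈ W.primesLE.erase 2, (1 - (sieveDim ∅ a p l : ℝ) / l) :=
          H n _ ∅ x a p hQ ha0 hp0 hcond
      _ ≤ C * (x / (a * p)) * (2 / (θ * log x / 2) * 2) := by
          refine mul_le_mul_of_nonneg_left ((prod_one_sub_sieveDim_empty_le hW2 hp.ne_zero).trans
            ?_) (by positivity)
          exact mul_le_mul (div_le_div_of_nonneg_left (by norm_num) (by positivity) (by linarith))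
            (totientRatio_prime_le hp) (zero_le_one.trans (one_le_totientRatio p)) (by positivity)
      _ = C * (8 / θ) * (x / log x) * (1 / p) * (1 / a) := by field_simp; norm_num
      _ ≤ C * (8 / θ) * (x / log x) * (1 / p) * (totientRatio a / a) := by gcongr
  · refine (Finset.sum_le_sum_of_subset_of_nonneg (Finset.filter_subset _ _)
      fun a _ _ => div_nonneg (zero_le_one.trans (one_le_totientRatio a)) (Nat.cast_nonneg a)).trans
      (sum_totientRatio_div_le hc hr hx hrat I)

open Filter in
/-- The integers `m ≤ x` with `J + 1` prime factors and small smooth part such that `m + 1` has a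
very large prime factor. -/
theorem exists_card_shift_large_prime_le {c r θ : ℝ} (hc : 0 < c) (hr : 1 ≤ r) (hθ : 0 < θ)
    (hθ1 : 20 * θ ≤ 1) :
    ∃ C : ℝ, 0 < C ∧ ∀ ε : ℝ, 0 < ε → ε ≤ 1 / 4 → ∀ᶠ x : ℝ in atTop, ∀ J : ℕ,
      (∀ j < J, smoothSum c x j ≤ r * smoothSum c x (j + 1)) →
      ∀ S : Finset ℕ, (∀ m ∈ S, m ∈ Icc 1 ⌊x⌋₊ ∧ m.primeFactors.card = J + 1 ∧ √x < m ∧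
        (smoothPart (x ^ θ) m : ℝ) ≤ x ^ (1 / 4 : ℝ) ∧ m + 1 ≤ ⌊x⌋₊ ∧
        ∃ p : ℕ, p.Prime ∧ x ^ (1 - ε) < p ∧ p ∣ m + 1) →
      (S.card : ℝ) ≤ C * ε * mainSize c x J := by
  obtain ⟨C, hC, H⟩ := exists_card_siftedPairs_le
  obtain ⟨C', hC', H'⟩ := exists_sum_divisors_rpow_le
  set I := ⌊1 / θ⌋₊
  refine ⟨C * (16 / θ ^ 2) * (4 * C') * (I * (exp (r * (8 + 2 / c)) * r ^ I) + 1),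
    by positivity, fun ε hε hε1 => ?_⟩
  filter_upwards [eventually_gt_atTop 1, (tendsto_rpow_atTop hθ).eventually_ge_atTop 2,
    Real.tendsto_log_atTop.eventually_ge_atTop (1 / ε)]
    with x hx hxθ hlogx J hrat S hS
  have hx0 : 0 < x := by linarith
  have hL : 0 < log x := Real.log_pos hx
  obtain ⟨n, hn1, hn2⟩ := exists_tower_le hxθ
  rw [Real.log_rpow hx0] at hn2
  set W : ℕ := 2 ^ 2 ^ n with hW
  have hWc : ((2 : ℝ) ^ 2 ^ n) = W := by rw [hW]; push_cast; rfl
  rw [hWc] at hn1 hn2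
  have hW2 : 2 ≤ W := le_self_pow₀ one_le_two (by positivity)
  have hQ : ∀ l ∈ W.primesLE.erase 2, l.Prime ∧ 3 ≤ l ∧ l ≤ W := fun l hl => by
    obtain ⟨h1, h2⟩ := Finset.mem_erase.1 hl
    obtain ⟨h3, h4⟩ := Nat.mem_primesLE.1 h2
    have := h4.two_le
    exact ⟨h4, by omega, h3⟩
  have hW10 : (W : ℝ) ^ 10 ≤ x ^ (1 / 2 : ℝ) := by
    calc (W : ℝ) ^ 10 ≤ (x ^ θ) ^ 10 := pow_le_pow_left₀ (Nat.cast_nonneg W) hn1 10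
      _ = x ^ (θ * 10) := by
        rw [← Real.rpow_natCast, ← Real.rpow_mul hx0.le]; norm_num
      _ ≤ x ^ (1 / 2 : ℝ) := Real.rpow_le_rpow_of_exponent_le hx.le (by linarith)
  have hsqrt : x ^ (1 / 4 : ℝ) ≤ √x := by
    rw [Real.sqrt_eq_rpow]
    exact Real.rpow_le_rpow_of_exponent_le hx.le (by norm_num)
  have hxε : 1 ≤ x ^ ε := Real.one_le_rpow hx.le hε.le
  have hsum : ∑ t ∈ Icc 1 ⌊x ^ ε⌋₊, totientRatio t / t ≤ 4 * C' * (ε * log x) := by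
    have h1 : 1 ≤ ⌊x ^ ε⌋₊ := Nat.le_floor (by exact_mod_cast hxε)
    have h2 : log (⌊x ^ ε⌋₊ : ℝ) ≤ ε * log x := by
      rw [← Real.log_rpow hx0]
      exact Real.log_le_log (by exact_mod_cast h1) (Nat.floor_le (by positivity))
    have h3 : 1 ≤ ε * log x := by rwa [div_le_iff₀ hε, mul_comm] at hlogx
    calc _ ≤ ∑ t ∈ Icc 1 ⌊x ^ ε⌋₊,
          2 * ((t : ℝ)⁻¹ * ∑ d ∈ t.divisors, (d : ℝ) ^ (-(1 / 2) : ℝ)) := by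
          refine Finset.sum_le_sum fun t ht => ?_
          have ht0 : t ≠ 0 := by have := Finset.mem_Icc.1 ht; omega
          rw [mul_left_comm, div_eq_inv_mul]
          exact mul_le_mul_of_nonneg_left (totientRatio_le_sum_divisors ht0) (by positivity)
      _ ≤ 2 * (C' * (1 + log (⌊x ^ ε⌋₊ : ℝ))) := by
          rw [← Finset.mul_sum]
          exact mul_le_mul_of_nonneg_left (H' _ h1) zero_le_two
      _ ≤ 2 * (C' * (ε * log x + ε * log x)) := by gcongr
      _ = _ := by ring
  have hmain := card_le_sum_siftedPairs (U := Icc 1 ⌊x ^ ε⌋₊) (x := x)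
    (F := W.primesLE.erase 2) (Q := W.primesLE.erase 2)
    (A := (cofactors x J I).filter fun a => (a : ℝ) ≤ x ^ (1 / 4 : ℝ))
    (S := S)
    (D := C * (16 / θ ^ 2) * (x / log x ^ 2)) (g := fun t => totientRatio t / t)
    (h := fun a => totientRatio a / a)
    (B := I * (exp (r * (8 + 2 / c)) * r ^ I) * smoothSum c x J)
    (by positivity) (fun t _ => div_nonneg (zero_le_one.trans (one_le_totientRatio t))
      (Nat.cast_nonneg t)) ?_ ?_ ?_
  · refine hmain.trans ?_
    have hs := smoothSum_nonneg c x J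
    calc _ ≤ C * (16 / θ ^ 2) * (x / log x ^ 2) * (4 * C' * (ε * log x)) *
          ((I * (exp (r * (8 + 2 / c)) * r ^ I) + 1) * smoothSum c x J) := by
          gcongr
          linarith
      _ = _ := by rw [mainSize]; field_simp
  · intro m hm
    obtain ⟨hm, hJ, hlarge, hsmall, hm1, p, hp, hpx, t, hpm⟩ := hS m hm
    have hm0 : m ≠ 0 := by have := Finset.mem_Icc.1 hm; omega
    have ht0 : 0 < t := Nat.pos_of_ne_zero fun h => by simp [h] at hpm
    have htx : (t : ℝ) ≤ x ^ ε := by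
      have h1 : (p : ℝ) * t ≤ x := by
        have := (Nat.le_floor_iff hx0.le).1 hm1
        rw [hpm] at this
        exact_mod_cast this
      have h2 : x ^ (1 - ε) * x ^ ε = x := by
        rw [← Real.rpow_add hx0, sub_add_cancel, Real.rpow_one]
      have h3 : 0 < x ^ (1 - ε) := by positivity
      have h4 : x ^ (1 - ε) * t ≤ x ^ (1 - ε) * x ^ ε := by
        rw [h2]
        exact (mul_le_mul_of_nonneg_right hpx.le (Nat.cast_nonneg t)).trans h1
      exact le_of_mul_le_mul_left h4 h3
    have hdiv : (m + 1) / t = p := Nat.div_eq_of_eq_mul_left ht0 hpm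
    refine ⟨t, Finset.mem_Icc.2 ⟨ht0, Nat.le_floor htx⟩, smoothPart (x ^ θ) m,
      Finset.mem_filter.2
      ⟨smoothPart_mem_cofactors hx hθ hm hJ hlarge (hsmall.trans hsqrt), hsmall⟩,
      Finset.mem_filter.2 ⟨hm, smoothPart_dvd _ hm0, ⟨p, hpm.trans (mul_comm _ _)⟩,
        fun l hl => ?_⟩⟩
    have hlW : (l : ℝ) ≤ x ^ θ := le_trans (by exact_mod_cast (hQ l hl).2.2) hn1
    refine ⟨not_dvd_div_smoothPart hm0 (hQ l hl).1 hlW, fun _ hdvd => ?_⟩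
    rw [hdiv, Nat.prime_dvd_prime_iff_eq (hQ l hl).1 hp] at hdvd
    have := Real.rpow_le_rpow_of_exponent_le hx.le (show θ ≤ 1 - ε by linarith)
    rw [hdvd] at hlW
    linarith
  · intro t ht a ha
    obtain ⟨ha, hax⟩ := Finset.mem_filter.1 ha
    have ha0 : 0 < a := (Finset.mem_Icc.1 (Finset.mem_filter.1 ha).1).1
    obtain ⟨ht0, htx⟩ := Finset.mem_Icc.1 ht
    have ht0 : 0 < t := ht0
    have htx : (t : ℝ) ≤ x ^ (1 / 4 : ℝ) :=
      ((Nat.le_floor_iff (by positivity)).1 htx).trans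
        (Real.rpow_le_rpow_of_exponent_le hx.le hε1)
    have hcond : ((2 : ℝ) ^ 2 ^ n) ^ 10 ≤ x / (a * t) := by
      rw [hWc, le_div_iff₀ (by positivity)]
      calc (W : ℝ) ^ 10 * (a * t)
          ≤ x ^ (1 / 2 : ℝ) * (x ^ (1 / 4 : ℝ) * x ^ (1 / 4 : ℝ)) := by gcongr
        _ = x := by
          rw [← Real.rpow_add hx0, ← Real.rpow_add hx0]
          norm_num
    have hlogW : 0 < log (W : ℝ) := Real.log_pos (by exact_mod_cast hW2)
    have h1 := one_le_totientRatio a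
    have h2 := one_le_totientRatio t
    calc _ ≤ C * (x / (a * t)) * ∏ l ∈ W.primesLE.erase 2,
            (1 - (sieveDim (W.primesLE.erase 2) a t l : ℝ) / l) :=
          H n _ _ x a t hQ ha0 ht0 hcond
      _ ≤ C * (x / (a * t)) * ((2 / (θ * log x / 2)) ^ 2 * totientRatio t * totientRatio a) := by
          refine mul_le_mul_of_nonneg_left
            ((prod_one_sub_sieveDim_self_le hW2 ha0.ne' ht0.ne').trans ?_) (by positivity)
          gcongr
          linarith
      _ = C * (16 / θ ^ 2) * (x / log x ^ 2) * (totientRatio t / t) * (totientRatio a / a) := by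
          field_simp; norm_num
  · refine (Finset.sum_le_sum_of_subset_of_nonneg (Finset.filter_subset _ _)
      fun a _ _ => div_nonneg (zero_le_one.trans (one_le_totientRatio a)) (Nat.cast_nonneg a)).trans
      (sum_totientRatio_div_le hc hr hx hrat I)

/-- Uniformly for `1 ≤ k ≤ R log log x` and all sets `P` of primes in `[2,x]` with
`∑_{p∈P} 1/p = o(1)`, the number of `1 < n ≤ x` with `ω(n−1) = k` and some prime
factor in `P` is `o(π_k(x))`. -/
theorem stmt_10 (R : ℝ) (hR : 0 < R) :
    ∀ δ : ℝ, 0 < δ → ∃ η : ℝ, 0 < η ∧ ∃ x₀ : ℝ, ∀ x : ℝ, x₀ ≤ x →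
      ∀ k : ℕ, 1 ≤ k → (k : ℝ) ≤ R * Real.log (Real.log x) →
      ∀ P : Finset ℕ, (∀ p ∈ P, p.Prime ∧ ((p : ℕ) : ℝ) ≤ x) →
        (∑ p ∈ P, (1 : ℝ) / p) ≤ η →
        (((Finset.Icc 2 ⌊x⌋₊).filter
            (fun n => (n - 1).primeFactors.card = k ∧ ∃ p ∈ P, p ∣ n)).card : ℝ)
          ≤ δ * (pik k x : ℝ) := by
  classical
  intro δ hδ
  obtain ⟨r, c, hr, hc, hpik⟩ := exists_mainSize_le_pik hR
  obtain ⟨θ₂, hθ₂, hθ₂', hL₂⟩ := exists_card_large_smoothPart_le (R := R) (ε := 1 / 4)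
    (δ := δ / 40) hc hr (by norm_num) (by norm_num) (by positivity)
  obtain ⟨C₂, hC₂, hS₂⟩ := exists_card_shift_large_prime_le hc hr hθ₂ (by linarith)
  obtain ⟨ε, hε, hε1, hεC⟩ : ∃ ε : ℝ, 0 < ε ∧ ε ≤ 1 / 4 ∧ C₂ * ε ≤ δ / 40 :=
    ⟨min (1 / 4) (δ / 40 / C₂), by positivity, min_le_left _ _, by
      rw [mul_comm, ← le_div_iff₀ hC₂]; exact min_le_right _ _⟩
  obtain ⟨θ₁, hθ₁, hθ₁', hL₁⟩ := exists_card_large_smoothPart_le (R := R) (ε := ε / 4)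
    (δ := δ / 40) hc hr (by positivity) (by linarith) (by positivity)
  obtain ⟨C₁, hC₁, hS₁⟩ := exists_card_shift_dvd_le (ε := ε) hc hr hθ₁ (by linarith) (by linarith)
  refine ⟨δ / 40 / C₁, by positivity, Filter.eventually_atTop.1 ?_⟩
  filter_upwards [hpik, hL₂, hL₁, hS₁, hS₂ ε hε hε1, Filter.eventually_gt_atTop 1,
    rpow_le_mul_mainSize (c := c) (R := R) (τ := 1 / 2) (δ := δ / 40) hr (by norm_num)
      (by positivity)]
    with x hpik hL₂ hL₁ hS₁ hS₂ hx hsqrt k hk hkR P hP hPη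
  obtain ⟨J, rfl⟩ : ∃ J, k = J + 1 := ⟨k - 1, by omega⟩
  have hJ : (J + 1 : ℝ) ≤ R * log (log x) := by exact_mod_cast hkR
  obtain ⟨hrat, hpik⟩ := hpik J hJ
  have hx0 : 0 < x := by linarith
  set B := (Finset.Icc 2 ⌊x⌋₊).filter
    (fun n => (n - 1).primeFactors.card = J + 1 ∧ ∃ p ∈ P, p ∣ n) with hB
  set M := B.image (fun n => n - 1) with hM
  have hBM : B.card = M.card := by
    refine (Finset.card_image_of_injOn fun n hn n' hn' h => ?_).symm
    have h1 := Finset.mem_Icc.1 (Finset.mem_filter.1 hn).1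
    have h2 := Finset.mem_Icc.1 (Finset.mem_filter.1 hn').1
    have h : n - 1 = n' - 1 := h
    omega
  have hMmem : ∀ m ∈ M, m ∈ Icc 1 ⌊x⌋₊ ∧ m.primeFactors.card = J + 1 ∧ m + 1 ≤ ⌊x⌋₊ ∧
      ∃ p ∈ P, p ∣ m + 1 := by
    intro m hm
    obtain ⟨n, hn, rfl⟩ := Finset.mem_image.1 hm
    obtain ⟨h1, h2, p, hp, hpn⟩ := Finset.mem_filter.1 hn
    obtain ⟨h3, h4⟩ := Finset.mem_Icc.1 h1
    exact ⟨Finset.mem_Icc.2 ⟨by omega, by omega⟩, h2, by omega, p, hp,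
      by rwa [Nat.sub_add_cancel (by omega)]⟩
  set L₁ := (Icc 1 ⌊x⌋₊).filter fun m => m.primeFactors.card = J + 1 ∧
    x ^ (ε / 4) < smoothPart (x ^ θ₁) m
  set L₂ := (Icc 1 ⌊x⌋₊).filter fun m => m.primeFactors.card = J + 1 ∧
    x ^ (1 / 4 : ℝ) < smoothPart (x ^ θ₂) m
  set P' := P.filter fun p : ℕ => (p : ℝ) ≤ x ^ (1 - ε)
  set S₁ := M.filter fun m : ℕ => √x < m ∧ (smoothPart (x ^ θ₁) m : ℝ) ≤ x ^ (ε / 2) ∧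
    ∃ p ∈ P', p ∣ m + 1
  set S₂ := M.filter fun m : ℕ => √x < m ∧ (smoothPart (x ^ θ₂) m : ℝ) ≤ x ^ (1 / 4 : ℝ) ∧
    ∃ p : ℕ, p.Prime ∧ x ^ (1 - ε) < p ∧ p ∣ m + 1
  have hS₁card : (S₁.card : ℝ) ≤ δ / 40 * mainSize c x J := by
    refine (hS₁ J hrat P' (fun p hp => ⟨(hP p (Finset.mem_filter.1 hp).1).1,
      (Finset.mem_filter.1 hp).2⟩) S₁ fun m hm => ?_).trans ?_
    · obtain ⟨hm, h⟩ := Finset.mem_filter.1 hm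
      exact ⟨(hMmem m hm).1, (hMmem m hm).2.1, h⟩
    · have hsum : ∑ p ∈ P', (1 : ℝ) / p ≤ δ / 40 / C₁ :=
        (Finset.sum_le_sum_of_subset_of_nonneg (Finset.filter_subset _ _)
          fun p _ _ => by positivity).trans hPη
      refine mul_le_mul_of_nonneg_right ?_ (mul_nonneg (div_nonneg hx0.le
        (Real.log_pos hx).le) (smoothSum_nonneg c x J))
      rwa [mul_comm, ← le_div_iff₀ hC₁]
  have hS₂card : (S₂.card : ℝ) ≤ δ / 40 * mainSize c x J := by
    refine (hS₂ J hrat S₂ fun m hm => ?_).trans (mul_le_mul_of_nonneg_right hεC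
      (mul_nonneg (div_nonneg hx0.le (Real.log_pos hx).le) (smoothSum_nonneg c x J)))
    obtain ⟨hm, h1, h2, h3⟩ := Finset.mem_filter.1 hm
    obtain ⟨h4, h5, h6, -⟩ := hMmem m hm
    exact ⟨h4, h5, h1, h2, h6, h3⟩
  have hsmall : ((Icc 1 ⌊√x⌋₊).card : ℝ) ≤ δ / 40 * mainSize c x J := by
    rw [Nat.card_Icc, Nat.add_sub_cancel]
    refine (Nat.floor_le (Real.sqrt_nonneg x)).trans (le_trans (le_of_eq ?_) (hsqrt J hJ hrat))
    rw [Real.sqrt_eq_rpow]; norm_num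
  have hsub : M ⊆ L₁ ∪ L₂ ∪ Icc 1 ⌊√x⌋₊ ∪ S₁ ∪ S₂ := by
    intro m hm
    obtain ⟨h1, h2, h3, p, hp, hpm⟩ := hMmem m hm
    simp only [Finset.mem_union]
    by_cases hsq : √x < m
    swap
    · exact .inl (.inl (.inr (Finset.mem_Icc.2
        ⟨(Finset.mem_Icc.1 h1).1, Nat.le_floor (not_lt.1 hsq)⟩)))
    by_cases hpx : (p : ℝ) ≤ x ^ (1 - ε)
    · by_cases hs : x ^ (ε / 4) < smoothPart (x ^ θ₁) m
      · exact .inl (.inl (.inl (.inl (Finset.mem_filter.2 ⟨h1, h2, hs⟩))))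
      · exact .inl (.inr (Finset.mem_filter.2 ⟨hm, hsq, (not_lt.1 hs).trans
          (Real.rpow_le_rpow_of_exponent_le hx.le (by linarith)), p,
          Finset.mem_filter.2 ⟨hp, hpx⟩, hpm⟩))
    · by_cases hs : x ^ (1 / 4 : ℝ) < smoothPart (x ^ θ₂) m
      · exact .inl (.inl (.inl (.inr (Finset.mem_filter.2 ⟨h1, h2, hs⟩))))
      · exact .inr (Finset.mem_filter.2 ⟨hm, hsq, not_lt.1 hs, p, (hP p hp).1,
          not_le.1 hpx, hpm⟩)
  have hcard : (M.card : ℝ) ≤ L₁.card + L₂.card + (Icc 1 ⌊√x⌋₊).card + S₁.card + S₂.card := by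
    have h1 := Finset.card_le_card hsub
    have h2 := Finset.card_union_le (L₁ ∪ L₂ ∪ Icc 1 ⌊√x⌋₊ ∪ S₁) S₂
    have h3 := Finset.card_union_le (L₁ ∪ L₂ ∪ Icc 1 ⌊√x⌋₊) S₁
    have h4 := Finset.card_union_le (L₁ ∪ L₂) (Icc 1 ⌊√x⌋₊)
    have h5 := Finset.card_union_le L₁ L₂
    exact_mod_cast (show M.card ≤ L₁.card + L₂.card + (Icc 1 ⌊√x⌋₊).card + S₁.card + S₂.card by
      omega)
  have hL₁card := hL₁ J hJ hrat
  have hL₂card := hL₂ J hJ hrat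
  rw [hBM]
  have hfin : δ / 8 * mainSize c x J ≤ δ / 8 * (8 * pik (J + 1) x) :=
    mul_le_mul_of_nonneg_left hpik (by positivity)
  linarith
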